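/- Let n ≥ 2, let 0 ≤ k ≤ n−2, and let Φ be a translation invariant curvature measure on ℝⁿ that is homogeneous of degree k and simple, i.e., Φ(K, β) = 0 for every Borel set β whenever the convex body K has empty interior. Then Φ(K, ℝⁿ) = 0 for every convex body K, and Φ is even, i.e., Φ(−K, −β) = Φ(K, β) for every convex body K and Borel set β. Moreover, if k ≤ n−3, then Φ = 0. -/

import Mathlib

open MeasureTheory Metric Filter Topology
open scoped Pointwise

/-- ℝⁿ as Euclidean space. -/
abbrev Rn (n : ℕ) := EuclideanSpace ℝ (Fin n)

/-- A convex body: a nonempty compact convex subset of ℝⁿ. -/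
def IsConvexBody {n : ℕ} (K : Set (Rn n)) : Prop :=
  K.Nonempty ∧ IsCompact K ∧ Convex ℝ K

/-- Integral of a complex-valued function against a finite complex Borel measure,
defined via the Jordan decompositions of the real and imaginary parts. -/
noncomputable def cmIntegral {n : ℕ} (μ : ComplexMeasure (Rn n)) (f : Rn n → ℂ) : ℂ :=
  ((∫ x, f x ∂(ComplexMeasure.re μ).toJordanDecomposition.posPart)
    - (∫ x, f x ∂(ComplexMeasure.re μ).toJordanDecomposition.negPart))
  + Complex.I * ((∫ x, f x ∂(ComplexMeasure.im μ).toJordanDecomposition.posPart)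
    - (∫ x, f x ∂(ComplexMeasure.im μ).toJordanDecomposition.negPart))

/-- The total variation measure of a finite complex Borel measure (a set is null for this
measure iff it is null for the classical total variation measure). -/
noncomputable def cmVariation {n : ℕ} (μ : ComplexMeasure (Rn n)) : Measure (Rn n) :=
  (ComplexMeasure.re μ).totalVariation + (ComplexMeasure.im μ).totalVariation

/-- A translation invariant curvature measure on ℝⁿ: a map assigning to each convex body
a finite complex Borel measure, which is local, translation invariant, and weakly continuous
with respect to Hausdorff convergence of convex bodies. -/
structure CurvatureMeasure (n : ℕ) where
  /-- the finite complex Borel measure associated to a convex body -/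
  meas : Set (Rn n) → ComplexMeasure (Rn n)
  locality : ∀ K L U : Set (Rn n), IsConvexBody K → IsConvexBody L → IsOpen U →
    K ∩ U = L ∩ U → ∀ β : Set (Rn n), MeasurableSet β → β ⊆ U → meas K β = meas L β
  translation_invariant : ∀ K : Set (Rn n), IsConvexBody K → ∀ x : Rn n,
    ∀ β : Set (Rn n), MeasurableSet β →
      meas ((fun y => y + x) '' K) ((fun y => y + x) '' β) = meas K β
  continuity : ∀ (Ki : ℕ → Set (Rn n)) (K : Set (Rn n)), (∀ i, IsConvexBody (Ki i)) →
    IsConvexBody K → Tendsto (fun i => hausdorffDist (Ki i) K) atTop (𝓝 0) →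
    ∀ f : BoundedContinuousFunction (Rn n) ℂ,
      Tendsto (fun i => cmIntegral (meas (Ki i)) f) atTop (𝓝 (cmIntegral (meas K) f))

/-- A curvature measure is homogeneous of degree `k`. -/
def CurvatureMeasure.Homogeneous {n : ℕ} (Φ : CurvatureMeasure n) (k : ℕ) : Prop :=
  ∀ t : ℝ, 0 < t → ∀ K : Set (Rn n), IsConvexBody K → ∀ β : Set (Rn n), MeasurableSet β →
    Φ.meas (t • K) (t • β) = (t : ℂ) ^ k * Φ.meas K β

/-- A curvature measure is SO(n) invariant: invariant under every orientation preserving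
linear isometry (rotation) of ℝⁿ. -/
def CurvatureMeasure.SOInvariant {n : ℕ} (Φ : CurvatureMeasure n) : Prop :=
  ∀ ρ : Rn n ≃ₗᵢ[ℝ] Rn n, 0 < LinearMap.det (ρ.toLinearEquiv : Rn n →ₗ[ℝ] Rn n) →
    ∀ K : Set (Rn n), IsConvexBody K → ∀ β : Set (Rn n), MeasurableSet β →
      Φ.meas (ρ '' K) (ρ '' β) = Φ.meas K β

section

open MeasureTheory Metric Filter Topology
open scoped Pointwise

section basics
variable {n m : ℕ}

/-- Hausdorff convergence, elementary form. -/
def HC {E : Type*} [PseudoMetricSpace E] (Ki : ℕ → Set E) (K : Set E) : Prop :=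
  ∀ ε : ℝ, 0 < ε → ∀ᶠ i in atTop, (∀ x ∈ Ki i, ∃ y ∈ K, dist x y ≤ ε) ∧
    (∀ y ∈ K, ∃ x ∈ Ki i, dist y x ≤ ε)

theorem HC.hausdorff {E : Type*} [PseudoMetricSpace E] {Ki : ℕ → Set E} {K : Set E}
    (h : HC Ki K) : Tendsto (fun i => hausdorffDist (Ki i) K) atTop (𝓝 0) := by
  rw [Metric.tendsto_atTop]
  intro ε hε
  obtain ⟨N, hN⟩ := eventually_atTop.1 (h (ε/2) (by positivity))
  refine ⟨N, fun i hi => ?_⟩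
  obtain ⟨h1, h2⟩ := hN i hi
  have := hausdorffDist_le_of_mem_dist (by positivity) h1 h2
  rw [Real.dist_eq, sub_zero, abs_of_nonneg hausdorffDist_nonneg]
  linarith

theorem HC.const {E : Type*} [PseudoMetricSpace E] (K : Set E) : HC (fun _ => K) K := by
  intro ε hε
  refine Eventually.of_forall fun i => ⟨fun x hx => ⟨x, hx, by simp [hε.le]⟩,
    fun x hx => ⟨x, hx, by simp [hε.le]⟩⟩

theorem HC.image {E F : Type*} [PseudoMetricSpace E] [PseudoMetricSpace F]
    {Ki : ℕ → Set E} {K : Set E}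
    (h : HC Ki K) {C : NNReal} {f : E → F} (hf : LipschitzWith C f) :
    HC (fun i => f '' Ki i) (f '' K) := by
  intro ε hε
  have hC : 0 < (C : ℝ) + 1 := by positivity
  filter_upwards [h (ε / (C+1)) (by positivity)] with i hi
  have key : ∀ x y, dist x y ≤ ε / (C+1) → dist (f x) (f y) ≤ ε := by
    intro x y hxy
    calc dist (f x) (f y) ≤ C * dist x y := hf.dist_le_mul x y
      _ ≤ (C+1) * (ε / (C+1)) := by gcongr; linarith
      _ = ε := by field_simp
  refine ⟨?_, ?_⟩
  · rintro _ ⟨x, hx, rfl⟩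
    obtain ⟨y, hy, hxy⟩ := hi.1 x hx
    exact ⟨_, ⟨y, hy, rfl⟩, key _ _ hxy⟩
  · rintro _ ⟨x, hx, rfl⟩
    obtain ⟨y, hy, hxy⟩ := hi.2 x hx
    exact ⟨_, ⟨y, hy, rfl⟩, key _ _ hxy⟩

theorem HC.prod {E F : Type*} [PseudoMetricSpace E] [PseudoMetricSpace F]
    {Ki : ℕ → Set E} {K : Set E} {Mi : ℕ → Set F} {M : Set F}
    (h : HC Ki K) (h' : HC Mi M) : HC (fun i => Ki i ×ˢ Mi i) (K ×ˢ M) := by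
  intro ε hε
  filter_upwards [h ε hε, h' ε hε] with i hi hi2
  refine ⟨?_, ?_⟩
  · rintro ⟨x, y⟩ ⟨hx, hy⟩
    obtain ⟨x2, hx2, hd⟩ := hi.1 x hx
    obtain ⟨y2, hy2, hd2⟩ := hi2.1 y hy
    exact ⟨(x2, y2), ⟨hx2, hy2⟩, by simp [Prod.dist_eq, hd, hd2]⟩
  · rintro ⟨x, y⟩ ⟨hx, hy⟩
    obtain ⟨x2, hx2, hd⟩ := hi.2 x hx
    obtain ⟨y2, hy2, hd2⟩ := hi2.2 y hy
    exact ⟨(x2, y2), ⟨hx2, hy2⟩, by simp [Prod.dist_eq, hd, hd2]⟩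

theorem HC.Icc {a b : ℕ → ℝ} {a0 b0 : ℝ} (hab : ∀ i, a i ≤ b i) (h0 : a0 ≤ b0)
    (ha : Tendsto a atTop (𝓝 a0)) (hb : Tendsto b atTop (𝓝 b0)) :
    HC (fun i => Set.Icc (a i) (b i)) (Set.Icc a0 b0) := by
  intro ε hε
  filter_upwards [(Metric.tendsto_nhds.1 ha) ε hε, (Metric.tendsto_nhds.1 hb) ε hε] with i h1 h2
  rw [Real.dist_eq, abs_lt] at h1 h2
  have key : ∀ (a b a' b' x : ℝ), a' ≤ b' → a - ε ≤ a' → a' ≤ a + ε → b - ε ≤ b' →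
      b' ≤ b + ε → x ∈ Set.Icc a b → ∃ y ∈ Set.Icc a' b', dist x y ≤ ε := by
    intro a b a' b' x h h1 h2 h3 h4 hx
    refine ⟨max a' (min x b'), ⟨le_max_left _ _, max_le h (min_le_right _ _)⟩, ?_⟩
    have := hx.1; have := hx.2
    rw [Real.dist_eq, abs_le]
    rcases max_cases a' (min x b') with h5 | h5 <;> rcases min_cases x b' with h6 | h6 <;>
      constructor <;> linarith
  refine ⟨fun x hx => key _ _ _ _ _ h0 ?_ ?_ ?_ ?_ hx, fun x hx => key _ _ _ _ _ (hab i) ?_ ?_ ?_ ?_ hx⟩ <;> linarith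

theorem HC.comp {E : Type*} [PseudoMetricSpace E] {Ki : ℕ → Set E} {K : Set E}
    (h : HC Ki K) {u : ℕ → ℕ} (hu : Tendsto u atTop atTop) : HC (fun i => Ki (u i)) K :=
  fun ε hε => hu.eventually (h ε hε)

theorem HC.of_dist {E : Type*} [PseudoMetricSpace E] {Ki : ℕ → Set E} {K : Set E} {δ : ℕ → ℝ}
    (hδ : Tendsto δ atTop (𝓝 0)) (h : ∀ i, (∀ x ∈ Ki i, ∃ y ∈ K, dist x y ≤ δ i) ∧
    (∀ y ∈ K, ∃ x ∈ Ki i, dist y x ≤ δ i)) : HC Ki K := by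
  intro ε hε
  filter_upwards [hδ.eventually (gt_mem_nhds hε)] with i hi
  refine ⟨fun x hx => ?_, fun x hx => ?_⟩
  · obtain ⟨y, hy, h1⟩ := (h i).1 x hx
    exact ⟨y, hy, h1.trans hi.le⟩
  · obtain ⟨y, hy, h1⟩ := (h i).2 x hx
    exact ⟨y, hy, h1.trans hi.le⟩

theorem IsConvexBody.isCompact {K : Set (Rn n)} (h : IsConvexBody K) : IsCompact K := h.2.1
theorem IsConvexBody.convex {K : Set (Rn n)} (h : IsConvexBody K) : Convex ℝ K := h.2.2
theorem IsConvexBody.isClosed {K : Set (Rn n)} (h : IsConvexBody K) : IsClosed K := h.2.1.isClosed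

theorem IsConvexBody.translate {K : Set (Rn n)} (h : IsConvexBody K) (a : Rn n) :
    IsConvexBody ((fun y => y + a) '' K) := by
  refine ⟨h.1.image _, h.2.1.image (by fun_prop), ?_⟩
  have := h.2.2.translate a
  simpa [add_comm] using this

theorem IsConvexBody.linImage {K : Set (Rn n)} (h : IsConvexBody K) (f : Rn n →L[ℝ] Rn m) :
    IsConvexBody (f '' K) :=
  ⟨h.1.image _, h.2.1.image f.continuous, h.2.2.linear_image (f : Rn n →ₗ[ℝ] Rn m)⟩

theorem IsConvexBody.smul {K : Set (Rn n)} (h : IsConvexBody K) (t : ℝ) :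
    IsConvexBody (t • K) := ⟨h.1.smul_set, h.2.1.smul t, h.2.2.smul t⟩

theorem IsConvexBody.neg {K : Set (Rn n)} (h : IsConvexBody K) :
    IsConvexBody (-K) := ⟨h.1.neg, h.2.1.neg, h.2.2.neg⟩

theorem IsConvexBody.add {K K' : Set (Rn n)} (h : IsConvexBody K) (h' : IsConvexBody K') :
    IsConvexBody (K + K') := ⟨h.1.add h'.1, h.2.1.add h'.2.1, h.2.2.add h'.2.2⟩

theorem IsConvexBody.inter {K A : Set (Rn n)} (h : IsConvexBody K) (hA : IsClosed A)
    (hc : Convex ℝ A) (hne : (K ∩ A).Nonempty) : IsConvexBody (K ∩ A) :=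
  ⟨hne, h.2.1.inter_right hA, h.2.2.inter hc⟩

theorem isConvexBody_singleton (x : Rn n) : IsConvexBody {x} :=
  ⟨⟨x, rfl⟩, isCompact_singleton, convex_singleton x⟩

/-- cylinder -/
theorem IsConvexBody.cyl {M : Set (Rn m)} (h : IsConvexBody M) {I : Set ℝ} (hI : I.Nonempty)
    (hIc : IsCompact I) (hIv : Convex ℝ I) (e : (Rn m × ℝ) →L[ℝ] Rn n) :
    IsConvexBody (e '' (M ×ˢ I)) :=
  ⟨(h.1.prod hI).image _, (h.2.1.prod hIc).image e.continuous,
    (h.2.2.prod hIv).linear_image (e : (Rn m × ℝ) →ₗ[ℝ] Rn n)⟩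

theorem isConvexBody_closedBall (x : Rn n) {r : ℝ} (hr : 0 ≤ r) : IsConvexBody (closedBall x r) :=
  ⟨nonempty_closedBall.2 hr, isCompact_closedBall x r, convex_closedBall x r⟩

/-- Convex set with nonempty interior: approximating from a sub-half. -/
theorem interior_empty_of_subset_hyperplane {K : Set (Rn n)} {φ : Rn n →L[ℝ] ℝ} (hφ : φ ≠ 0) {c : ℝ}
    (h : ∀ x ∈ K, φ x = c) : interior K = ∅ := by
  by_contra hne
  obtain ⟨x, hx⟩ := Set.nonempty_iff_ne_empty.2 hne
  obtain ⟨v, hv⟩ : ∃ v, φ v ≠ 0 := by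
    by_contra hcon; push Not at hcon; exact hφ (by ext v; simp [hcon v])
  have hc : Continuous fun t : ℝ => x + t • v := by fun_prop
  have : ∀ᶠ t in 𝓝 (0:ℝ), x + t • v ∈ interior K := by
    apply hc.continuousAt.eventually
    simpa using isOpen_interior.mem_nhds hx
  obtain ⟨ε, hε, hb⟩ := Metric.eventually_nhds_iff.1 this
  have h1 := h _ (interior_subset (hb (y := ε/2) (by simp [abs_of_pos hε]; linarith)))
  have h2 := h _ (interior_subset hx)
  simp [h2] at h1
  rcases h1 with h1 | h1
  · linarith
  · exact hv h1

end basics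

end

section

open MeasureTheory Metric Filter Topology
open scoped Pointwise

section locdef
variable {n m : ℕ}

theorem convex_push {A : Set (Rn n)} (hA : Convex ℝ A) {x0 : Rn n} {r : ℝ} (hr : 0 < r)
    (hb : closedBall x0 r ⊆ A) {ε : ℝ} (hε : 0 < ε) {y a : Rn n} (ha : a ∈ A) (hya : dist y a ≤ ε) :
    y + (ε / (ε + r)) • (x0 - y) ∈ A := by
  set s := ε / (ε + r) with hs
  have hs0 : 0 < s := by positivity
  have hs1 : s < 1 := by rw [hs, div_lt_one (by positivity)]; linarith
  have hq : ((1 - s)/s) * ε = r := by rw [hs]; field_simp; ring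
  have hq0 : 0 < (1-s)/s := div_pos (by linarith) hs0
  have h1 : x0 + ((1 - s)/s) • (y - a) ∈ A := by
    apply hb
    rw [mem_closedBall, dist_eq_norm, add_sub_cancel_left, norm_smul, Real.norm_of_nonneg hq0.le]
    rw [dist_eq_norm] at hya
    calc (1-s)/s * ‖y - a‖ ≤ (1-s)/s * ε := by gcongr
      _ = r := hq
  have h2 := hA ha h1 (a := 1 - s) (b := s) (by linarith) hs0.le (by ring)
  convert h2 using 1
  rw [smul_add, smul_smul, mul_div_cancel₀ _ hs0.ne']
  module

theorem HC.inter {Ki : ℕ → Set (Rn n)} {K A : Set (Rn n)} (h : HC Ki K) 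
    (hK : IsConvexBody K) (hA : Convex ℝ A) {x0 : Rn n} (hx0 : x0 ∈ K)
    (hi : x0 ∈ interior A) : HC (fun i => Ki i ∩ A) (K ∩ A) := by
  obtain ⟨r, hr, hb⟩ := Metric.nhds_basis_closedBall.mem_iff.1 (mem_interior_iff_mem_nhds.1 hi)
  obtain ⟨D, hD⟩ := hK.2.1.isBounded.exists_norm_le
  have hD0 : 0 ≤ D := (norm_nonneg _).trans (hD _ hx0)
  have hdist : ∀ y ∈ K, ‖x0 - y‖ ≤ 2 * D := fun y hy => by
    have := norm_sub_le x0 y; linarith [hD _ hx0, hD _ hy]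
  intro ε hε
  -- choose s small
  obtain ⟨η, hη, hη1⟩ : ∃ η : ℝ, 0 < η ∧ η + η / (η + r) * (2 * D) ≤ ε := by
    have hc : ContinuousAt (fun η : ℝ => η + η / (η + r) * (2*D)) 0 := by
      apply ContinuousAt.add continuousAt_id
      apply ContinuousAt.mul _ continuousAt_const
      apply ContinuousAt.div continuousAt_id (by fun_prop)
      simpa using hr.ne'
    have : ∀ᶠ η in 𝓝 (0:ℝ), η + η / (η + r) * (2*D) < ε := by
      apply hc.eventually (gt_mem_nhds _)
      simpa using hε
    obtain ⟨η, h1, h2⟩ := ((this.filter_mono nhdsWithin_le_nhds).and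
      (self_mem_nhdsWithin (s := Set.Ioi (0:ℝ)))).exists
    exact ⟨η, h2, h1.le⟩
  filter_upwards [h η hη, h (η * r / (η + r)) (by positivity)] with i h1 h2
  have hs1 : η / (η + r) ≤ 1 := by rw [div_le_one (by positivity)]; linarith
  have hs0 : 0 ≤ η / (η + r) := by positivity
  have hmemK : ∀ y ∈ K, y + (η / (η + r)) • (x0 - y) ∈ K := fun y hy => 
    hK.2.2.add_smul_sub_mem hy hx0 ⟨hs0, hs1⟩
  refine ⟨?_, ?_⟩
  · rintro x ⟨hx, hxA⟩
    obtain ⟨y, hy, hxy⟩ := h1.1 x hx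
    refine ⟨_, ⟨hmemK y hy, convex_push hA hr hb hη hxA (by rwa [dist_comm])⟩, ?_⟩
    calc dist x (y + (η / (η + r)) • (x0 - y)) ≤ dist x y + dist y (y + (η / (η + r)) • (x0 - y)) := dist_triangle _ _ _
      _ ≤ η + η / (η + r) * (2*D) := by
        gcongr
        rw [dist_self_add_right, norm_smul, Real.norm_of_nonneg hs0]
        gcongr
        exact hdist y hy
      _ ≤ ε := hη1
  · rintro y ⟨hy, hyA⟩
    obtain ⟨x, hx, hxy⟩ := h2.2 _ (hmemK y hy)
    refine ⟨x, ⟨hx, ?_⟩, ?_⟩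
    · -- x is within s r of y', in A
      set s := η / (η + r) with hs
      have hs0' : 0 < s := by positivity
      have hw : x0 + s⁻¹ • (x - (y + s • (x0 - y))) ∈ A := by
        apply hb
        rw [mem_closedBall, dist_eq_norm, add_sub_cancel_left, norm_smul, norm_inv, Real.norm_of_nonneg hs0,
          inv_mul_le_iff₀ hs0', ← dist_eq_norm, dist_comm]
        refine hxy.trans (le_of_eq ?_)
        rw [hs]; ring
      have := hA hyA hw (a := 1 - s) (b := s) (by linarith) hs0'.le (by ring)
      convert this using 1
      rw [smul_add, smul_smul, mul_inv_cancel₀ hs0'.ne']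
      module
    · calc dist y x ≤ dist y (y + (η / (η + r)) • (x0 - y)) + dist (y + (η / (η + r)) • (x0 - y)) x := dist_triangle _ _ _
        _ ≤ η / (η + r) * (2*D) + η * r / (η + r) := by
          gcongr
          rw [dist_self_add_right, norm_smul, Real.norm_of_nonneg hs0]
          gcongr
          exact hdist y hy
        _ ≤ η + η / (η + r) * (2*D) := by
          have : η * r / (η + r) ≤ η := by
            rw [div_le_iff₀ (by positivity)]; nlinarith
          linarith
        _ ≤ ε := hη1

/-- precomposition with translation -/
noncomputable def shiftC (a : Rn n) : C(Rn n, Rn n) := ⟨fun x => x + a, by fun_prop⟩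
/-- scaling -/
noncomputable def scaleC (t : ℝ) : C(Rn n, Rn n) := ⟨fun x => t • x, by fun_prop⟩

/-- A simple local functional (curvature measure acting on functions). -/
structure Loc (n : ℕ) where
  L : Set (Rn n) → C(Rn n, ℝ) →ₗ[ℝ] ℂ
  bound : ∀ K, IsConvexBody K → ∃ C : ℝ, 0 ≤ C ∧ ∀ (f : C(Rn n, ℝ)) (M : ℝ),
    (∀ x ∈ K, |f x| ≤ M) → ‖L K f‖ ≤ C * M
  loc : ∀ K K' U, IsConvexBody K → IsConvexBody K' → IsOpen U → K ∩ U = K' ∩ U →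
    ∀ f : C(Rn n, ℝ), (∀ x, x ∉ U → f x = 0) → L K f = L K' f
  trans : ∀ K, IsConvexBody K → ∀ (a : Rn n) (f : C(Rn n, ℝ)),
    L ((fun y => y + a) '' K) f = L K (f.comp (shiftC a))
  cont : ∀ (Ki : ℕ → Set (Rn n)) K, (∀ i, IsConvexBody (Ki i)) → IsConvexBody K → HC Ki K →
    ∀ f, Tendsto (fun i => L (Ki i) f) atTop (𝓝 (L K f))
  simple : ∀ K, IsConvexBody K → interior K = ∅ → ∀ f, L K f = 0

/-- homogeneity -/
def Loc.Hom (Λ : Loc n) (k : ℕ) : Prop := ∀ t : ℝ, 0 < t → ∀ K, IsConvexBody K → ∀ f,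
  Λ.L (t • K) f = (t : ℂ) ^ k * Λ.L K (f.comp (scaleC t))

theorem Loc.zero_of_zero (Λ : Loc n) {K} (hK : IsConvexBody K) {f : C(Rn n, ℝ)}
    (hf : ∀ x ∈ K, f x = 0) : Λ.L K f = 0 := by
  obtain ⟨C, hC, h⟩ := Λ.bound K hK
  have := h f 0 (fun x hx => by simp [hf x hx])
  simpa using this

theorem Loc.congr (Λ : Loc n) {K} (hK : IsConvexBody K) {f g : C(Rn n, ℝ)}
    (hf : ∀ x ∈ K, f x = g x) : Λ.L K f = Λ.L K g := by
  rw [← sub_eq_zero, ← map_sub]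
  exact Λ.zero_of_zero hK (fun x hx => by simp [hf x hx])

/-- clamp to a bounded function -/
noncomputable def clampB {X : Type*} [TopologicalSpace X] (f : C(X, ℝ)) (M : ℝ) :
    BoundedContinuousFunction X ℝ :=
  BoundedContinuousFunction.ofNormedAddCommGroup (fun x => max (-M) (min (f x) M)) (by fun_prop) |M| (by
    intro x
    rw [Real.norm_eq_abs, abs_le]
    rcases max_cases (-M) (min (f x) M) with h | h <;> rcases min_cases (f x) M with h' | h' <;>
      constructor <;> cases abs_cases M <;> linarith)

theorem clampB_eq {X : Type*} [TopologicalSpace X] (f : C(X, ℝ)) {M : ℝ} {x : X} (h : |f x| ≤ M) : clampB f M x = f x := by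
  rw [abs_le] at h
  change max (-M) (min (f x) M) = f x
  rw [min_eq_left h.2, max_eq_right h.1]

theorem clampB_norm {X : Type*} [TopologicalSpace X] (f : C(X, ℝ)) {M : ℝ} (hM : 0 ≤ M) : ‖clampB f M‖ ≤ M := by
  refine (BoundedContinuousFunction.norm_ofNormedAddCommGroup_le _ (abs_nonneg M) _).trans ?_
  rw [abs_of_nonneg hM]

theorem Loc.ub (Λ : Loc n) {Ki : ℕ → Set (Rn n)} {K} (hKi : ∀ i, IsConvexBody (Ki i))
    (hK : IsConvexBody K) (h : HC Ki K) : ∃ C : ℝ, 0 ≤ C ∧ ∀ i (f : C(Rn n, ℝ)) (M : ℝ),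
    (∀ x ∈ Ki i, |f x| ≤ M) → ‖Λ.L (Ki i) f‖ ≤ C * M := by
  choose C hC hCb using fun i => Λ.bound (Ki i) (hKi i)
  let T : ℕ → (BoundedContinuousFunction (Rn n) ℝ →L[ℝ] ℂ) := fun i =>
    LinearMap.mkContinuous
      { toFun := fun g => Λ.L (Ki i) g.toContinuousMap
        map_add' := fun f g => by rw [← map_add]; rfl
        map_smul' := fun c g => by rw [RingHom.id_apply, ← map_smul]; rfl } (C i)
      (fun g => hCb i _ _ (fun x _ => g.norm_coe_le_norm x))
  obtain ⟨C', hC'⟩ := banach_steinhaus (g := T) (by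
    intro g
    have ht := Λ.cont Ki K hKi hK h g.toContinuousMap
    obtain ⟨B, hB⟩ := ht.norm.bddAbove_range
    exact ⟨B, fun i => hB ⟨i, rfl⟩⟩)
  refine ⟨C', (norm_nonneg _).trans (hC' 0), fun i f M hM => ?_⟩
  obtain ⟨x, hx⟩ := (hKi i).1
  have hM0 : 0 ≤ M := (abs_nonneg _).trans (hM x hx)
  have : Λ.L (Ki i) f = T i (clampB f M) :=
    Λ.congr (hKi i) (fun x hx => (clampB_eq f (hM x hx)).symm)
  rw [this]
  calc ‖T i (clampB f M)‖ ≤ ‖T i‖ * ‖clampB f M‖ := (T i).le_opNorm _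
    _ ≤ C' * M := mul_le_mul (hC' i) (clampB_norm f hM0) (norm_nonneg _) ((norm_nonneg _).trans (hC' i))

end locdef

end

section

open MeasureTheory Metric Filter Topology
open scoped Pointwise

section generic
variable {n m : ℕ}

/-- functionals -/
abbrev Du (n : ℕ) := Rn n →ₗ[ℝ] ℝ

theorem Du.cont (l : Du n) : Continuous l := LinearMap.continuous_of_finiteDimensional l

/-- generic families of constraints -/
def Generic (S : Set (Du n × ℝ)) : Prop :=
  ∀ x, LinearIndepOn ℝ Prod.fst {p : Du n × ℝ | p ∈ S ∧ p.1 x = p.2}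

/-- polyhedron -/
def Polh (S : Set (Du n × ℝ)) : Set (Rn n) := {x | ∀ p ∈ S, p.1 x ≤ p.2}

theorem Polh.isClosed (S : Set (Du n × ℝ)) : IsClosed (Polh S) := by
  have : Polh S = ⋂ p ∈ S, {x | p.1 x ≤ p.2} := by ext; simp [Polh]
  rw [this]
  exact isClosed_biInter fun p _ => isClosed_le p.1.cont continuous_const

theorem Polh.convex (S : Set (Du n × ℝ)) : Convex ℝ (Polh S) := by
  have : Polh S = ⋂ p ∈ S, {x | p.1 x ≤ p.2} := by ext; simp [Polh]
  rw [this]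
  exact convex_iInter₂ fun p _ => convex_halfSpace_le p.1.isLinear p.2

theorem generic_insert_finite {S : Set (Du n × ℝ)} (hf : S.Finite) (hS : Generic S) (l : Du n) :
    {c : ℝ | ¬ Generic (insert (l, c) S)}.Finite := by
  have key : ∀ c ∈ {c : ℝ | ¬ Generic (insert (l, c) S)}, ∃ x, l x = c ∧
      l ∈ Submodule.span ℝ (Prod.fst '' {p : Du n × ℝ | p ∈ S ∧ p.1 x = p.2}) := by
    intro c hc
    simp only [Set.mem_ofPred_eq, Generic, not_forall] at hc
    obtain ⟨x, hx⟩ := hc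
    by_cases hlx : l x = c
    · refine ⟨x, hlx, ?_⟩
      by_contra hcon
      apply hx
      have := (hS x).insert (x := (l, c)) hcon
      refine this.mono fun p => ?_
      simp only [Set.mem_insert_iff, Set.mem_ofPred_eq]
      rintro ⟨rfl | h1, h2⟩
      · exact Or.inl rfl
      · exact Or.inr ⟨h1, h2⟩
    · exfalso; apply hx
      refine (hS x).mono fun p => ?_
      simp only [Set.mem_insert_iff, Set.mem_ofPred_eq]
      rintro ⟨rfl | h1, h2⟩
      · exact absurd h2 hlx
      · exact ⟨h1, h2⟩
  choose! x hx hxs using key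
  apply Set.Finite.of_finite_image (f := fun c => {p : Du n × ℝ | p ∈ S ∧ p.1 (x c) = p.2})
  · exact hf.finite_subsets.subset (by rintro _ ⟨c, _, rfl⟩ p hp; exact hp.1)
  · intro c hc c' hc' heq
    simp only at heq
    have h1 := hxs c hc
    rw [← hx c hc, ← hx c' hc']
    have : ∀ l' ∈ Submodule.span ℝ (Prod.fst '' {p : Du n × ℝ | p ∈ S ∧ p.1 (x c) = p.2}),
        l' (x c) = l' (x c') := by
      intro l' hl'
      induction hl' using Submodule.span_induction with
      | mem y hy =>
        obtain ⟨p, hp, rfl⟩ := hy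
        have hp' := hp
        rw [heq] at hp'
        rw [hp.2, hp'.2]
      | zero => simp
      | add a b _ _ ha hb => simp [ha, hb]
      | smul r a _ ha => simp [ha]
    exact this l h1

theorem generic_choice {ι : Type*} (t : Finset ι) (l : ι → Du n) (u v : ι → ℝ) (huv : ∀ i, u i < v i)
    {S0 : Set (Du n × ℝ)} (hf : S0.Finite) (hS : Generic S0) :
    ∃ c : ι → ℝ, (∀ i ∈ t, u i < c i ∧ c i < v i ∧ (l i, c i) ∉ S0) ∧
      Generic (S0 ∪ (fun i => (l i, c i)) '' (t : Set ι)) := by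
  classical
  induction t using Finset.induction_on with
  | empty => exact ⟨fun _ => 0, by simp, by simpa using hS⟩
  | insert a t ha ih =>
    obtain ⟨c, hc, hg⟩ := ih
    have hf1 : (S0 ∪ (fun i => (l i, c i)) '' (t : Set ι)).Finite :=
      hf.union (t.finite_toSet.image _)
    have hbad := generic_insert_finite hf1 hg (l a)
    have hbad2 : ({x | (l a, x) ∈ S0} : Set ℝ).Finite :=
      hf.preimage (f := fun x => (l a, x)) (fun x _ y _ h => by simpa using h)
    obtain ⟨x, hx, hxb⟩ := ((Set.Ioo_infinite (huv a)).sdiff (hbad.union hbad2)).nonempty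
    simp only [Set.mem_union, Set.mem_ofPred_eq, not_or, not_not] at hxb
    refine ⟨Function.update c a x, ?_, ?_⟩
    · intro i hi
      rcases Finset.mem_insert.1 hi with rfl | hi
      · simpa using ⟨hx.1, hx.2, hxb.2⟩
      · have : i ≠ a := fun h => ha (h ▸ hi)
        simpa [this] using hc i hi
    · convert hxb.1 using 1
      have : (fun i => (l i, Function.update c a x i)) '' (t : Set ι) = (fun i => (l i, c i)) '' (t : Set ι) := by
        apply Set.image_congr
        intro i hi
        have : i ≠ a := fun h => ha (h ▸ hi)
        simp [this]
      rw [Finset.coe_insert, Set.image_insert_eq, this]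
      simp

/-- generic polytope approximation from outside -/
theorem exists_generic_approx {K : Set (Rn n)} (hK : IsConvexBody K) {ε : ℝ} (hε : 0 < ε)
    {S0 : Set (Du n × ℝ)} (hf : S0.Finite) (hS : Generic S0) :
    ∃ S : Set (Du n × ℝ), S.Finite ∧ Generic (S0 ∪ S) ∧ Disjoint S0 S ∧ K ⊆ Polh S ∧
      IsConvexBody (Polh S) ∧ (∀ x ∈ Polh S, ∃ y ∈ K, dist x y ≤ ε) := by
  classical
  have hcont : Continuous fun y => infDist y K := continuous_infDist_pt K
  have hDc : IsCompact {y | infDist y K = ε} := by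
    refine IsCompact.of_isClosed_subset (hK.2.1.cthickening (r := ε)) (isClosed_eq hcont continuous_const) ?_
    intro y hy
    rw [cthickening_eq_preimage_infEDist, Set.mem_preimage, Set.mem_Iic]
    have hy' : infDist y K = ε := hy
    rw [infDist] at hy'
    rw [← hy', ENNReal.ofReal_toReal (infEDist_ne_top hK.1)]
  have hsep : ∀ y : Rn n, infDist y K = ε → ∃ l : Du n, ∃ u v : ℝ, u < v ∧ (∀ a ∈ K, l a < u) ∧ v < l y := by
    intro y hy
    have hyK : y ∉ K := fun h => by rw [infDist_zero_of_mem h] at hy; linarith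
    obtain ⟨f, u, v, h1, h2, h3⟩ := geometric_hahn_banach_compact_closed hK.2.2 hK.2.1
      (convex_singleton y) isClosed_singleton (by simpa using hyK)
    exact ⟨f.toLinearMap, u, v, h2, h1, h3 y rfl⟩
  choose! l u v huv hl hly using hsep
  obtain ⟨t, htD, ht⟩ := hDc.elim_nhds_subcover (fun y => {z | v y < l y z}) (fun y hy =>
    (isOpen_lt continuous_const (l y).cont).mem_nhds (hly y hy))
  obtain ⟨c, hc, hg⟩ := generic_choice t.attach (fun y => l y.1) (fun y => u y.1) (fun y => v y.1)
    (fun y => huv y.1 (htD y.1 y.2)) hf hS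
  set S := (fun i : t => (l i.1, c i)) '' (t.attach : Set t) with hSdef
  have hKP : K ⊆ Polh S := by
    rintro x hx p ⟨i, hi, rfl⟩
    exact ((hl i.1 (htD i.1 i.2) x hx).trans (hc i (by simp)).1).le
  have hPD : ∀ x ∈ Polh S, infDist x K ≠ ε := by
    intro x hx hxD
    obtain ⟨y, hy, hxy⟩ := Set.mem_iUnion₂.1 (ht hxD)
    have h1 := hx (l y, c ⟨y, hy⟩) ⟨⟨y, hy⟩, by simp, rfl⟩
    have h2 := (hc ⟨y, hy⟩ (by simp)).2.1
    simp only [Set.mem_ofPred_eq] at hxy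
    simp only at h1 h2
    linarith
  obtain ⟨x0, hx0⟩ := hK.1
  have hlt : ∀ x ∈ Polh S, infDist x K < ε := by
    intro x hx
    by_contra hcon
    have := (Polh.convex S).isPreconnected.intermediate_value (hKP hx0) hx hcont.continuousOn
    obtain ⟨z, hz, hz2⟩ := this (a := ε) ⟨by rw [infDist_zero_of_mem hx0]; exact hε.le, not_lt.1 hcon⟩
    exact hPD z hz hz2
  have hd : ∀ x ∈ Polh S, ∃ y ∈ K, dist x y ≤ ε := by
    intro x hx
    obtain ⟨y, hy, h⟩ := (infDist_lt_iff hK.1).1 (hlt x hx)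
    exact ⟨y, hy, h.le⟩
  refine ⟨S, t.attach.finite_toSet.image _, hg, ?_, hKP, ⟨⟨x0, hKP hx0⟩, ?_, Polh.convex S⟩, hd⟩
  · rw [Set.disjoint_right]
    rintro p ⟨i, hi, rfl⟩
    exact (hc i (by simp)).2.2
  · refine IsCompact.of_isClosed_subset (hK.2.1.cthickening (r := ε)) (Polh.isClosed S) ?_
    intro x hx
    obtain ⟨y, hy, h⟩ := hd x hx
    exact mem_cthickening_of_dist_le x y ε K hy h

/-- parallelotope in coordinates `T` -/
def Par (T : Rn n ≃L[ℝ] (Fin n → ℝ)) (lo hi : Fin n → ℝ) : Set (Rn n) :=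
  {y | ∀ i, lo i ≤ T y i ∧ T y i ≤ hi i}

theorem Par.eq_preimage (T : Rn n ≃L[ℝ] (Fin n → ℝ)) (lo hi : Fin n → ℝ) :
    Par T lo hi = T.symm '' (Set.Icc lo hi) := by
  rw [ContinuousLinearEquiv.image_symm_eq_preimage]
  ext y; simp only [Par, Set.mem_ofPred_eq, Set.mem_preimage, Set.mem_Icc, Pi.le_def, forall_and]

theorem Par.body (T : Rn n ≃L[ℝ] (Fin n → ℝ)) {lo hi : Fin n → ℝ} (h : ∀ i, lo i ≤ hi i) :
    IsConvexBody (Par T lo hi) := by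
  rw [Par.eq_preimage]
  exact ⟨(Set.nonempty_Icc.2 h).image _, isCompact_Icc.image T.symm.continuous,
    (convex_Icc lo hi).linear_image (T.symm : (Fin n → ℝ) →L[ℝ] Rn n).toLinearMap⟩

theorem exists_coords {A : Set (Du n × ℝ)} (hA : LinearIndepOn ℝ Prod.fst A) :
    ∃ T : Rn n ≃L[ℝ] (Fin n → ℝ), ∀ p ∈ A, ∃ i, ∀ y, T y i = p.1 y := by
  have hid := hA.id_image
  let b := Module.Basis.extend hid
  have hfr : Module.finrank ℝ (Du n) = n := by
    rw [Subspace.dual_finrank_eq]; simp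
  have : Fintype (hid.extend (Set.subset_univ _)) := FiniteDimensional.fintypeBasisIndex b
  have hcard : Fintype.card (hid.extend (Set.subset_univ _)) = n := by
    rw [← Module.finrank_eq_card_basis b, hfr]
  let e := Fintype.equivFinOfCardEq hcard
  let b' := b.reindex e
  let T0 : Rn n →ₗ[ℝ] (Fin n → ℝ) := LinearMap.pi (fun i => b' i)
  have hinj : Function.Injective T0 := by
    rw [injective_iff_map_eq_zero]
    intro x hx
    rw [← Module.forall_dual_apply_eq_zero_iff ℝ x]
    intro f
    rw [← b'.sum_repr f, LinearMap.sum_apply]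
    refine Finset.sum_eq_zero fun i _ => ?_
    have := congrFun hx i
    simp only [T0, LinearMap.pi_apply, Pi.zero_apply] at this
    simp [this]
  let T := (T0.linearEquivOfInjective hinj (by simp)).toContinuousLinearEquiv
  refine ⟨T, fun p hp => ?_⟩
  have hmem : p.1 ∈ hid.extend (Set.subset_univ _) := hid.subset_extend _ ⟨p, hp, rfl⟩
  refine ⟨e ⟨p.1, hmem⟩, fun y => ?_⟩
  change b' (e ⟨p.1, hmem⟩) y = p.1 y
  simp [b', b]

theorem local_par {S S' : Set (Du n × ℝ)} (hf : S.Finite) (hSS : S ⊆ S') (hS : Generic S')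
    {x : Rn n} (hx : x ∈ Polh S) : ∃ (T : Rn n ≃L[ℝ] (Fin n → ℝ)) (lo hi : Fin n → ℝ) (U : Set (Rn n)),
      (∀ i, lo i < hi i) ∧ IsOpen U ∧ x ∈ U ∧ Polh S ∩ U = Par T lo hi ∩ U ∧
      ∀ p ∈ S', p ∉ S → p.1 x = p.2 → ∃ j, (∀ y, T y j = p.1 y) ∧ lo j < p.2 ∧ p.2 < hi j := by
  classical
  obtain ⟨T, hT⟩ := exists_coords (hS x)
  let act : Fin n → Prop := fun i => ∃ p ∈ S, p.1 x = p.2 ∧ ∀ y, T y i = p.1 y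
  refine ⟨T, fun i => T x i - 1, fun i => if act i then T x i else T x i + 1,
    {y | ∀ i, |T y i - T x i| < 1} ∩ {y | ∀ p ∈ S, p.1 x ≠ p.2 → p.1 y < p.2}, ?_, ?_, ?_, ?_, ?_⟩
  · intro i; simp only; split_ifs <;> linarith
  · apply IsOpen.inter
    · simp only [Set.ofPred_forall]
      exact isOpen_iInter_of_finite fun i => isOpen_lt (by fun_prop) continuous_const
    · have : {y | ∀ p ∈ S, p.1 x ≠ p.2 → p.1 y < p.2} = ⋂ p ∈ {p : Du n × ℝ | p ∈ S ∧ p.1 x ≠ p.2}, {y | p.1 y < p.2} := by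
        ext y; simp
      rw [this]
      exact (hf.subset fun p hp => hp.1).isOpen_biInter fun p _ => isOpen_lt p.1.cont continuous_const
  · refine ⟨fun i => by simp, fun p hp hne => lt_of_le_of_ne (hx p hp) hne⟩
  · ext y
    simp only [Set.mem_inter_iff, and_congr_left_iff]
    rintro ⟨h1, h2⟩
    simp only [Set.mem_ofPred_eq] at h1 h2
    constructor
    · intro hy i
      have := abs_lt.1 (h1 i)
      refine ⟨by linarith, ?_⟩
      show T y i ≤ if act i then T x i else T x i + 1
      split_ifs with hi
      · obtain ⟨p, hp, hpx, hpi⟩ := hi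
        rw [hpi, hpi, hpx]; exact hy p hp
      · linarith
    · intro hy p hp
      by_cases hpx : p.1 x = p.2
      · obtain ⟨i, hi⟩ := hT p ⟨hSS hp, hpx⟩
        have : T y i ≤ if act i then T x i else T x i + 1 := (hy i).2
        rw [if_pos ⟨p, hp, hpx, hi⟩, hi, hi, hpx] at this
        exact this
      · exact (h2 p hp hpx).le
  · intro p hp hpS hpx
    obtain ⟨j, hj⟩ := hT p ⟨hp, hpx⟩
    have hna : ¬ act j := by
      rintro ⟨q, hq, hqx, hqj⟩
      have : q.1 = p.1 := LinearMap.ext fun y => by rw [← hqj, hj]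
      have := (hS x).injOn (x₁ := q) (x₂ := p) ⟨hSS hq, hqx⟩ ⟨hp, hpx⟩ this
      exact hpS (this ▸ hq)
    refine ⟨j, hj, ?_, ?_⟩
    · simp only; rw [hj, hpx]; linarith
    · simp only [if_neg hna]; rw [hj, hpx]; linarith

theorem generic_empty : Generic (∅ : Set (Du n × ℝ)) := by
  intro x; simp

theorem generic_single {φ : Du n} (hφ : φ ≠ 0) (c : ℝ) : Generic ({(φ, c)} : Set (Du n × ℝ)) := by
  intro x
  have h1 : LinearIndepOn ℝ Prod.fst ({(φ, c)} : Set (Du n × ℝ)) := LinearIndepOn.singleton hφ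
  exact h1.mono (fun p hp => hp.1)

/-- a functional which vanishes locally vanishes -/
theorem local_zero {K : Set (Rn n)} (hK : IsCompact K) (D : C(Rn n, ℝ) →ₗ[ℝ] ℂ)
    (h0 : ∀ f : C(Rn n, ℝ), (∀ x ∈ K, f x = 0) → D f = 0)
    (h : ∀ x ∈ K, ∃ U, IsOpen U ∧ x ∈ U ∧ ∀ f : C(Rn n, ℝ), (∀ y, y ∉ U → f y = 0) → D f = 0)
    (f : C(Rn n, ℝ)) : D f = 0 := by
  choose! U hU hxU hD using h
  obtain ⟨t, htK, ht⟩ := hK.elim_nhds_subcover U (fun x hx => (hU x hx).mem_nhds (hxU x hx))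
  let e := t.equivFin
  obtain ⟨g, hg1, hg2, -, -⟩ := exists_continuous_sum_one_of_isOpen_isCompact
    (s := fun i => U (e.symm i)) (fun i => hU _ (htK _ (e.symm i).2)) hK (by
      intro x hx
      obtain ⟨y, hy, hxy⟩ := Set.mem_iUnion₂.1 (ht hx)
      exact Set.mem_iUnion.2 ⟨e ⟨y, hy⟩, by simpa using hxy⟩)
  have h1 : D f = D (∑ i, f * g i) := by
    rw [← sub_eq_zero, ← map_sub]
    apply h0
    intro x hx
    have := hg2 hx
    simp only [ContinuousMap.sub_apply, ContinuousMap.coe_sum, Finset.sum_apply,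
      ContinuousMap.mul_apply, ← Finset.mul_sum]
    simp only [Finset.sum_apply, Pi.one_apply] at this
    rw [this]; ring
  rw [h1, map_sum]
  refine Finset.sum_eq_zero fun i _ => hD _ (htK _ (e.symm i).2) _ fun y hy => ?_
  have : g i y = 0 := by
    by_contra hne
    exact hy (hg1 i (subset_tsupport _ hne))
  simp [this]

theorem HC.of_approx {K : Set (Rn n)} {P : ℕ → Set (Rn n)} (h1 : ∀ i, K ⊆ P i)
    (h2 : ∀ i, ∀ x ∈ P i, ∃ y ∈ K, dist x y ≤ 1 / ((i:ℝ) + 1)) : HC P K := by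
  refine HC.of_dist (δ := fun i => 1 / ((i:ℝ)+1)) tendsto_one_div_add_atTop_nhds_zero_nat fun i => ⟨h2 i, fun y hy => ⟨y, h1 i hy, ?_⟩⟩
  simp; positivity

/-- Lemma A -/
theorem Loc.zero_of_par (Λ : Loc n) (h : ∀ T (lo hi : Fin n → ℝ), (∀ i, lo i < hi i) → Λ.L (Par T lo hi) = 0)
    {K} (hK : IsConvexBody K) (f) : Λ.L K f = 0 := by
  choose S hSf hSg _ hKS hSb hSd using fun i : ℕ =>
    exists_generic_approx hK (ε := 1 / ((i:ℝ) + 1)) (by positivity) Set.finite_empty (generic_empty (n := n))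
  have hz : ∀ i, Λ.L (Polh (S i)) f = 0 := by
    intro i
    refine local_zero (hSb i).2.1 _ (fun g hg => Λ.zero_of_zero (hSb i) hg) ?_ f
    intro x hx
    obtain ⟨T, lo, hi, U, hlt, hU, hxU, heq, -⟩ := local_par (hSf i) subset_rfl (by simpa using hSg i) hx
    refine ⟨U, hU, hxU, fun g hg => ?_⟩
    rw [Λ.loc _ _ U (hSb i) (Par.body T fun j => (hlt j).le) hU heq g hg, h T lo hi hlt]
    rfl
  have := Λ.cont _ _ hSb hK (HC.of_approx hKS hSd) f
  simp only [hz] at this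
  exact tendsto_nhds_unique this tendsto_const_nhds |>.symm ▸ rfl

end generic

end

section

open MeasureTheory Metric Filter Topology
open scoped Pointwise

section cut
variable {n m : ℕ}

theorem HC.nested {Ki : ℕ → Set (Rn n)} (hc : ∀ i, IsCompact (Ki i)) (ha : Antitone Ki) {K : Set (Rn n)}
    (hK : K = ⋂ i, Ki i) : HC Ki K := by
  intro ε hε
  have : ∃ i, Ki i ⊆ thickening ε K := by
    have := exists_subset_nhds_of_isCompact (V := Ki) (U := thickening ε K)
      (directed_of_isDirected_le fun i j h => ha h) hc (by
        intro x hx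
        refine isOpen_thickening.mem_nhds (self_subset_thickening hε _ ?_)
        rw [hK]; exact hx)
    exact this
  obtain ⟨i, hi⟩ := this
  filter_upwards [eventually_ge_atTop i] with j hj
  refine ⟨fun x hx => ?_, fun y hy => ⟨y, ?_, by simp [hε.le]⟩⟩
  · obtain ⟨y, hy, h⟩ := mem_thickening_iff.1 (hi (ha hj hx))
    exact ⟨y, hy, h.le⟩
  · rw [hK] at hy; exact Set.mem_iInter.1 hy j

theorem body_le {K : Set (Rn n)} (hK : IsConvexBody K) (φ : Du n) (b : ℝ)
    (h : (K ∩ {x | φ x ≤ b}).Nonempty) : IsConvexBody (K ∩ {x | φ x ≤ b}) :=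
  hK.inter (isClosed_le φ.cont continuous_const) (convex_halfSpace_le φ.isLinear b) h

theorem body_ge {K : Set (Rn n)} (hK : IsConvexBody K) (φ : Du n) (b : ℝ)
    (h : (K ∩ {x | b ≤ φ x}).Nonempty) : IsConvexBody (K ∩ {x | b ≤ φ x}) :=
  hK.inter (isClosed_le continuous_const φ.cont) (convex_halfSpace_ge φ.isLinear b) h

theorem Loc.cut_aux (Λ : Loc n) {K : Set (Rn n)} (hK : IsConvexBody K) (φ : Du n) (b : ℝ)
    (h1 : (K ∩ {x | φ x ≤ b}).Nonempty) (h2 : (K ∩ {x | b ≤ φ x}).Nonempty) (f : C(Rn n, ℝ))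
    (hf : ∀ x, φ x = b → f x = 0) :
    Λ.L K f = Λ.L (K ∩ {x | φ x ≤ b}) f + Λ.L (K ∩ {x | b ≤ φ x}) f := by
  have hφ := φ.cont
  let fp : C(Rn n, ℝ) := ⟨fun x => if φ x ≤ b then 0 else f x,
    Continuous.if_le continuous_const f.continuous hφ continuous_const (fun x hx => (hf x hx).symm)⟩
  let fm : C(Rn n, ℝ) := ⟨fun x => if b ≤ φ x then 0 else f x,
    Continuous.if_le continuous_const f.continuous continuous_const hφ (fun x hx => (hf x hx.symm).symm)⟩
  have hfeq : f = fp + fm := by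
    ext x
    simp only [fp, fm, ContinuousMap.add_apply, ContinuousMap.coe_mk]
    rcases lt_trichotomy (φ x) b with h | h | h
    · simp [h.le, not_le.2 h]
    · simp [h, hf x h]
    · simp [h.le, not_le.2 h]
  have hKm := body_le hK φ b h1
  have hKp := body_ge hK φ b h2
  have e1 : Λ.L (K ∩ {x | φ x ≤ b}) fp = 0 := Λ.zero_of_zero hKm fun x hx => by
    simp only [fp, ContinuousMap.coe_mk]; exact if_pos hx.2
  have e2 : Λ.L (K ∩ {x | b ≤ φ x}) fm = 0 := Λ.zero_of_zero hKp fun x hx => by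
    simp only [fm, ContinuousMap.coe_mk]; exact if_pos hx.2
  have e3 : Λ.L K fp = Λ.L (K ∩ {x | b ≤ φ x}) fp := by
    refine Λ.loc _ _ {x | b < φ x} hK hKp (isOpen_lt continuous_const hφ) ?_ _ fun x hx => ?_
    · ext x; simp only [Set.mem_inter_iff, Set.mem_ofPred_eq]
      exact ⟨fun h => ⟨⟨h.1, h.2.le⟩, h.2⟩, fun h => ⟨h.1.1, h.2⟩⟩
    · simp only [fp, ContinuousMap.coe_mk]; rw [if_pos (not_lt.1 hx)]
  have e4 : Λ.L K fm = Λ.L (K ∩ {x | φ x ≤ b}) fm := by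
    refine Λ.loc _ _ {x | φ x < b} hK hKm (isOpen_lt hφ continuous_const) ?_ _ fun x hx => ?_
    · ext x; simp only [Set.mem_inter_iff, Set.mem_ofPred_eq]
      exact ⟨fun h => ⟨⟨h.1, h.2.le⟩, h.2⟩, fun h => ⟨h.1.1, h.2⟩⟩
    · simp only [fm, ContinuousMap.coe_mk]; rw [if_pos (not_lt.1 hx)]
  rw [hfeq]; simp only [map_add]; rw [e1, e2, e3, e4]; ring

/-- cut lemma -/
theorem Loc.cut (Λ : Loc n) {K : Set (Rn n)} (hK : IsConvexBody K) {φ : Du n} (hφ0 : φ ≠ 0) (b : ℝ)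
    (h1 : (K ∩ {x | φ x ≤ b}).Nonempty) (h2 : (K ∩ {x | b ≤ φ x}).Nonempty) (f : C(Rn n, ℝ)) :
    Λ.L K f = Λ.L (K ∩ {x | φ x ≤ b}) f + Λ.L (K ∩ {x | b ≤ φ x}) f := by
  have hφ := φ.cont
  obtain ⟨z, hzK, hz⟩ : ∃ z ∈ K, φ z = b := by
    obtain ⟨x, hx, hx'⟩ := h1
    obtain ⟨y, hy, hy'⟩ := h2
    exact hK.2.2.isPreconnected.intermediate_value hx hy hφ.continuousOn ⟨hx', hy'⟩
  let s : ℕ → ℝ := fun i => 1 / ((i:ℝ) + 1)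
  have hs : ∀ i, 0 < s i := fun i => by simp only [s]; positivity
  have hsa : Antitone s := fun i j h => by simp only [s]; gcongr
  let W : ℕ → Set (Rn n) := fun i => {x | φ x ≤ b + s i} ∩ {x | b - s i ≤ φ x}
  have hWc : ∀ i, IsClosed (W i) := fun i =>
    (isClosed_le hφ continuous_const).inter (isClosed_le continuous_const hφ)
  have hWv : ∀ i, Convex ℝ (W i) := fun i =>
    (convex_halfSpace_le φ.isLinear _).inter (convex_halfSpace_ge φ.isLinear _)
  have hzW : ∀ i, z ∈ W i := fun i => ⟨by
    simp only [Set.mem_ofPred_eq]; linarith [hs i], by simp only [Set.mem_ofPred_eq]; linarith [hs i]⟩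
  have hWa : Antitone W := by
    intro i j h x hx
    have := hsa h
    have h1 : φ x ≤ b + s j := hx.1
    have h2 : b - s j ≤ φ x := hx.2
    exact ⟨by simp only [Set.mem_ofPred_eq]; linarith, by simp only [Set.mem_ofPred_eq]; linarith⟩
  have hWi : ⋂ i, W i = {x | φ x = b} := by
    ext x
    simp only [Set.mem_iInter, Set.mem_ofPred_eq]
    constructor
    · intro h
      have hl : Tendsto s atTop (𝓝 0) := tendsto_one_div_add_atTop_nhds_zero_nat
      apply le_antisymm
      · have : Tendsto (fun i => b + s i) atTop (𝓝 (b + 0)) := tendsto_const_nhds.add hl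
        rw [add_zero] at this
        exact ge_of_tendsto' this fun i => (h i).1
      · have : Tendsto (fun i => b - s i) atTop (𝓝 (b - 0)) := tendsto_const_nhds.sub hl
        rw [sub_zero] at this
        exact le_of_tendsto' this fun i => (h i).2
    · intro h i
      exact ⟨by simp only [Set.mem_ofPred_eq]; linarith [hs i], by simp only [Set.mem_ofPred_eq]; linarith [hs i]⟩
  -- limits vanish
  have hlim : ∀ K' : Set (Rn n), IsConvexBody K' → z ∈ K' → Tendsto (fun i => Λ.L (K' ∩ W i) f) atTop (𝓝 0) := by
    intro K' hK' hz'
    have hb : IsConvexBody (⋂ i, (K' ∩ W i)) := by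
      rw [← Set.inter_iInter]
      exact hK'.inter (isClosed_iInter hWc) (convex_iInter hWv) ⟨z, hz', Set.mem_iInter.2 hzW⟩
    have h0 : Λ.L (⋂ i, (K' ∩ W i)) f = 0 := by
      apply Λ.simple _ hb
      apply interior_empty_of_subset_hyperplane (φ := φ.toContinuousLinearMap) (c := b)
      · intro h; apply hφ0; ext x
        have := congrArg (fun g => g x) h; simpa using this
      · intro x hx
        rw [← Set.inter_iInter, hWi] at hx
        exact hx.2
    rw [← h0]
    refine Λ.cont _ _ (fun i => hK'.inter (hWc i) (hWv i) ⟨z, hz', hzW i⟩) hb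
      (HC.nested (fun i => hK'.2.1.inter_right (hWc i)) ?_ rfl) f
    intro i j h x hx
    exact ⟨hx.1, hWa h hx.2⟩
  have hKm := body_le hK φ b h1
  have hKp := body_ge hK φ b h2
  have hzm : z ∈ K ∩ {x | φ x ≤ b} := ⟨hzK, hz.le⟩
  have hzp : z ∈ K ∩ {x | b ≤ φ x} := ⟨hzK, hz.ge⟩
  have hD : ∀ i, Λ.L K f - Λ.L (K ∩ {x | φ x ≤ b}) f - Λ.L (K ∩ {x | b ≤ φ x}) f =
      Λ.L (K ∩ W i) f - Λ.L (K ∩ {x | φ x ≤ b} ∩ W i) f - Λ.L (K ∩ {x | b ≤ φ x} ∩ W i) f := by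
    intro i
    let χ : C(Rn n, ℝ) := ⟨fun x => max 0 (1 - |φ x - b| / s i), by fun_prop⟩
    have hχ1 : ∀ x, φ x = b → (f * (1 - χ)) x = 0 := by
      intro x hx
      simp [χ, hx]
    have hχ0 : ∀ x, x ∉ {x | |φ x - b| < s i} → (f * χ) x = 0 := by
      intro x hx
      simp only [Set.mem_ofPred_eq, not_lt] at hx
      have : 1 - |φ x - b| / s i ≤ 0 := by
        rw [sub_nonpos, le_div_iff₀ (hs i)]; linarith
      simp [χ, this]
    have hbW : ∀ K' : Set (Rn n), IsConvexBody K' → z ∈ K' → IsConvexBody (K' ∩ W i) := fun K' hK' hz' =>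
      hK'.inter (hWc i) (hWv i) ⟨z, hz', hzW i⟩
    have hloc : ∀ K' : Set (Rn n), IsConvexBody K' → z ∈ K' → Λ.L K' (f * χ) = Λ.L (K' ∩ W i) (f * χ) := by
      intro K' hK' hz'
      refine Λ.loc _ _ {x | |φ x - b| < s i} hK' (hbW K' hK' hz') (isOpen_lt (by fun_prop) continuous_const) ?_ _ hχ0
      ext x
      simp only [Set.mem_inter_iff, Set.mem_ofPred_eq, W]
      constructor
      · rintro ⟨h1, h2⟩
        have := abs_lt.1 h2
        exact ⟨⟨h1, by linarith, by linarith⟩, h2⟩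
      · exact fun h => ⟨h.1.1, h.2⟩
    have hfeq : f = f * χ + f * (1 - χ) := by ring
    have c1 := Λ.cut_aux hK φ b h1 h2 _ hχ1
    have c2 := Λ.cut_aux (hbW K hK hzK) φ b ⟨z, ⟨hzK, hzW i⟩, hz.le⟩ ⟨z, ⟨hzK, hzW i⟩, hz.ge⟩ _ hχ1
    rw [Set.inter_right_comm, Set.inter_right_comm K (W i)] at c2
    rw [hfeq]; simp only [map_add]
    rw [hloc K hK hzK, hloc _ hKm hzm, hloc _ hKp hzp, c1, c2]
    ring
  have hl : Tendsto (fun i => Λ.L (K ∩ W i) f - Λ.L (K ∩ {x | φ x ≤ b} ∩ W i) f - Λ.L (K ∩ {x | b ≤ φ x} ∩ W i) f)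
      atTop (𝓝 (0 - 0 - 0)) := ((hlim K hK hzK).sub (hlim _ hKm hzm)).sub (hlim _ hKp hzp)
  have := tendsto_nhds_unique (tendsto_const_nhds.congr hD) hl
  linear_combination this

end cut

end

section

open MeasureTheory Metric Filter Topology
open scoped Pointwise

section cyl
variable {n m : ℕ}

theorem addlin {g : ℝ → ℂ} (hadd : ∀ s t, 0 ≤ s → 0 ≤ t → g (s + t) = g s + g t)
    (hc : ∀ u : ℕ → ℝ, (∀ i, 0 ≤ u i) → ∀ s, 0 ≤ s → Tendsto u atTop (𝓝 s) →
      Tendsto (fun i => g (u i)) atTop (𝓝 (g s))) (s : ℝ) (hs : 0 ≤ s) : g s = s * g 1 := by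
  have h0 : g 0 = 0 := by have := hadd 0 0 le_rfl le_rfl; simpa using this
  have hn : ∀ (k : ℕ) (s : ℝ), 0 ≤ s → g (k * s) = k * g s := by
    intro k s hs
    induction k with
    | zero => simp [h0]
    | succ k ih =>
      rw [Nat.cast_succ, add_mul, one_mul, hadd _ _ (by positivity) hs, ih]
      push_cast; ring
  let u : ℕ → ℝ := fun i => (⌊s * (i:ℝ)⌋₊ : ℝ) / i
  have hu : Tendsto u atTop (𝓝 s) :=
    (tendsto_nat_floor_mul_div_atTop (R := ℝ) hs).comp tendsto_natCast_atTop_atTop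
  have h1 := hc u (fun i => by positivity) s hs hu
  have h2 : Tendsto (fun i => (u i : ℂ) * g 1) atTop (𝓝 (s * g 1)) :=
    ((Complex.continuous_ofReal.tendsto _).comp hu).mul_const _
  refine tendsto_nhds_unique h1 (h2.congr' ?_)
  filter_upwards [eventually_gt_atTop 0] with i hi
  have hi' : (i : ℝ) ≠ 0 := by positivity
  have hi2 : (i : ℂ) ≠ 0 := by exact_mod_cast hi'
  have e1 := hn i (1 / i) (by positivity)
  rw [mul_one_div_cancel hi'] at e1
  have e2 := hn ⌊s * (i:ℝ)⌋₊ (1 / i) (by positivity)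
  rw [mul_one_div] at e2
  simp only [u]
  rw [e2, e1]; push_cast; field_simp

/-- coordinates of cylinders -/
abbrev CE (m : ℕ) := (Rn m × ℝ) ≃L[ℝ] Rn (m + 1)

/-- cylinder -/
def Cy (e : CE m) (M : Set (Rn m)) (a b : ℝ) : Set (Rn (m + 1)) := e '' (M ×ˢ Set.Icc a b)

theorem mem_Cy (e : CE m) (M : Set (Rn m)) (a b : ℝ) (x : Rn (m+1)) :
    x ∈ Cy e M a b ↔ (e.symm x).1 ∈ M ∧ a ≤ (e.symm x).2 ∧ (e.symm x).2 ≤ b := by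
  rw [Cy, ContinuousLinearEquiv.image_eq_preimage_symm]; rfl

/-- base projection -/
def prC (e : CE m) : C(Rn (m+1), Rn m) := ⟨fun x => (e.symm x).1, by fun_prop⟩
/-- height -/
def htC (e : CE m) : C(Rn (m+1), ℝ) := ⟨fun x => (e.symm x).2, by fun_prop⟩
/-- product function -/
noncomputable def fw (e : CE m) (f : C(Rn m, ℝ)) (w : C(ℝ, ℝ)) : C(Rn (m+1), ℝ) :=
  f.comp (prC e) * w.comp (htC e)

theorem fw_apply (e : CE m) (f : C(Rn m, ℝ)) (w : C(ℝ, ℝ)) (x) :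
    fw e f w x = f (e.symm x).1 * w (e.symm x).2 := rfl

theorem Cy.body (e : CE m) {M : Set (Rn m)} (hM : IsConvexBody M) {a b : ℝ} (h : a ≤ b) :
    IsConvexBody (Cy e M a b) :=
  hM.cyl (Set.nonempty_Icc.2 h) isCompact_Icc (convex_Icc a b) (e : (Rn m × ℝ) →L[ℝ] Rn (m+1))

theorem Cy.HC (e : CE m) {Mi : ℕ → Set (Rn m)} {M : Set (Rn m)} (h : HC Mi M) {a b : ℕ → ℝ} {a0 b0 : ℝ}
    (hab : ∀ i, a i ≤ b i) (h0 : a0 ≤ b0)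
    (ha : Tendsto a atTop (𝓝 a0)) (hb : Tendsto b atTop (𝓝 b0)) :
    _root_.HC (fun i => Cy e (Mi i) (a i) (b i)) (Cy e M a0 b0) :=
  (h.prod (_root_.HC.Icc hab h0 ha hb)).image (e : (Rn m × ℝ) →L[ℝ] Rn (m+1)).lipschitz

theorem Cy.cut (Λ : Loc (m+1)) (e : CE m) {M : Set (Rn m)} (hM : IsConvexBody M) {a b c : ℝ} (h1 : a ≤ b)
    (h2 : b ≤ c) (f) : Λ.L (Cy e M a c) f = Λ.L (Cy e M a b) f + Λ.L (Cy e M b c) f := by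
  let φ : Du (m+1) := (LinearMap.snd ℝ (Rn m) ℝ).comp (e.symm : Rn (m+1) →L[ℝ] _).toLinearMap
  have hφ : ∀ x, φ x = (e.symm x).2 := fun x => rfl
  have hφ0 : φ ≠ 0 := by
    intro h
    have : φ (e (0, 1)) = 0 := by rw [h]; rfl
    rw [hφ] at this; simp at this
  obtain ⟨y, hy⟩ := hM.1
  have hmem : ∀ c', a ≤ b → b ≤ c' → e (y, b) ∈ Cy e M a c' := fun c' h1 h2 =>
    ⟨(y, b), ⟨hy, h1, h2⟩, rfl⟩
  have e1 : Cy e M a c ∩ {x | φ x ≤ b} = Cy e M a b := by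
    ext x
    simp only [Set.mem_inter_iff, mem_Cy, hφ, Set.mem_ofPred_eq]
    constructor
    · exact fun h => ⟨h.1.1, h.1.2.1, h.2⟩
    · exact fun h => ⟨⟨h.1, h.2.1, h.2.2.trans h2⟩, h.2.2⟩
  have e2 : Cy e M a c ∩ {x | b ≤ φ x} = Cy e M b c := by
    ext x
    simp only [Set.mem_inter_iff, mem_Cy, hφ, Set.mem_ofPred_eq]
    constructor
    · exact fun h => ⟨h.1.1, h.2, h.1.2.2⟩
    · exact fun h => ⟨⟨h.1, h1.trans h.2.1, h.2.2⟩, h.2.1⟩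
  have := Λ.cut (Cy.body e hM (h1.trans h2)) hφ0 b ⟨e (y, b), hmem c h1 h2, by simp [hφ]⟩
    ⟨e (y, b), hmem c h1 h2, by simp [hφ]⟩ f
  rwa [e1, e2] at this

theorem Cy.shift (e : CE m) (M : Set (Rn m)) (a b s : ℝ) :
    (fun y => y + e (0, s)) '' Cy e M a b = Cy e M (a + s) (b + s) := by
  ext x
  rw [Set.mem_image, mem_Cy]
  constructor
  · rintro ⟨y, hy, rfl⟩
    rw [mem_Cy] at hy
    simpa using hy
  · intro h
    refine ⟨x - e (0, s), ?_, by simp⟩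
    rw [mem_Cy]
    simp only [map_sub, ContinuousLinearEquiv.symm_apply_apply, Prod.fst_sub, sub_zero, Prod.snd_sub]
    exact ⟨h.1, by linarith, by linarith⟩

/-- shift on the line -/
def shR (s : ℝ) : C(ℝ, ℝ) := ⟨fun x => x + s, by fun_prop⟩

theorem Cy.L_shift (Λ : Loc (m+1)) (e : CE m) {M : Set (Rn m)} (hM : IsConvexBody M) {a b : ℝ} (s : ℝ) (h : a ≤ b)
    (f : C(Rn m, ℝ)) (w : C(ℝ, ℝ)) :
    Λ.L (Cy e M (a + s) (b + s)) (fw e f w) = Λ.L (Cy e M a b) (fw e f (w.comp (shR s))) := by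
  rw [← Cy.shift, Λ.trans _ (Cy.body e hM h)]
  congr 1
  ext x
  simp [fw, shiftC, prC, htC, shR]

theorem Cy.lam_cont (Λ : Loc (m+1)) (e : CE m) {M : Set (Rn m)} (hM : IsConvexBody M) (f) 
    (u : ℕ → ℝ) (hu : ∀ i, 0 ≤ u i) (s : ℝ) (hs : 0 ≤ s) (h : Tendsto u atTop (𝓝 s)) :
    Tendsto (fun i => Λ.L (Cy e M 0 (u i)) f) atTop (𝓝 (Λ.L (Cy e M 0 s) f)) :=
  Λ.cont _ _ (fun i => Cy.body e hM (hu i)) (Cy.body e hM hs)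
    (Cy.HC e (_root_.HC.const M) hu hs tendsto_const_nhds h) f

theorem Cy.lam_add (Λ : Loc (m+1)) (e : CE m) {M : Set (Rn m)} (hM : IsConvexBody M) 
    (f : C(Rn m, ℝ)) (w : C(ℝ, ℝ)) (s t : ℝ) (hs : 0 ≤ s) (ht : 0 ≤ t) :
    Λ.L (Cy e M 0 (s + t)) (fw e f w) = Λ.L (Cy e M 0 s) (fw e f w) +
      Λ.L (Cy e M 0 t) (fw e f (w.comp (shR s))) := by
  rw [Cy.cut Λ e hM hs (by linarith : s ≤ s + t), ← Cy.L_shift Λ e hM s ht, zero_add, add_comm t s]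

theorem Cy.slab_one (Λ : Loc (m+1)) (e : CE m) {M : Set (Rn m)} (hM : IsConvexBody M) 
    (f : C(Rn m, ℝ)) (s : ℝ) (hs : 0 ≤ s) :
    Λ.L (Cy e M 0 s) (fw e f 1) = s * Λ.L (Cy e M 0 1) (fw e f 1) :=
  addlin (g := fun s => Λ.L (Cy e M 0 s) (fw e f 1)) (fun s t hs ht => Cy.lam_add Λ e hM f 1 s t hs ht)
    (Cy.lam_cont Λ e hM _) s hs

/-- power function -/
def powC (j : ℕ) : C(ℝ, ℝ) := ⟨fun x => x ^ j, by fun_prop⟩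

theorem Cy.slab_pow (Λ : Loc (m+1)) (e : CE m) {M : Set (Rn m)} (hM : IsConvexBody M) 
    (f : C(Rn m, ℝ)) (h0 : Λ.L (Cy e M 0 1) (fw e f 1) = 0) (j : ℕ) : ∀ s : ℝ, 0 ≤ s →
    Λ.L (Cy e M 0 s) (fw e f (powC j)) = ((s ^ j - 0 ^ j : ℝ) : ℂ) * Λ.L (Cy e M 0 1) (fw e f (powC 1)) := by
  induction j using Nat.strong_induction_on with
  | _ j ih =>
  set γ := Λ.L (Cy e M 0 1) (fw e f (powC 1)) with hγ
  rcases Nat.eq_zero_or_pos j with rfl | hj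
  · intro s hs
    have : powC 0 = 1 := by ext x; simp [powC]
    rw [this, Cy.slab_one Λ e hM f s hs, h0]; simp
  let g : ℝ → ℂ := fun s => Λ.L (Cy e M 0 s) (fw e f (powC j)) - ((s ^ j : ℝ) : ℂ) * γ
  have hexp : ∀ s t : ℝ, 0 ≤ t → Λ.L (Cy e M 0 t) (fw e f ((powC j).comp (shR s))) =
      (((t + s) ^ j - t ^ j - s ^ j : ℝ) : ℂ) * γ + Λ.L (Cy e M 0 t) (fw e f (powC j)) := by
    intro s t ht
    have : fw e f ((powC j).comp (shR s)) = (∑ i ∈ Finset.range j, (s ^ (j - i) * (j.choose i : ℝ)) • fw e f (powC i))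
        + fw e f (powC j) := by
      ext x
      simp only [fw_apply, ContinuousMap.add_apply, ContinuousMap.coe_sum, Finset.sum_apply, ContinuousMap.coe_smul, Pi.smul_apply,
        ContinuousMap.comp_apply, powC, shR, ContinuousMap.coe_mk, add_pow, Finset.sum_range_succ, smul_eq_mul]
      simp only [Nat.sub_self, pow_zero, mul_one, Nat.choose_self, Nat.cast_one, mul_add, Finset.mul_sum]
      congr 1
      exact Finset.sum_congr rfl fun i _ => by ring
    rw [this, map_add, map_sum]
    congr 1
    have e1 : ∀ i ∈ Finset.range j, Λ.L (Cy e M 0 t) ((s ^ (j - i) * (j.choose i : ℝ)) • fw e f (powC i)) =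
        ((t ^ i * s ^ (j - i) * (j.choose i : ℝ) - 0 ^ i * s ^ (j-i) * (j.choose i : ℝ) : ℝ) : ℂ) * γ := by
      intro i hi
      rw [map_smul, ih i (Finset.mem_range.1 hi) t ht, Complex.real_smul]
      push_cast; ring
    rw [Finset.sum_congr rfl e1, ← Finset.sum_mul]
    congr 1
    rw [← Complex.ofReal_sum, Finset.sum_sub_distrib]
    congr 1
    have e2 := add_pow t s j
    have e3 := add_pow 0 s j
    rw [Finset.sum_range_succ] at e2 e3
    simp only [Nat.sub_self, pow_zero, mul_one, Nat.choose_self, Nat.cast_one, zero_add] at e2 e3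
    rw [zero_pow hj.ne'] at e3
    linarith
  have hg : ∀ s, 0 ≤ s → g s = s * g 1 := by
    apply addlin
    · intro s t hs ht
      simp only [g]
      rw [Cy.lam_add Λ e hM f _ s t hs ht, hexp s t ht]
      push_cast; ring
    · intro u hu s hs h
      refine (Cy.lam_cont Λ e hM _ u hu s hs h).sub (Tendsto.mul_const _ ?_)
      exact (Complex.continuous_ofReal.tendsto _).comp (h.pow j)
  have hg1 : g 1 = 0 := by
    rcases Nat.lt_or_ge 1 j with hj1 | hj1
    · -- use the uniform bound
      let u : ℕ → ℝ := fun i => 1 / ((i : ℝ) + 1)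
      have hu0 : ∀ i, 0 < u i := fun i => by simp only [u]; positivity
      have hut : Tendsto u atTop (𝓝 0) := tendsto_one_div_add_atTop_nhds_zero_nat
      obtain ⟨C, hC0, hC⟩ := Λ.ub (fun i => Cy.body e hM (hu0 i).le) (Cy.body e hM le_rfl)
        (Cy.HC e (_root_.HC.const M) (fun i => (hu0 i).le) le_rfl tendsto_const_nhds hut)
      obtain ⟨B, hB⟩ := hM.2.1.exists_bound_of_continuousOn f.continuous.continuousOn
      have hB0 : 0 ≤ B := by
        obtain ⟨y, hy⟩ := hM.1
        exact (norm_nonneg _).trans (hB y hy)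
      have hbd : ∀ i, ‖g 1‖ ≤ (C * B + ‖γ‖) * u i := by
        intro i
        have h1 : ‖Λ.L (Cy e M 0 (u i)) (fw e f (powC j))‖ ≤ C * (B * u i ^ j) := by
          apply hC
          intro x hx
          rw [mem_Cy] at hx
          rw [fw_apply, abs_mul]
          refine mul_le_mul (hB _ hx.1) ?_ (abs_nonneg _) hB0
          simp only [powC, ContinuousMap.coe_mk]
          rw [abs_of_nonneg (pow_nonneg hx.2.1 _)]
          exact pow_le_pow_left₀ hx.2.1 hx.2.2 j
        have h2 : ‖g (u i)‖ ≤ (C * B + ‖γ‖) * u i ^ j := by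
          refine (norm_sub_le _ _).trans ?_
          rw [norm_mul, Complex.norm_real, Real.norm_of_nonneg (pow_nonneg (hu0 i).le _)]
          linarith
        rw [hg _ (hu0 i).le, norm_mul, Complex.norm_real, Real.norm_of_nonneg (hu0 i).le] at h2
        have h3 : u i ^ j ≤ u i * u i := by
          rw [← pow_two]
          refine pow_le_pow_of_le_one (hu0 i).le ?_ hj1
          simp only [u]; rw [div_le_one (by positivity)]; linarith [(Nat.cast_nonneg i : (0:ℝ) ≤ i)]
        have h4 : u i * ‖g 1‖ ≤ u i * ((C * B + ‖γ‖) * u i) := by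
          refine h2.trans ?_
          have : 0 ≤ C * B + ‖γ‖ := by positivity
          nlinarith
        exact le_of_mul_le_mul_left h4 (hu0 i)
      have : Tendsto (fun i => (C * B + ‖γ‖) * u i) atTop (𝓝 ((C * B + ‖γ‖) * 0)) := hut.const_mul _
      rw [mul_zero] at this
      exact norm_le_zero_iff.1 (ge_of_tendsto' this hbd)
    · have : j = 1 := by omega
      subst this
      simp [g, hγ]
  intro s hs
  have := hg s hs
  rw [hg1, mul_zero] at this
  simp only [g] at this
  rw [zero_pow hj.ne', sub_zero]
  exact sub_eq_zero.1 this

/-- polynomial as a continuous function -/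
noncomputable def polyC (q : Polynomial ℝ) : C(ℝ, ℝ) := ⟨fun x => q.eval x, q.continuous⟩

theorem Cy.poly0 (Λ : Loc (m+1)) (e : CE m) {M : Set (Rn m)} (hM : IsConvexBody M) 
    (f : C(Rn m, ℝ)) (h0 : Λ.L (Cy e M 0 1) (fw e f 1) = 0) (s : ℝ) (hs : 0 ≤ s) (q : Polynomial ℝ) :
    Λ.L (Cy e M 0 s) (fw e f (polyC q)) =
      ((q.eval s - q.eval 0 : ℝ) : ℂ) * Λ.L (Cy e M 0 1) (fw e f (powC 1)) := by
  induction q using Polynomial.induction_on' with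
  | add p q hp hq =>
    have : fw e f (polyC (p + q)) = fw e f (polyC p) + fw e f (polyC q) := by
      ext x; simp [fw_apply, polyC, mul_add]
    rw [this, map_add, hp, hq]; simp only [Polynomial.eval_add]; push_cast; ring
  | monomial j a =>
    have : fw e f (polyC (Polynomial.monomial j a)) = a • fw e f (powC j) := by
      ext x; simp [fw_apply, polyC, powC]; ring
    rw [this, map_smul, Cy.slab_pow Λ e hM f h0 j s hs, Complex.real_smul]
    simp only [Polynomial.eval_monomial]; push_cast; ring

theorem Cy.poly (Λ : Loc (m+1)) (e : CE m) {M : Set (Rn m)} (hM : IsConvexBody M) 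
    (f : C(Rn m, ℝ)) (h0 : Λ.L (Cy e M 0 1) (fw e f 1) = 0) {a b : ℝ} (hab : a ≤ b) (q : Polynomial ℝ) :
    Λ.L (Cy e M a b) (fw e f (polyC q)) =
      ((q.eval b - q.eval a : ℝ) : ℂ) * Λ.L (Cy e M 0 1) (fw e f (powC 1)) := by
  have h1 := Cy.L_shift Λ e hM a (sub_nonneg.2 hab) f (polyC q)
  rw [zero_add, sub_add_cancel] at h1
  have h2 : (polyC q).comp (shR a) = polyC (q.comp (Polynomial.X + Polynomial.C a)) := by
    ext x; simp [polyC, shR]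
  rw [h1, h2, Cy.poly0 Λ e hM f h0 _ (sub_nonneg.2 hab)]
  simp

end cyl

end

section

open MeasureTheory Metric Filter Topology
open scoped Pointwise

section theta
variable {n m : ℕ}

theorem fw_add (e : CE m) (f g : C(Rn m, ℝ)) (w : C(ℝ, ℝ)) : fw e (f + g) w = fw e f w + fw e g w := by
  ext x; simp [fw_apply, add_mul]

theorem fw_smul (e : CE m) (c : ℝ) (g : C(Rn m, ℝ)) (w : C(ℝ, ℝ)) : fw e (c • g) w = c • fw e g w := by
  ext x; simp [fw_apply, mul_assoc]

theorem HC.smul_zero {M : Set (Rn m)} (hM : IsConvexBody M) {u : ℕ → ℝ} (hu : Tendsto u atTop (𝓝 0)) :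
    HC (fun i => u i • M) {(0 : Rn m)} := by
  obtain ⟨R, hR⟩ := hM.2.1.isBounded.exists_norm_le
  obtain ⟨y0, hy0⟩ := hM.1
  have hR0 : 0 ≤ R := (norm_nonneg _).trans (hR y0 hy0)
  have h0 : Tendsto (fun i => |u i| * R) atTop (𝓝 0) := by
    simpa using (hu.abs).mul_const R
  refine HC.of_dist h0 fun i => ⟨?_, ?_⟩
  · rintro x ⟨y, hy, rfl⟩
    refine ⟨0, rfl, ?_⟩
    simp only [dist_zero_right, norm_smul, Real.norm_eq_abs]
    exact mul_le_mul_of_nonneg_left (hR y hy) (abs_nonneg _)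
  · rintro x rfl
    refine ⟨u i • y0, Set.smul_mem_smul_set hy0, ?_⟩
    simp only [dist_zero_left, norm_smul, Real.norm_eq_abs]
    exact mul_le_mul_of_nonneg_left (hR y0 hy0) (abs_nonneg _)

/-- slicing functional -/
noncomputable def Theta (Λ : Loc (m+1)) (e : CE m) (w : C(ℝ, ℝ)) : Loc m where
  L M := 
    { toFun := fun f => Λ.L (Cy e M 0 1) (fw e f w)
      map_add' := fun f g => by rw [fw_add, map_add]
      map_smul' := fun c f => by rw [fw_smul, map_smul]; rfl }
  bound := by
    intro M hM
    obtain ⟨C, hC0, hC⟩ := Λ.bound _ (Cy.body e hM zero_le_one)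
    obtain ⟨B, hB⟩ := (isCompact_Icc (a := (0:ℝ)) (b := 1)).exists_bound_of_continuousOn w.continuous.continuousOn
    have hB0 : 0 ≤ B := (norm_nonneg _).trans (hB 0 ⟨le_rfl, zero_le_one⟩)
    refine ⟨C * B, by positivity, fun f N hN => ?_⟩
    have hN0 : 0 ≤ N := by obtain ⟨y, hy⟩ := hM.1; exact (abs_nonneg _).trans (hN y hy)
    refine (hC _ (B * N) ?_).trans (by rw [mul_assoc])
    intro x hx
    rw [mem_Cy] at hx
    rw [fw_apply, abs_mul, mul_comm]
    exact mul_le_mul (hB _ hx.2) (hN _ hx.1) (abs_nonneg _) hB0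
  loc := by
    intro K K' U hK hK' hU h f hf
    refine Λ.loc _ _ ((prC e) ⁻¹' U) (Cy.body e hK zero_le_one) (Cy.body e hK' zero_le_one)
      (hU.preimage (prC e).continuous) ?_ _ ?_
    · ext x
      have := Set.ext_iff.1 h (prC e x)
      simp only [Set.mem_inter_iff, mem_Cy, Set.mem_preimage] at this ⊢
      change (_ ∧ _) ∧ _ ↔ (_ ∧ _) ∧ _ 
      simp only [prC, ContinuousMap.coe_mk] at this ⊢
      tauto
    · intro x hx
      rw [fw_apply, hf (e.symm x).1 hx, zero_mul]
  trans := by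
    intro M hM a f
    have : Cy e ((fun y => y + a) '' M) 0 1 = (fun y => y + e (a, 0)) '' Cy e M 0 1 := by
      ext x
      constructor
      · rintro ⟨⟨y, t⟩, ⟨⟨z, hz, hzy⟩, ht⟩, rfl⟩
        refine ⟨e (z, t), ⟨(z, t), ⟨hz, ht⟩, rfl⟩, ?_⟩
        simp only at hzy
        simp only [← map_add, Prod.mk_add_mk, add_zero, hzy]
      · rintro ⟨_, ⟨⟨z, t⟩, ⟨hz, ht⟩, rfl⟩, rfl⟩
        refine ⟨(z + a, t), ⟨⟨z, hz, rfl⟩, ht⟩, ?_⟩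
        simp only [← map_add, Prod.mk_add_mk, add_zero]
    change Λ.L _ _ = Λ.L _ _
    rw [this, Λ.trans _ (Cy.body e hM zero_le_one)]
    congr 1
    ext x
    simp [fw_apply, shiftC]
  cont := by
    intro Ki K hKi hK h f
    exact Λ.cont _ _ (fun i => Cy.body e (hKi i) zero_le_one) (Cy.body e hK zero_le_one)
      (Cy.HC e h (fun _ => zero_le_one) zero_le_one tendsto_const_nhds tendsto_const_nhds) _
  simple := by
    intro M hM h f
    refine Λ.simple _ (Cy.body e hM zero_le_one) ?_ _
    have : Cy e M 0 1 = e.toHomeomorph '' (M ×ˢ Set.Icc 0 1) := rfl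
    rw [this, ← Homeomorph.image_interior, interior_prod_eq, h]
    simp

theorem Theta_apply (Λ : Loc (m+1)) (e : CE m) (w : C(ℝ, ℝ)) (M f) :
   (Theta Λ e w).L M f = Λ.L (Cy e M 0 1) (fw e f w) := rfl

theorem Cy.L_smul {Λ : Loc (m+1)} {k : ℕ} (hh : Λ.Hom k) (e : CE m) (f w) {M} (hM : IsConvexBody M) 
    {t : ℝ} (ht : 0 < t) :
    Λ.L (Cy e (t • M) 0 1) (fw e f w) = (t:ℂ)^k *
      Λ.L (Cy e M 0 t⁻¹) (fw e (f.comp (scaleC t)) (w.comp ⟨fun x => t * x, by fun_prop⟩)) := by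
  have : Cy e (t • M) 0 1 = t • Cy e M 0 t⁻¹ := by
    ext x
    constructor
    · rintro ⟨⟨y, s⟩, ⟨⟨z, hz, rfl⟩, hs⟩, rfl⟩
      refine ⟨e (z, t⁻¹ * s), ⟨(z, t⁻¹ * s), ⟨hz, by have := hs.1; simp only at this ⊢; positivity, ?_⟩, rfl⟩, ?_⟩
      · exact mul_le_of_le_one_right (by positivity) hs.2
      · simp only [← map_smul, Prod.smul_mk, smul_eq_mul]
        rw [mul_inv_cancel_left₀ ht.ne']
    · rintro ⟨_, ⟨⟨z, s⟩, ⟨hz, hs⟩, rfl⟩, rfl⟩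
      refine ⟨(t • z, t * s), ⟨⟨z, hz, rfl⟩, by have := hs.1; simp only at this ⊢; positivity, ?_⟩, ?_⟩
      · calc t * s ≤ t * t⁻¹ := by gcongr; exact hs.2
          _ = 1 := mul_inv_cancel₀ ht.ne'
      · simp only [← map_smul, Prod.smul_mk, smul_eq_mul]
  rw [this, hh t ht _ (Cy.body e hM (by positivity))]
  congr 2
  ext x
  simp [fw_apply, scaleC]

theorem Theta_hom_one {Λ : Loc (m+1)} {k : ℕ} (hh : Λ.Hom (k+1)) (e : CE m) : (Theta Λ e 1).Hom k := by
  intro t ht M hM f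
  rw [Theta_apply, Theta_apply, Cy.L_smul hh e f 1 hM ht]
  have : (1 : C(ℝ,ℝ)).comp ⟨fun x => t * x, by fun_prop⟩ = 1 := by ext; simp
  rw [this, Cy.slab_one Λ e hM _ _ (by positivity : 0 ≤ t⁻¹)]
  have : (t:ℂ) ≠ 0 := by exact_mod_cast ht.ne'
  push_cast; field_simp; ring

theorem Theta_zero {Λ : Loc (m+1)} (hh : Λ.Hom 0) (e : CE m) {M} (hM : IsConvexBody M) (f) : 
    Λ.L (Cy e M 0 1) (fw e f 1) = 0 := by
  let u : ℕ → ℝ := fun i => 1 / ((i : ℝ) + 1)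
  have hu0 : ∀ i, 0 < u i := fun i => by simp only [u]; positivity
  have hut : Tendsto u atTop (𝓝 0) := tendsto_one_div_add_atTop_nhds_zero_nat
  obtain ⟨C, hC0, hC⟩ := (Theta Λ e 1).ub (fun i => hM.smul (u i)) (isConvexBody_singleton 0) (HC.smul_zero hM hut)
  obtain ⟨B, hB⟩ := hM.2.1.exists_bound_of_continuousOn f.continuous.continuousOn
  have key : ∀ i, ‖Λ.L (Cy e M 0 1) (fw e f 1)‖ ≤ u i * (C * B) := by
    intro i
    have h1 := Cy.L_smul hh e (f.comp (scaleC (u i)⁻¹)) 1 hM (hu0 i)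
    have h2 : (1 : C(ℝ,ℝ)).comp ⟨fun x => u i * x, by fun_prop⟩ = 1 := by ext; simp
    have h3 : (f.comp (scaleC (u i)⁻¹)).comp (scaleC (u i)) = f := by
      ext x; simp [scaleC, smul_smul, (hu0 i).ne']
    rw [h2, h3, Cy.slab_one Λ e hM _ _ (inv_nonneg.2 (hu0 i).le), pow_zero, one_mul] at h1
    have h4 := hC i (f.comp (scaleC (u i)⁻¹)) B (by
      rintro x ⟨y, hy, rfl⟩
      have := hB y hy
      simpa [scaleC, smul_smul, (hu0 i).ne'] using this)
    rw [Theta_apply, h1, norm_mul, Complex.norm_real, Real.norm_of_nonneg (inv_nonneg.2 (hu0 i).le)] at h4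
    rwa [inv_mul_le_iff₀ (hu0 i)] at h4
  have h5 : Tendsto (fun i => u i * (C * B)) atTop (𝓝 0) := by simpa using hut.mul_const (C * B)
  exact norm_le_zero_iff.1 (ge_of_tendsto' h5 key)

theorem Theta_hom_pow {Λ : Loc (m+1)} (hh : Λ.Hom 0) (e : CE m) : (Theta Λ e (powC 1)).Hom 0 := by
  intro t ht M hM f
  rw [Theta_apply, Theta_apply, Cy.L_smul hh e f _ hM ht]
  have : fw e (f.comp (scaleC t)) ((powC 1).comp ⟨fun x => t * x, by fun_prop⟩) = t • fw e (f.comp (scaleC t)) (powC 1) := by 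
    ext; simp [fw_apply, powC]; ring
  rw [this, map_smul, Cy.slab_pow Λ e hM _ (Theta_zero hh e hM _) 1 _ (by positivity : 0 ≤ t⁻¹), Complex.real_smul]
  have : (t:ℂ) ≠ 0 := by exact_mod_cast ht.ne'
  push_cast; field_simp; simp

end theta

end

section

open MeasureTheory Metric Filter Topology
open scoped Pointwise

section parf
variable {n m : ℕ}

/-- cylinder coordinates from a frame -/
noncomputable def ceOf (T : Rn (m+1) ≃L[ℝ] (Fin (m+1) → ℝ)) (j : Fin (m+1)) : CE m :=
  LinearEquiv.toContinuousLinearEquiv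
  { toFun := fun p => T.symm (j.insertNth p.2 (fun i => p.1 i))
    map_add' := fun p q => by
      rw [← map_add]; congr 1
      ext i
      revert i
      rw [Fin.forall_iff_succAbove j]
      simp
    map_smul' := fun c p => by
      rw [← map_smul]; congr 1
      ext i
      revert i
      rw [Fin.forall_iff_succAbove j]
      simp
    invFun := fun x => (WithLp.toLp 2 (fun i => T x (j.succAbove i)), T x j)
    left_inv := fun p => by
      ext <;> simp
    right_inv := fun x => by
      rw [ContinuousLinearEquiv.symm_apply_eq]
      ext i
      revert i
      rw [Fin.forall_iff_succAbove j]
      simp }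

theorem ceOf_symm (T : Rn (m+1) ≃L[ℝ] (Fin (m+1) → ℝ)) (j : Fin (m+1)) (x) :
    (ceOf T j).symm x = (WithLp.toLp 2 (fun i => T x (j.succAbove i)), T x j) := rfl

theorem Par.eq_Cy (T : Rn (m+1) ≃L[ℝ] (Fin (m+1) → ℝ)) (j : Fin (m+1)) (lo hi) :
    Par T lo hi = Cy (ceOf T j) (Par (EuclideanSpace.equiv (Fin m) ℝ) (fun i => lo (j.succAbove i)) (fun i => hi (j.succAbove i)))
      (lo j) (hi j) := by
  ext x
  rw [mem_Cy, ceOf_symm]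
  simp only [Par, Set.mem_ofPred_eq]
  rw [Fin.forall_iff_succAbove j, and_comm]
  rfl

/-- product of polynomials in the coordinates -/
noncomputable def pf (T : Rn n ≃L[ℝ] (Fin n → ℝ)) (P : Fin n → Polynomial ℝ) : C(Rn n, ℝ) :=
  ⟨fun x => ∏ i, (P i).eval (T x i), by
    refine continuous_finsetProd _ fun i _ => ?_
    exact (P i).continuous.comp ((continuous_apply i).comp T.continuous)⟩

theorem pf_apply (T : Rn n ≃L[ℝ] (Fin n → ℝ)) (P : Fin n → Polynomial ℝ) (x) : pf T P x = ∏ i, (P i).eval (T x i) := rfl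

/-- vertex -/
noncomputable def vert (T : Rn n ≃L[ℝ] (Fin n → ℝ)) (lo hi : Fin n → ℝ) (ε : Fin n → Bool) : Rn n :=
  T.symm (fun i => if ε i then hi i else lo i)

/-- sign -/
def sgnB (ε : Fin n → Bool) : ℝ := ∏ i, (if ε i then 1 else -1)

/-- the signed vertex sum -/
noncomputable def vsum (T : Rn n ≃L[ℝ] (Fin n → ℝ)) (lo hi : Fin n → ℝ) (f : C(Rn n, ℝ)) : ℝ :=
  ∑ ε, sgnB ε * f (vert T lo hi ε)

theorem vsum_pf (T : Rn n ≃L[ℝ] (Fin n → ℝ)) (lo hi : Fin n → ℝ) (P : Fin n → Polynomial ℝ) :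
    vsum T lo hi (pf T P) = ∏ i, ((P i).eval (hi i) - (P i).eval (lo i)) := by
  have h := Finset.prod_univ_sum (fun _ : Fin n => (Finset.univ : Finset Bool))
    (fun i b => if b then (P i).eval (hi i) else -(P i).eval (lo i))
  simp only [Fintype.univ_bool, Finset.mem_singleton, Bool.true_eq_false, not_false_eq_true, Finset.sum_insert,
    Finset.sum_singleton, if_true, Bool.false_eq_true, if_false] at h
  simp only [sub_eq_add_neg]
  rw [h]
  have h2 : Fintype.piFinset (fun _ : Fin n => ({true, false} : Finset Bool)) = Finset.univ := by
    ext x; simp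
  rw [h2, vsum]
  refine Finset.sum_congr rfl fun ε _ => ?_
  rw [sgnB, pf_apply, ← Finset.prod_mul_distrib]
  refine Finset.prod_congr rfl fun i _ => ?_
  simp only [vert, ContinuousLinearEquiv.apply_symm_apply]
  cases ε i <;> simp

theorem vert_mem (T : Rn n ≃L[ℝ] (Fin n → ℝ)) {lo hi : Fin n → ℝ} (h : ∀ i, lo i ≤ hi i) (ε) : vert T lo hi ε ∈ Par T lo hi := by
  intro i
  simp only [vert, ContinuousLinearEquiv.apply_symm_apply]
  cases ε i <;> simp [h i]

theorem pf_dense (T : Rn n ≃L[ℝ] (Fin n → ℝ)) {Q : Set (Rn n)} (hQ : IsCompact Q) (E : C(Rn n, ℝ) →ₗ[ℝ] ℂ) (C : ℝ)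
    (hC : ∀ (f : C(Rn n, ℝ)) (M : ℝ), (∀ x ∈ Q, |f x| ≤ M) → ‖E f‖ ≤ C * M) (hE : ∀ P, E (pf T P) = 0) (f) : E f = 0 := by
  have hmul : ∀ x y : C(Rn n, ℝ), x ∈ Submodule.span ℝ (Set.range (pf T)) → y ∈ Submodule.span ℝ (Set.range (pf T)) →
      x * y ∈ Submodule.span ℝ (Set.range (pf T)) := by
    intro x y hx hy
    refine Submodule.span_induction₂ (p := fun x y _ _ => x * y ∈ Submodule.span ℝ (Set.range (pf T)))
      ?_ ?_ ?_ ?_ ?_ ?_ ?_ hx hy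
    · rintro _ _ ⟨P, rfl⟩ ⟨P', rfl⟩
      refine Submodule.subset_span ⟨P * P', ?_⟩
      ext x; simp [pf_apply, Finset.prod_mul_distrib]
    · intro y _; simp
    · intro y _; simp
    · intro x y z _ _ _ h1 h2; rw [add_mul]; exact Submodule.add_mem _ h1 h2
    · intro x y z _ _ _ h1 h2; rw [mul_add]; exact Submodule.add_mem _ h1 h2
    · intro r x y _ _ h1; rw [smul_mul_assoc]; exact Submodule.smul_mem _ _ h1
    · intro r x y _ _ h1; rw [mul_smul_comm]; exact Submodule.smul_mem _ _ h1
  let A : Subalgebra ℝ C(Rn n, ℝ) := Submodule.toSubalgebra (Submodule.span ℝ (Set.range (pf T)))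
    (Submodule.subset_span ⟨1, by ext x; simp [pf_apply]⟩) hmul
  have hA : A.SeparatesPoints := by
    intro x y hxy
    obtain ⟨i, hi⟩ : ∃ i, T x i ≠ T y i := by
      by_contra hcon; push Not at hcon; exact hxy (T.injective (funext hcon))
    refine ⟨pf T (Function.update 1 i Polynomial.X), ⟨pf T (Function.update 1 i Polynomial.X), Submodule.subset_span ⟨_, rfl⟩, rfl⟩, ?_⟩
    have : ∀ z, pf T (Function.update 1 i Polynomial.X) z = T z i := by
      intro z
      rw [pf_apply, Finset.prod_eq_single i]
      · simp
      · intro b _ hb; simp [hb]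
      · simp
    rw [this, this]; exact hi
  have hE0 : ∀ g ∈ A, E g = 0 := by
    intro g hg
    have : Submodule.span ℝ (Set.range (pf T)) ≤ LinearMap.ker E := by
      rw [Submodule.span_le]; rintro _ ⟨P, rfl⟩; exact hE P
    exact this hg
  by_contra hne
  have hpos : 0 < ‖E f‖ := norm_pos_iff.2 hne
  obtain ⟨g, hg, hgf⟩ := ContinuousMap.exists_mem_subalgebra_near_continuous_of_isCompact_of_separatesPoints hA f hQ
    (ε := ‖E f‖ / (2 * (|C| + 1))) (by positivity)
  have h1 := hC (g - f) _ (fun x hx => (hgf x hx).le)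
  rw [map_sub, hE0 g hg, zero_sub, norm_neg] at h1
  have h2 : C * (‖E f‖ / (2 * (|C| + 1))) ≤ ‖E f‖ / 2 := by
    rw [mul_div_assoc', div_le_div_iff₀ (by positivity) (by norm_num)]
    nlinarith [le_abs_self C]
  linarith

theorem par_step (Λ : Loc (m+1)) (Z : ∀ (e : CE m) M, IsConvexBody M → ∀ f, Λ.L (Cy e M 0 1) (fw e f 1) = 0)
    (T : Rn (m+1) ≃L[ℝ] (Fin (m+1) → ℝ)) {lo hi : Fin (m+1) → ℝ} (h : ∀ i, lo i ≤ hi i) (j) (P : Fin (m+1) → Polynomial ℝ) :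
    Λ.L (Par T lo hi) (pf T P) = (((P j).eval (hi j) - (P j).eval (lo j) : ℝ) : ℂ) *
      (Theta Λ (ceOf T j) (powC 1)).L 
        (Par (EuclideanSpace.equiv (Fin m) ℝ) (fun i => lo (j.succAbove i)) (fun i => hi (j.succAbove i)))
        (pf (EuclideanSpace.equiv (Fin m) ℝ) (fun i => P (j.succAbove i))) := by
  have hb : IsConvexBody (Par (EuclideanSpace.equiv (Fin m) ℝ) (fun i => lo (j.succAbove i)) (fun i => hi (j.succAbove i))) :=
    Par.body _ (fun i => h _)
  rw [Par.eq_Cy T j, Theta_apply, ← Cy.poly Λ (ceOf T j) hb _ (Z _ _ hb _) (h j)]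
  congr 1
  ext x
  rw [pf_apply, Fin.prod_univ_succAbove _ j, fw_apply, pf_apply, mul_comm]
  rfl

theorem par_formula (Λ : Loc (m+1)) (Z : ∀ (e : CE m) M, IsConvexBody M → ∀ f, Λ.L (Cy e M 0 1) (fw e f 1) = 0)
    (T : Rn (m+1) ≃L[ℝ] (Fin (m+1) → ℝ)) {lo hi : Fin (m+1) → ℝ} (h : ∀ i, lo i < hi i) :
    ∃ c : ℂ, ∀ f, Λ.L (Par T lo hi) f = c * vsum T lo hi f := by
  have h' : ∀ i, lo i ≤ hi i := fun i => (h i).le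
  let xx : Fin (m+1) → Polynomial ℝ := fun i => Polynomial.C (hi i - lo i)⁻¹ * Polynomial.X
  have hxx : ∀ i, (xx i).eval (hi i) - (xx i).eval (lo i) = 1 := by
    intro i
    simp only [xx, Polynomial.eval_mul, Polynomial.eval_C, Polynomial.eval_X]
    rw [← mul_sub, inv_mul_cancel₀ (sub_pos.2 (h i)).ne']
  have step : ∀ P j, Λ.L (Par T lo hi) (pf T P) = (((P j).eval (hi j) - (P j).eval (lo j) : ℝ) : ℂ) *
      Λ.L (Par T lo hi) (pf T (Function.update P j (xx j))) := by
    intro P j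
    rw [par_step Λ Z T h' j P, par_step Λ Z T h' j (Function.update P j (xx j))]
    simp only [Function.update_self, hxx, Fin.succAbove_ne, ne_eq, not_false_eq_true, Function.update_of_ne]
    simp
  have ind : ∀ (s : Finset (Fin (m+1))) P, Λ.L (Par T lo hi) (pf T P) =
      ((∏ j ∈ s, ((P j).eval (hi j) - (P j).eval (lo j)) : ℝ) : ℂ) * Λ.L (Par T lo hi) (pf T (s.piecewise xx P)) := by
    intro s P
    induction s using Finset.induction_on with
    | empty => simp
    | insert j s hj ih =>
      rw [Finset.piecewise_insert, Finset.prod_insert hj, ih, step (s.piecewise xx P) j]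
      simp only [Finset.piecewise_eq_of_notMem _ _ _ hj]
      push_cast; ring
  refine ⟨Λ.L (Par T lo hi) (pf T xx), fun f => ?_⟩
  set c := Λ.L (Par T lo hi) (pf T xx) with hc
  let V : C(Rn (m+1), ℝ) →ₗ[ℝ] ℂ :=
    { toFun := fun f => c * vsum T lo hi f
      map_add' := fun f g => by simp [vsum, mul_add, Finset.sum_add_distrib]
      map_smul' := fun a f => by
        simp only [vsum, ContinuousMap.coe_smul, Pi.smul_apply, smul_eq_mul, RingHom.id_apply, Complex.real_smul]
        push_cast
        rw [Finset.mul_sum, Finset.mul_sum, Finset.mul_sum]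
        exact Finset.sum_congr rfl fun i _ => by ring }
  obtain ⟨C, hC0, hC⟩ := Λ.bound _ (Par.body T h')
  have := pf_dense T (Par.body T h').2.1 (Λ.L (Par T lo hi) - V) (C + ‖c‖ * ∑ ε : Fin (m+1) → Bool, |sgnB ε|) ?_ ?_ f
  · rw [LinearMap.sub_apply, sub_eq_zero] at this
    exact this
  · intro f M hM
    rw [LinearMap.sub_apply, add_mul]
    refine (norm_sub_le _ _).trans (add_le_add (hC f M hM) ?_)
    simp only [V, LinearMap.coe_mk, AddHom.coe_mk]
    rw [norm_mul, Complex.norm_real, mul_assoc, Finset.sum_mul]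
    refine mul_le_mul_of_nonneg_left ((norm_sum_le _ _).trans ?_) (norm_nonneg _)
    refine Finset.sum_le_sum fun ε _ => ?_
    rw [norm_mul]
    exact mul_le_mul_of_nonneg_left (hM _ (vert_mem T h' ε)) (norm_nonneg _)
  · intro P
    rw [LinearMap.sub_apply, ind Finset.univ P]
    simp only [V, LinearMap.coe_mk, AddHom.coe_mk, vsum_pf, Finset.piecewise_univ]
    rw [← hc]; ring

end parf

end

section

open MeasureTheory Metric Filter Topology
open scoped Pointwise

section parity
variable {n m : ℕ}

theorem sgnB_ne (ε : Fin n → Bool) : sgnB ε ≠ 0 := by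
  rw [sgnB, Finset.prod_ne_zero_iff]
  intro i _
  cases ε i <;> simp

theorem vsum_single (T : Rn n ≃L[ℝ] (Fin n → ℝ)) (lo hi : Fin n → ℝ) (f : C(Rn n, ℝ))
    (h0 : f (vert T lo hi (fun _ => false)) = 1) (h1 : ∀ ε, (∃ i, ε i = true) → f (vert T lo hi ε) = 0) :
    vsum T lo hi f = sgnB (fun _ : Fin n => false) := by
  rw [vsum, Finset.sum_eq_single (fun _ => false)]
  · rw [h0, mul_one]
  · intro ε _ hε
    rw [h1 ε, mul_zero]
    by_contra hcon
    push Not at hcon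
    exact hε (funext fun i => by simpa using hcon i)
  · simp

/-- bump at the lower vertex -/
noncomputable def bmp (T : Rn n ≃L[ℝ] (Fin n → ℝ)) (lo hi : Fin n → ℝ) : C(Rn n, ℝ) :=
  ⟨fun x => ∏ i, max 0 (1 - |T x i - lo i| / (hi i - lo i)), by
    refine continuous_finsetProd _ fun i _ => ?_
    have : Continuous fun x => T x i := (continuous_apply i).comp T.continuous
    fun_prop⟩

theorem Loc.hom_pos_zero (Λ : Loc (m+1)) (Z : ∀ (e : CE m) M, IsConvexBody M → ∀ f, Λ.L (Cy e M 0 1) (fw e f 1) = 0)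
    {k : ℕ} (hk : 0 < k) (hh : Λ.Hom k) {K} (hK : IsConvexBody K) (f) : Λ.L K f = 0 := by
  refine Λ.zero_of_par (fun T lo hi h => ?_) hK f
  obtain ⟨c, hc⟩ := par_formula Λ Z T h
  have h' : ∀ i, lo i ≤ hi i := fun i => (h i).le
  have hd : ∀ i, 0 < hi i - lo i := fun i => sub_pos.2 (h i)
  suffices c = 0 by ext f; rw [hc, this, zero_mul]; rfl
  let hi2 : Fin (m+1) → ℝ := fun i => lo i + 2 * (hi i - lo i)
  have hlo2 : ∀ i, lo i ≤ hi2 i := fun i => by simp only [hi2]; linarith [hd i]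
  let a : Rn (m+1) := T.symm lo
  have e1 : Par T lo hi2 = (fun y => y + -a) '' ((2:ℝ) • Par T lo hi) := by
    ext x
    constructor
    · intro hx
      refine ⟨x + a, ⟨(2:ℝ)⁻¹ • (x + a), fun i => ?_, by simp⟩, by simp⟩
      have := hx i
      simp only [hi2] at this
      simp only [a, map_smul, map_add, ContinuousLinearEquiv.apply_symm_apply, Pi.smul_apply, Pi.add_apply, smul_eq_mul]
      constructor <;> linarith
    · rintro ⟨_, ⟨y, hy, rfl⟩, rfl⟩
      intro i
      have := hy i
      simp only [hi2, a, map_smul, map_add, map_neg, ContinuousLinearEquiv.apply_symm_apply, Pi.smul_apply, Pi.add_apply, Pi.neg_apply, smul_eq_mul]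
      constructor <;> linarith
  have hQ := Par.body T h'
  set b := bmp T lo hi with hb
  have e2 : Λ.L (Par T lo hi) b = Λ.L (Par T lo hi2) b := by
    refine Λ.loc _ _ {x | ∀ i, |T x i - lo i| < hi i - lo i} hQ (Par.body T hlo2) ?_ ?_ _ ?_
    · rw [Set.ofPred_forall]
      refine isOpen_iInter_of_finite fun i => ?_
      have : Continuous fun x => T x i := (continuous_apply i).comp T.continuous
      exact isOpen_lt (by fun_prop) continuous_const
    · ext x
      simp only [Par, Set.mem_inter_iff, Set.mem_ofPred_eq, hi2]
      constructor
      · exact fun hx => ⟨fun i => ⟨(hx.1 i).1, by linarith [hx.1 i, hd i]⟩, hx.2⟩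
      · exact fun hx => ⟨fun i => ⟨(hx.1 i).1, by linarith [abs_lt.1 (hx.2 i)]⟩, hx.2⟩
    · intro x hx
      simp only [Set.mem_ofPred_eq, not_forall, not_lt] at hx
      obtain ⟨i, hi'⟩ := hx
      simp only [hb, bmp, ContinuousMap.coe_mk]
      refine Finset.prod_eq_zero (Finset.mem_univ i) (max_eq_left ?_)
      rw [sub_nonpos, one_le_div (hd i)]
      exact hi'
  rw [e1, Λ.trans _ (hQ.smul 2), hh 2 (by norm_num) _ hQ, hc, hc] at e2
  have v1 : vsum T lo hi b = sgnB (fun _ : Fin (m+1) => false) := by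
    apply vsum_single
    · simp [hb, bmp, vert]
    · rintro ε ⟨i, hi'⟩
      simp only [hb, bmp, ContinuousMap.coe_mk]
      refine Finset.prod_eq_zero (Finset.mem_univ i) (max_eq_left ?_)
      simp [vert, hi', abs_of_pos (hd i), div_self (hd i).ne']
  have v2 : vsum T lo hi ((b.comp (shiftC (-a))).comp (scaleC 2)) = sgnB (fun _ : Fin (m+1) => false) := by
    apply vsum_single
    · simp only [hb, bmp, vert, shiftC, scaleC, ContinuousMap.comp_apply, ContinuousMap.coe_mk, a]
      refine Finset.prod_eq_one fun i _ => ?_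
      simp [show 2 * lo i + -lo i - lo i = 0 by ring]
    · rintro ε ⟨i, hi'⟩
      simp only [hb, bmp, ContinuousMap.coe_mk, shiftC, scaleC, ContinuousMap.comp_apply]
      refine Finset.prod_eq_zero (Finset.mem_univ i) (max_eq_left ?_)
      rw [sub_nonpos, one_le_div (hd i)]
      simp only [vert, a, map_add, map_smul, map_neg, ContinuousLinearEquiv.apply_symm_apply, Pi.add_apply, Pi.smul_apply, Pi.neg_apply, hi', if_true, smul_eq_mul]
      rw [le_abs]; left; linarith [hd i]
  rw [v1, v2] at e2
  have hs : ((sgnB (fun _ : Fin (m+1) => false) : ℝ) : ℂ) ≠ 0 := by exact_mod_cast sgnB_ne _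
  have h2 : ((2:ℝ):ℂ) ^ k ≠ 1 := by
    have : (1:ℝ) < 2 ^ k := one_lt_pow₀ (by norm_num) hk.ne'
    intro hcon
    have : (2:ℝ)^k = 1 := by exact_mod_cast hcon
    linarith
  by_contra hc0
  apply h2
  have h3 : c * (sgnB (fun _ : Fin (m+1) => false) : ℝ) ≠ 0 := mul_ne_zero hc0 hs
  exact mul_right_cancel₀ h3 (by rw [← e2, one_mul])

/-- negation -/
def negC : C(Rn n, Rn n) := ⟨fun x => -x, by fun_prop⟩

theorem HC.neg {Ki : ℕ → Set (Rn n)} {K} (h : HC Ki K) : HC (fun i => - Ki i) (-K) := by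
  have := h.image (f := fun x : Rn n => -x) (LipschitzWith.id.neg : LipschitzWith 1 (fun x : Rn n => -x))
  simpa only [Set.image_neg_eq_neg] using this

/-- reflected functional -/
noncomputable def Loc.negL (Λ : Loc n) : Loc n where
  L K := 
    { toFun := fun f => Λ.L (-K) (f.comp negC)
      map_add' := fun f g => by rw [← map_add]; rfl
      map_smul' := fun c f => by rw [RingHom.id_apply, ← map_smul]; rfl }
  bound := by
    intro K hK
    obtain ⟨C, h0, h⟩ := Λ.bound _ hK.neg
    refine ⟨C, h0, fun f M hM => h _ _ fun x hx => ?_⟩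
    exact hM _ hx
  loc := by
    intro K K' U hK hK' hU h f hf
    refine Λ.loc _ _ (-U) hK.neg hK'.neg hU.neg ?_ _ ?_
    · rw [← Set.inter_neg, ← Set.inter_neg, h]
    · intro x hx
      exact hf _ hx
  trans := by
    intro K hK a f
    have : -((fun y => y + a) '' K) = (fun y => y + -a) '' (-K) := by
      ext x
      constructor
      · rintro ⟨y, hy, hyx⟩
        exact ⟨-y, by simpa using hy, by simp only at hyx; rw [← neg_neg x, ← hyx]; simp [add_comm]⟩
      · rintro ⟨y, hy, rfl⟩
        exact ⟨-y, hy, by simp [add_comm]⟩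
    change Λ.L _ _ = Λ.L _ _
    rw [this, Λ.trans _ hK.neg]
    congr 1
    ext x
    simp [negC, shiftC, add_comm]
  cont := fun Ki K hKi hK h f => Λ.cont _ _ (fun i => (hKi i).neg) hK.neg h.neg _
  simple := by
    intro K hK h f
    refine Λ.simple _ hK.neg ?_ _
    have : -K = (Homeomorph.neg (Rn n)) '' K := by simp
    rw [this, ← Homeomorph.image_interior, h, Set.image_empty]

theorem Loc.negL_apply (Λ : Loc n) (K f) : Λ.negL.L K f = Λ.L (-K) (f.comp negC) := rfl

/-- linear combination -/
noncomputable def Loc.subc (Λ Λ' : Loc n) (c : ℂ) : Loc n where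
  L K := Λ.L K - c • Λ'.L K
  bound := by
    intro K hK
    obtain ⟨C, h0, h⟩ := Λ.bound _ hK
    obtain ⟨C', h0', h'⟩ := Λ'.bound _ hK
    refine ⟨C + ‖c‖ * C', by positivity, fun f M hM => ?_⟩
    rw [LinearMap.sub_apply, LinearMap.smul_apply, smul_eq_mul]
    refine (norm_sub_le _ _).trans ?_
    rw [add_mul, norm_mul, mul_assoc]
    exact add_le_add (h f M hM) (mul_le_mul_of_nonneg_left (h' f M hM) (norm_nonneg _))
  loc := by
    intro K K' U hK hK' hU h f hf
    rw [LinearMap.sub_apply, LinearMap.smul_apply, LinearMap.sub_apply, LinearMap.smul_apply,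
      Λ.loc K K' U hK hK' hU h f hf, Λ'.loc K K' U hK hK' hU h f hf]
  trans := by
    intro K hK a f
    rw [LinearMap.sub_apply, LinearMap.smul_apply, LinearMap.sub_apply, LinearMap.smul_apply,
      Λ.trans K hK, Λ'.trans K hK]
  cont := fun Ki K hKi hK h f => (Λ.cont Ki K hKi hK h f).sub ((Λ'.cont Ki K hKi hK h f).const_smul c)
  simple := by
    intro K hK h f
    rw [LinearMap.sub_apply, LinearMap.smul_apply, Λ.simple K hK h, Λ'.simple K hK h]; simp

theorem Loc.subc_apply (Λ Λ' : Loc n) (c : ℂ) (K f) : (Λ.subc Λ' c).L K f = Λ.L K f - c * Λ'.L K f := rfl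

theorem Loc.Hom.negL {Λ : Loc n} {k} (h : Λ.Hom k) : Λ.negL.Hom k := by
  intro t ht K hK f
  rw [Loc.negL_apply, Loc.negL_apply, ← Set.smul_set_neg, h t ht _ hK.neg]
  congr 2
  ext x; simp [negC, scaleC]

theorem Loc.Hom.subc {Λ Λ' : Loc n} {k} (h : Λ.Hom k) (h' : Λ'.Hom k) (c) : (Λ.subc Λ' c).Hom k := by
  intro t ht K hK f
  rw [Loc.subc_apply, Loc.subc_apply, h t ht K hK, h' t ht K hK]; ring

theorem Cy.neg (e : CE m) (M : Set (Rn m)) (a b : ℝ) : - Cy e M a b = Cy e (-M) (-b) (-a) := by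
  ext x
  rw [Set.mem_neg, mem_Cy, mem_Cy]
  simp only [map_neg, Prod.fst_neg, Prod.snd_neg, Set.mem_neg]
  constructor
  · exact fun h => ⟨h.1, by linarith, by linarith⟩
  · exact fun h => ⟨h.1, by linarith, by linarith⟩

theorem Loc.parity (k : ℕ) : ∀ (m d : ℕ), m = k + d → ∀ Λ : Loc (m+1), Λ.Hom k → ∀ K, IsConvexBody K → ∀ f,
    Λ.L (-K) (f.comp negC) = (-1) ^ (d + 1) * Λ.L K f := by
  induction k with
  | zero =>
    intro m d hd Λ hh K hK f
    have Z : ∀ (e : CE m) M, IsConvexBody M → ∀ f, Λ.L (Cy e M 0 1) (fw e f 1) = 0 := fun e M hM f => Theta_zero hh e hM f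
    have := (Λ.negL.subc Λ ((-1) ^ (d+1))).zero_of_par (fun T lo hi h => ?_) hK f
    · rw [Loc.subc_apply, Loc.negL_apply, sub_eq_zero] at this; exact this
    have h' : ∀ i, lo i ≤ hi i := fun i => (h i).le
    obtain ⟨c, hc⟩ := par_formula Λ Z T h
    let b : Rn (m+1) := T.symm (fun i => - hi i - lo i)
    have e1 : - Par T lo hi = (fun y => y + b) '' Par T lo hi := by
      ext x
      constructor
      · intro hx
        refine ⟨x - b, fun i => ?_, by simp⟩
        have := hx i
        simp only [map_neg, Pi.neg_apply] at this
        simp only [b, map_sub, ContinuousLinearEquiv.apply_symm_apply, Pi.sub_apply]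
        constructor <;> linarith
      · rintro ⟨y, hy, rfl⟩
        intro i
        have := hy i
        simp only [b, map_neg, map_add, ContinuousLinearEquiv.apply_symm_apply, Pi.add_apply, Pi.neg_apply]
        constructor <;> linarith
    ext f
    rw [Loc.subc_apply, Loc.negL_apply, e1, Λ.trans _ (Par.body T h'), hc, hc, LinearMap.zero_apply, sub_eq_zero]
    have e2 : vsum T lo hi ((f.comp negC).comp (shiftC b)) = (-1)^(d+1) * vsum T lo hi f := by
      have hmd : m = d := by omega
      subst hmd
      rw [vsum, vsum, Finset.mul_sum]
      refine Fintype.sum_equiv (Equiv.piCongrRight fun _ => Equiv.boolNot) _ _ fun ε => ?_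
      have s1 : sgnB ε = (-1) ^ (m+1) * sgnB (Equiv.piCongrRight (fun _ => Equiv.boolNot) ε) := by
        have : ((-1:ℝ)) ^ (m+1) = ∏ i : Fin (m+1), (-1) := by simp
        rw [this, sgnB, sgnB, ← Finset.prod_mul_distrib]
        refine Finset.prod_congr rfl fun i _ => ?_
        simp only [Equiv.piCongrRight_apply, Pi.map_apply, Equiv.boolNot_apply]
        cases ε i <;> simp
      rw [s1, mul_assoc]
      congr 2
      simp only [ContinuousMap.comp_apply, negC, shiftC, ContinuousMap.coe_mk]
      congr 1
      apply T.injective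
      ext i
      simp only [vert, b, map_neg, map_add, ContinuousLinearEquiv.apply_symm_apply, Pi.neg_apply, Pi.add_apply,
        Equiv.piCongrRight_apply, Pi.map_apply, Equiv.boolNot_apply]
      cases ε i <;> simp
    rw [e2]; push_cast; ring
  | succ k ih =>
    intro m d hd Λ hh K hK f
    obtain ⟨m, rfl⟩ : ∃ m', m = m' + 1 := ⟨k + d, by omega⟩
    have := (Λ.negL.subc Λ ((-1) ^ (d+1))).hom_pos_zero ?_ (Nat.succ_pos k) (hh.negL.subc hh _) hK f
    · rw [Loc.subc_apply, Loc.negL_apply, sub_eq_zero] at this; exact this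
    intro e M hM f
    have h1 := ih m d (by omega) (Theta Λ e 1) (Theta_hom_one hh e) M hM f
    rw [Theta_apply, Theta_apply] at h1
    rw [Loc.subc_apply, Loc.negL_apply, ← h1, sub_eq_zero, Cy.neg]
    have h2 := Cy.L_shift Λ e hM.neg (a := -1) (b := -0) 1 (by norm_num) (f.comp negC) 1
    have h3 : (1 : C(ℝ,ℝ)).comp (shR 1) = 1 := by ext; simp
    rw [h3] at h2
    rw [show (-1:ℝ) + 1 = 0 by norm_num, show (-0:ℝ) + 1 = 1 by norm_num] at h2
    rw [h2]
    congr 1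
    ext x
    simp [fw_apply, negC]

end parity

end

section

open MeasureTheory Metric Filter Topology
open scoped Pointwise

section vanish
variable {n m : ℕ}

/-- simple even homogeneous valuations -/
structure Val {n : ℕ} (ψ : Set (Rn n) → ℂ) (k : ℕ) : Prop where
  cont : ∀ (Ki : ℕ → Set (Rn n)) K, (∀ i, IsConvexBody (Ki i)) → IsConvexBody K → HC Ki K →
    Tendsto (fun i => ψ (Ki i)) atTop (𝓝 (ψ K))
  trans : ∀ K, IsConvexBody K → ∀ a, ψ ((fun y => y + a) '' K) = ψ K
  simple : ∀ K, IsConvexBody K → interior K = ∅ → ψ K = 0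
  cut : ∀ K, IsConvexBody K → ∀ φ : Du n, φ ≠ 0 → ∀ b : ℝ, (K ∩ {x | φ x ≤ b}).Nonempty →
    (K ∩ {x | b ≤ φ x}).Nonempty → ψ K = ψ (K ∩ {x | φ x ≤ b}) + ψ (K ∩ {x | b ≤ φ x})
  even : ∀ K, IsConvexBody K → ψ (-K) = ψ K
  hom : ∀ t : ℝ, 0 < t → ∀ K, IsConvexBody K → ψ (t • K) = (t:ℂ) ^ k * ψ K

theorem interior_singleton_zero : interior ({0} : Set (Rn (m+1))) = ∅ := by
  let φ : Rn (m+1) →L[ℝ] ℝ := EuclideanSpace.proj (0 : Fin (m+1))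
  refine interior_empty_of_subset_hyperplane (φ := φ) (c := 0) ?_ ?_
  · intro h
    have := congrArg (fun g : Rn (m+1) →L[ℝ] ℝ => g (EuclideanSpace.single 0 1)) h
    simp [φ] at this
  · rintro x rfl; simp

theorem Loc.one_zero {Λ : Loc (m+1)} (hh : Λ.Hom 0) {K} (hK : IsConvexBody K) : Λ.L K 1 = 0 := by
  let u : ℕ → ℝ := fun i => 1 / ((i : ℝ) + 1)
  have hu0 : ∀ i, 0 < u i := fun i => by simp only [u]; positivity
  have hut : Tendsto u atTop (𝓝 0) := tendsto_one_div_add_atTop_nhds_zero_nat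
  have h1 := Λ.cont _ _ (fun i => hK.smul (u i)) (isConvexBody_singleton 0) (HC.smul_zero hK hut) 1
  rw [Λ.simple {0} (isConvexBody_singleton 0) interior_singleton_zero] at h1
  have h2 : ∀ i, Λ.L (u i • K) 1 = Λ.L K 1 := by
    intro i
    rw [hh _ (hu0 i) K hK, pow_zero, one_mul]; rfl
  simp only [h2] at h1
  exact tendsto_nhds_unique tendsto_const_nhds h1

/-- linear functional as a continuous map -/
noncomputable def linC (φ : Du n) : C(Rn n, ℝ) := ⟨φ, φ.continuous_of_finiteDimensional⟩

theorem Loc.val_lin {Λ : Loc 3} (hh : Λ.Hom 0) (φ : Du 3) : Val (fun K => Λ.L K (linC φ)) 1 where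
  cont Ki K hKi hK h := Λ.cont Ki K hKi hK h _
  trans K hK a := by
    rw [Λ.trans K hK]
    have : (linC φ).comp (shiftC a) = linC φ + φ a • 1 := by ext x; simp [linC, shiftC]
    rw [this, map_add, map_smul, Loc.one_zero hh hK, smul_zero, add_zero]
  simple K hK h := Λ.simple K hK h _
  cut K hK φ' h0 b h1 h2 := Λ.cut hK h0 b h1 h2 _
  even K hK := by
    have h1 := Loc.parity 0 2 2 rfl Λ hh K hK (linC (-φ))
    have h2 : (linC (-φ)).comp negC = linC φ := by ext x; simp [linC, negC]
    have h3 : linC (-φ) = (-1 : ℝ) • linC φ := by ext x; simp [linC]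
    rw [h2, h3, map_smul] at h1
    rw [h1]; simp; ring
  hom t ht K hK := by
    rw [hh t ht K hK]
    have : (linC φ).comp (scaleC t) = t • linC φ := by ext x; simp [linC, scaleC]
    rw [this, map_smul, Complex.real_smul]; ring

theorem Loc.vanish3 (KS : ∀ ψ : Set (Rn 3) → ℂ, Val ψ 1 → ∀ K, IsConvexBody K → ψ K = 0)
    {Λ : Loc 3} (hh : Λ.Hom 0) {K} (hK : IsConvexBody K) (f) : Λ.L K f = 0 := by
  have Z : ∀ (e : CE 2) M, IsConvexBody M → ∀ f, Λ.L (Cy e M 0 1) (fw e f 1) = 0 := fun e M hM f => Theta_zero hh e hM f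
  refine Λ.zero_of_par (fun T lo hi h => ?_) hK f
  obtain ⟨c, hc⟩ := par_formula Λ Z T h
  have h' : ∀ i, lo i ≤ hi i := fun i => (h i).le
  have hd : ∀ i, 0 < hi i - lo i := fun i => sub_pos.2 (h i)
  suffices c = 0 by ext f; rw [hc, this, zero_mul]; rfl
  let φ : Du 3 := ∑ i, (hi i - lo i)⁻¹ • (LinearMap.proj (R := ℝ) (φ := fun _ : Fin 3 => ℝ) i).comp (T : Rn 3 →L[ℝ] (Fin 3 → ℝ)).toLinearMap
  have hφ : ∀ x, φ x = ∑ i, (hi i - lo i)⁻¹ * T x i := by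
    intro x
    simp [φ, LinearMap.sum_apply]
  let d : ℝ := ∑ i, (hi i - lo i)⁻¹ * lo i
  have hφd : ∀ x, φ x - d = ∑ i, (T x i - lo i) / (hi i - lo i) := by
    intro x
    rw [hφ]; simp only [d]
    rw [← Finset.sum_sub_distrib]
    exact Finset.sum_congr rfl fun i _ => by rw [← mul_sub, mul_comm, div_eq_mul_inv]
  let r : C(Rn 3, ℝ) := ⟨fun x => max 0 (1 - (φ x - d)), by
    have := φ.continuous_of_finiteDimensional
    fun_prop⟩
  have hv : vsum T lo hi r = sgnB (fun _ : Fin 3 => false) := by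
    apply vsum_single
    · simp [r, hφd, vert]
    · rintro ε ⟨i, hε⟩
      simp only [r, ContinuousMap.coe_mk]
      apply max_eq_left
      rw [hφd, sub_nonpos]
      have h1 : ∀ j ∈ Finset.univ, 0 ≤ (T (vert T lo hi ε) j - lo j) / (hi j - lo j) := by
        intro j _
        refine div_nonneg ?_ (hd j).le
        linarith [(vert_mem T h' ε j).1]
      refine le_trans ?_ (Finset.single_le_sum h1 (Finset.mem_univ i))
      simp [vert, hε, div_self (hd i).ne']
  have hQ := Par.body T h'
  have hl : T.symm lo ∈ Par T lo hi ∩ {x | φ x - d ≤ 1} := by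
    refine ⟨fun i => by simp [h' i], ?_⟩
    change φ (T.symm lo) - d ≤ 1
    rw [hφd]; simp
  have hD : IsConvexBody (Par T lo hi ∩ {x | φ x - d ≤ 1}) := by
    refine hQ.inter ?_ ?_ ⟨_, hl⟩
    · have := φ.continuous_of_finiteDimensional
      exact isClosed_le (by fun_prop) continuous_const
    · have : {x | φ x - d ≤ 1} = {x | φ x ≤ 1 + d} := by ext x; simp only [Set.mem_ofPred_eq]; rw [sub_le_iff_le_add]
      rw [this]
      exact convex_halfSpace_le φ.isLinear _
  have e1 : Λ.L (Par T lo hi) r = Λ.L (Par T lo hi ∩ {x | φ x - d ≤ 1}) r := by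
    refine Λ.loc _ _ {x | φ x - d < 1} hQ hD ?_ ?_ _ ?_
    · have := φ.continuous_of_finiteDimensional
      exact isOpen_lt (by fun_prop) continuous_const
    · ext x
      simp only [Set.mem_inter_iff, Set.mem_ofPred_eq]
      constructor
      · exact fun hx => ⟨⟨hx.1, hx.2.le⟩, hx.2⟩
      · exact fun hx => ⟨hx.1.1, hx.2⟩
    · intro x hx
      simp only [Set.mem_ofPred_eq, not_lt] at hx
      simp only [r, ContinuousMap.coe_mk]
      exact max_eq_left (by linarith)
  have e2 : Λ.L (Par T lo hi ∩ {x | φ x - d ≤ 1}) r =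
      Λ.L (Par T lo hi ∩ {x | φ x - d ≤ 1}) ((1 + d) • 1 - linC φ) := by
    refine Λ.congr hD fun x hx => ?_
    have : φ x - d ≤ 1 := hx.2
    simp only [r, ContinuousMap.coe_mk, linC]
    rw [max_eq_right (by linarith)]
    simp; ring
  rw [map_sub, map_smul, Loc.one_zero hh hD, KS _ (Loc.val_lin hh φ) _ hD, smul_zero, sub_zero] at e2
  rw [hc, hv, e2] at e1
  have hs : ((sgnB (fun _ : Fin 3 => false) : ℝ) : ℂ) ≠ 0 := by exact_mod_cast sgnB_ne _
  exact (mul_eq_zero.1 e1).resolve_right hs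

theorem Loc.vanish (KS : ∀ ψ : Set (Rn 3) → ℂ, Val ψ 1 → ∀ K, IsConvexBody K → ψ K = 0) (k : ℕ) : ∀ (m : ℕ), k + 2 ≤ m → ∀ Λ : Loc (m+1), Λ.Hom k → ∀ K, IsConvexBody K → ∀ f, Λ.L K f = 0 := by
  induction k with
  | zero =>
    intro m hm
    induction m, hm using Nat.le_induction with
    | base => intro Λ hh K hK f; exact Loc.vanish3 KS hh hK f
    | succ m hm ih =>
      intro Λ hh K hK f
      have Z : ∀ (e : CE (m+1)) M, IsConvexBody M → ∀ f, Λ.L (Cy e M 0 1) (fw e f 1) = 0 := fun e M hM f => Theta_zero hh e hM f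
      refine Λ.zero_of_par (fun T lo hi h => ?_) hK f
      have h' : ∀ i, lo i ≤ hi i := fun i => (h i).le
      obtain ⟨C, hC0, hC⟩ := Λ.bound _ (Par.body T h')
      ext f
      refine pf_dense T (Par.body T h').2.1 (Λ.L (Par T lo hi)) C hC ?_ f
      intro P
      rw [par_step Λ Z T h' 0 P, ih _ (Theta_hom_pow hh _) _ (Par.body _ fun i => h' _), mul_zero]
  | succ k ih =>
    intro m hm Λ hh K hK f
    obtain ⟨m, rfl⟩ : ∃ m', m = m' + 1 := ⟨m - 1, by omega⟩
    refine Λ.hom_pos_zero ?_ (Nat.succ_pos k) hh hK f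
    intro e M hM f
    exact ih m (by omega) (Theta Λ e 1) (Theta_hom_one hh e) M hM f

end vanish

end

section

open MeasureTheory Metric Filter Topology
open scoped Pointwise

section vcyl
variable {n m k : ℕ}

theorem Cy.trans_eq (e : CE m) (M : Set (Rn m)) (a : Rn m) (b c : ℝ) :
    Cy e ((fun y => y + a) '' M) b c = (fun y => y + e (a, 0)) '' Cy e M b c := by
  ext x
  constructor
  · rintro ⟨⟨y, t⟩, ⟨⟨z, hz, hzy⟩, ht⟩, rfl⟩
    refine ⟨e (z, t), ⟨(z, t), ⟨hz, ht⟩, rfl⟩, ?_⟩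
    simp only at hzy
    simp only [← map_add, Prod.mk_add_mk, add_zero, hzy]
  · rintro ⟨_, ⟨⟨z, t⟩, ⟨hz, ht⟩, rfl⟩, rfl⟩
    refine ⟨(z + a, t), ⟨⟨z, hz, rfl⟩, ht⟩, ?_⟩
    simp only [← map_add, Prod.mk_add_mk, add_zero]

theorem Cy.smul_eq (e : CE m) (M : Set (Rn m)) {t : ℝ} (ht : 0 < t) : Cy e (t • M) 0 1 = t • Cy e M 0 t⁻¹ := by
  ext x
  constructor
  · rintro ⟨⟨y, s⟩, ⟨⟨z, hz, rfl⟩, hs⟩, rfl⟩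
    refine ⟨e (z, t⁻¹ * s), ⟨(z, t⁻¹ * s), ⟨hz, by have := hs.1; simp only at this ⊢; positivity, ?_⟩, rfl⟩, ?_⟩
    · exact mul_le_of_le_one_right (by positivity) hs.2
    · simp only [← map_smul, Prod.smul_mk, smul_eq_mul]
      rw [mul_inv_cancel_left₀ ht.ne']
  · rintro ⟨_, ⟨⟨z, s⟩, ⟨hz, hs⟩, rfl⟩, rfl⟩
    refine ⟨(t • z, t * s), ⟨⟨z, hz, rfl⟩, by have := hs.1; simp only at this ⊢; positivity, ?_⟩, ?_⟩
    · calc t * s ≤ t * t⁻¹ := by gcongr; exact hs.2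
        _ = 1 := mul_inv_cancel₀ ht.ne'
    · simp only [← map_smul, Prod.smul_mk, smul_eq_mul]

theorem Cy.empty_interior (e : CE m) {M : Set (Rn m)} (h : interior M = ∅) (a b : ℝ) : interior (Cy e M a b) = ∅ := by
  have : Cy e M a b = e.toHomeomorph '' (M ×ˢ Set.Icc a b) := rfl
  rw [this, ← Homeomorph.image_interior, interior_prod_eq, h]
  simp

theorem Val.cyl_add {ψ : Set (Rn (m+1)) → ℂ} (hψ : Val ψ k) (e : CE m) {M : Set (Rn m)} (hM : IsConvexBody M) {a b c : ℝ} (h1 : a ≤ b)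
    (h2 : b ≤ c) : ψ (Cy e M a c) = ψ (Cy e M a b) + ψ (Cy e M b c) := by
  let φ : Du (m+1) := (LinearMap.snd ℝ (Rn m) ℝ).comp (e.symm : Rn (m+1) →L[ℝ] _).toLinearMap
  have hφ : ∀ x, φ x = (e.symm x).2 := fun x => rfl
  have hφ0 : φ ≠ 0 := by
    intro h
    have : φ (e (0, 1)) = 0 := by rw [h]; rfl
    rw [hφ] at this; simp at this
  obtain ⟨y, hy⟩ := hM.1
  have hmem : ∀ c', a ≤ b → b ≤ c' → e (y, b) ∈ Cy e M a c' := fun c' h1 h2 =>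
    ⟨(y, b), ⟨hy, h1, h2⟩, rfl⟩
  have e1 : Cy e M a c ∩ {x | φ x ≤ b} = Cy e M a b := by
    ext x
    simp only [Set.mem_inter_iff, mem_Cy, hφ, Set.mem_ofPred_eq]
    constructor
    · exact fun h => ⟨h.1.1, h.1.2.1, h.2⟩
    · exact fun h => ⟨⟨h.1, h.2.1, h.2.2.trans h2⟩, h.2.2⟩
  have e2 : Cy e M a c ∩ {x | b ≤ φ x} = Cy e M b c := by
    ext x
    simp only [Set.mem_inter_iff, mem_Cy, hφ, Set.mem_ofPred_eq]
    constructor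
    · exact fun h => ⟨h.1.1, h.2, h.1.2.2⟩
    · exact fun h => ⟨⟨h.1, h1.trans h.2.1, h.2.2⟩, h.2.1⟩
  have := hψ.cut _ (Cy.body e hM (h1.trans h2)) φ hφ0 b ⟨e (y, b), hmem c h1 h2, by simp [hφ]⟩
    ⟨e (y, b), hmem c h1 h2, by simp [hφ]⟩
  rwa [e1, e2] at this

theorem Val.cyl_shift {ψ : Set (Rn (m+1)) → ℂ} (hψ : Val ψ k) (e : CE m) {M : Set (Rn m)} (hM : IsConvexBody M) {a b : ℝ} (h1 : a ≤ b)
    (s : ℝ) : ψ (Cy e M (a + s) (b + s)) = ψ (Cy e M a b) := by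
  rw [← Cy.shift, hψ.trans _ (Cy.body e hM h1)]

theorem Val.cyl_lin {ψ : Set (Rn (m+1)) → ℂ} (hψ : Val ψ k) (e : CE m) {M : Set (Rn m)} (hM : IsConvexBody M) {s : ℝ}
    (hs : 0 ≤ s) : ψ (Cy e M 0 s) = s * ψ (Cy e M 0 1) := by
  refine addlin (g := fun s => ψ (Cy e M 0 s)) (fun s t hs ht => ?_) ?_ s hs
  · rw [hψ.cyl_add e hM hs (by linarith : s ≤ s + t), ← hψ.cyl_shift e hM ht s, zero_add, add_comm t s]
  · intro u hu s hs h
    exact hψ.cont _ _ (fun i => Cy.body e hM (hu i)) (Cy.body e hM hs)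
      (Cy.HC e (_root_.HC.const M) hu hs tendsto_const_nhds h)

theorem Val.slice {ψ : Set (Rn (m+1)) → ℂ} (hψ : Val ψ (k+1)) (e : CE m) : Val (fun M => ψ (Cy e M 0 1)) k where
  cont Ki K hKi hK h := hψ.cont _ _ (fun i => Cy.body e (hKi i) zero_le_one) (Cy.body e hK zero_le_one)
      (Cy.HC e h (fun _ => zero_le_one) zero_le_one tendsto_const_nhds tendsto_const_nhds)
  trans K hK a := by rw [Cy.trans_eq, hψ.trans _ (Cy.body e hK zero_le_one)]
  simple K hK h := hψ.simple _ (Cy.body e hK zero_le_one) (Cy.empty_interior e h 0 1)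
  cut K hK φ hφ b h1 h2 := by
    let φ' : Du (m+1) := φ.comp ((LinearMap.fst ℝ (Rn m) ℝ).comp (e.symm : Rn (m+1) →L[ℝ] _).toLinearMap)
    have hφ' : ∀ x, φ' x = φ (e.symm x).1 := fun x => rfl
    have hφ0 : φ' ≠ 0 := by
      intro h
      apply hφ
      ext y
      have : φ' (e (y, 0)) = 0 := by rw [h]; rfl
      rw [hφ'] at this; simpa using this
    have e1 : Cy e (K ∩ {x | φ x ≤ b}) 0 1 = Cy e K 0 1 ∩ {x | φ' x ≤ b} := by
      ext x
      simp only [Set.mem_inter_iff, mem_Cy, hφ', Set.mem_ofPred_eq]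
      tauto
    have e2 : Cy e (K ∩ {x | b ≤ φ x}) 0 1 = Cy e K 0 1 ∩ {x | b ≤ φ' x} := by
      ext x
      simp only [Set.mem_inter_iff, mem_Cy, hφ', Set.mem_ofPred_eq]
      tauto
    rw [e1, e2]
    refine hψ.cut _ (Cy.body e hK zero_le_one) φ' hφ0 b ?_ ?_
    · rw [← e1]; exact (h1.prod (Set.nonempty_Icc.2 zero_le_one)).image _
    · rw [← e2]; exact (h2.prod (Set.nonempty_Icc.2 zero_le_one)).image _
  even K hK := by
    have h1 := hψ.cyl_shift e hK.neg (a := -1) (b := 0) (by norm_num) 1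
    rw [show (-1:ℝ) + 1 = 0 by norm_num, zero_add] at h1
    rw [h1]
    have h2 := Cy.neg e K 0 1
    rw [neg_zero] at h2
    rw [← h2, hψ.even _ (Cy.body e hK zero_le_one)]
  hom t ht K hK := by
    rw [Cy.smul_eq e K ht, hψ.hom t ht _ (Cy.body e hK (by positivity)), hψ.cyl_lin e hK (by positivity)]
    have : (t:ℂ) ≠ 0 := by exact_mod_cast ht.ne'
    push_cast; field_simp; ring

/-- extension by zero to the empty set -/
noncomputable def ex0 (ψ : Set (Rn n) → ℂ) (K : Set (Rn n)) : ℂ := by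
  classical exact if K.Nonempty then ψ K else 0

theorem ex0_ne (ψ : Set (Rn n) → ℂ) {K : Set (Rn n)} (h : K.Nonempty) : ex0 ψ K = ψ K := if_pos h
theorem ex0_empty (ψ : Set (Rn n) → ℂ) : ex0 ψ ∅ = 0 := if_neg Set.not_nonempty_empty

theorem Val.cut0 {ψ : Set (Rn n) → ℂ} (hψ : Val ψ k) {K : Set (Rn n)} (hc : IsCompact K) (hv : Convex ℝ K) (φ : Du n) (b : ℝ)
    (h : φ ≠ 0 ∨ b ≠ 0) : ex0 ψ K = ex0 ψ (K ∩ {x | φ x ≤ b}) + ex0 ψ (K ∩ {x | b ≤ φ x}) := by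
  by_cases h1 : (K ∩ {x | φ x ≤ b}).Nonempty
  · by_cases h2 : (K ∩ {x | b ≤ φ x}).Nonempty
    · have hK : K.Nonempty := h1.mono Set.inter_subset_left
      rw [ex0_ne _ h1, ex0_ne _ h2, ex0_ne _ hK]
      refine hψ.cut K ⟨hK, hc, hv⟩ φ ?_ b h1 h2
      rintro rfl
      obtain ⟨x, _, hx⟩ := h1
      obtain ⟨y, _, hy⟩ := h2
      simp only [Set.mem_ofPred_eq, LinearMap.zero_apply] at hx hy
      rcases h with h | h
      · exact h rfl
      · exact h (le_antisymm hy hx)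
    · rw [Set.not_nonempty_iff_eq_empty] at h2
      rw [h2, ex0_empty, add_zero]
      congr 1
      refine (Set.inter_eq_left.2 fun x hx => ?_).symm
      by_contra hcon
      simp only [Set.mem_ofPred_eq, not_le] at hcon
      exact Set.eq_empty_iff_forall_notMem.1 h2 x ⟨hx, hcon.le⟩
  · rw [Set.not_nonempty_iff_eq_empty] at h1
    rw [h1, ex0_empty, zero_add]
    congr 1
    refine (Set.inter_eq_left.2 fun x hx => ?_).symm
    by_contra hcon
    simp only [Set.mem_ofPred_eq, not_le] at hcon
    exact Set.eq_empty_iff_forall_notMem.1 h1 x ⟨hx, hcon.le⟩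

/-- sweep of a set along a segment -/
def sweep (w : Rn n) (P : Set (Rn n)) : Set (Rn n) := (fun p : Rn n × ℝ => p.1 + p.2 • w) '' (P ×ˢ Set.Icc 0 1)

theorem mem_sweep {w : Rn n} {P : Set (Rn n)} {x : Rn n} : x ∈ sweep w P ↔ ∃ s : ℝ, 0 ≤ s ∧ s ≤ 1 ∧ x - s • w ∈ P := by
  constructor
  · rintro ⟨⟨p, s⟩, ⟨hp, hs⟩, rfl⟩
    exact ⟨s, hs.1, hs.2, by simpa using hp⟩
  · rintro ⟨s, h0, h1, hx⟩
    exact ⟨(x - s • w, s), ⟨hx, h0, h1⟩, by simp⟩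

theorem sweep_compact (w : Rn n) {P : Set (Rn n)} (h : IsCompact P) : IsCompact (sweep w P) :=
  (h.prod isCompact_Icc).image (by fun_prop)

theorem sweep_convex (w : Rn n) {P : Set (Rn n)} (h : Convex ℝ P) : Convex ℝ (sweep w P) := by
  have := (h.prod (convex_Icc (0:ℝ) 1)).linear_image
    (LinearMap.coprod LinearMap.id (LinearMap.toSpanSingleton ℝ (Rn n) w))
  exact this

theorem sweep_body (w : Rn n) {P : Set (Rn n)} (h : IsConvexBody P) : IsConvexBody (sweep w P) :=
  ⟨(h.1.prod (Set.nonempty_Icc.2 zero_le_one)).image _, sweep_compact w h.2.1, sweep_convex w h.2.2⟩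

theorem exists_CE (u : Du (m+1)) (w : Rn (m+1)) (h : u w = 1) : ∃ e : CE m, e (0, 1) = w ∧ ∀ x, (e.symm x).2 = u x := by
  have hu : u ≠ 0 := by rintro rfl; simp at h
  have hf : Module.finrank ℝ (LinearMap.ker u) = m := by
    have h1 := LinearMap.finrank_range_add_finrank_ker u
    rw [LinearMap.range_eq_top.2 (LinearMap.surjective hu)] at h1
    simp at h1
    omega
  let g : Rn m ≃ₗ[ℝ] LinearMap.ker u := LinearEquiv.ofFinrankEq _ _ (by rw [hf]; simp)
  have hg : ∀ y, u (g y) = 0 := fun y => (g y).2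
  refine ⟨LinearEquiv.toContinuousLinearEquiv
    { toFun := fun p => (g p.1 : Rn (m+1)) + p.2 • w
      map_add' := fun p q => by simp [add_smul]; abel
      map_smul' := fun c p => by simp [mul_smul]
      invFun := fun x => (g.symm ⟨x - u x • w, by simp [h]⟩, u x)
      left_inv := fun p => by
        have : u ((g p.1 : Rn (m+1)) + p.2 • w) = p.2 := by simp [h, hg]
        simp only [this]
        ext1
        · simp
        · rfl
      right_inv := fun x => by simp }, ?_, fun x => rfl⟩
  simp

theorem Val.sweep_cyl {ψ : Set (Rn (m+1)) → ℂ} (hψ : Val ψ k) (Z : ∀ (e : CE m) M, IsConvexBody M → ψ (Cy e M 0 1) = 0) (w : Rn (m+1))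
    (u : Du (m+1)) (hu : u w = 1) (c : ℝ) {G : Set (Rn (m+1))} (hG : IsConvexBody G) (hGc : ∀ x ∈ G, u x = c) : 
    ψ (sweep w G) = 0 := by
  obtain ⟨e, he1, he2⟩ := exists_CE u w hu
  let pr : Rn (m+1) →L[ℝ] Rn m := (ContinuousLinearMap.fst ℝ (Rn m) ℝ).comp (e.symm : Rn (m+1) →L[ℝ] Rn m × ℝ)
  have hpr : ∀ x, pr x = (e.symm x).1 := fun x => rfl
  have hM : IsConvexBody (pr '' G) := hG.linImage pr
  have h1 : sweep w G = Cy e (pr '' G) (0 + c) (1 + c) := by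
    ext x
    constructor
    · rintro ⟨⟨g, s⟩, ⟨hg, hs⟩, rfl⟩
      rw [mem_Cy]
      refine ⟨⟨g, hg, ?_⟩, ?_⟩
      · simp only [hpr, map_add, map_smul, ← he1]
        simp
      · rw [he2]
        have := hs.1; have := hs.2
        simp only [map_add, map_smul, hu, hGc g hg, smul_eq_mul, mul_one] at *
        constructor <;> linarith
    · rintro ⟨⟨y, s⟩, ⟨⟨g, hg, hgy⟩, hs⟩, rfl⟩
      refine ⟨(g, s - c), ⟨hg, ?_, ?_⟩, ?_⟩
      · have := hs.1; simp only at this ⊢; linarith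
      · have := hs.2; simp only at this ⊢; linarith
      · simp only at hgy ⊢
        apply e.symm.injective
        rw [← he1]
        simp only [map_add, map_smul, ContinuousLinearEquiv.symm_apply_apply]
        ext1
        · simp [← hgy, hpr]
        · simp [he2, hGc g hg]
  rw [h1, hψ.cyl_shift e hM zero_le_one, Z e _ hM]

theorem Val.sweep_fin {ψ : Set (Rn (m+1)) → ℂ} (hψ : Val ψ k) (Z : ∀ (e : CE m) M, IsConvexBody M → ψ (Cy e M 0 1) = 0) (w : Rn (m+1))
    (r : ℕ) : ∀ S : Finset (Du (m+1) × ℝ), S.card = r + 1 → (∀ q ∈ S, q.1 w = 1) → ∀ P : Set (Rn (m+1)), IsCompact P → Convex ℝ P →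
      (∀ x ∈ P, ∀ q ∈ S, q.1 x ≤ q.2) → 
      (∀ x, ∀ s : ℝ, 0 ≤ s → x - s • w ∈ P → (∀ q ∈ S, q.1 x ≤ q.2) → x ∈ P) → ex0 ψ (sweep w P) = ex0 ψ P := by
  classical
  induction r with
  | zero =>
    intro S hS hw P hc hv hP H
    obtain ⟨⟨u, c⟩, rfl⟩ := Finset.card_eq_one.1 hS
    simp only [Finset.mem_singleton, forall_eq] at hw hP H
    have hu0 : u ≠ 0 := by rintro rfl; simp at hw
    rcases P.eq_empty_or_nonempty with rfl | hne
    · simp [sweep]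
    have e1 : sweep w P ∩ {x | u x ≤ c} = P := by
      ext x
      constructor
      · rintro ⟨hx, hxc⟩
        obtain ⟨s, h0, h1, hx⟩ := mem_sweep.1 hx
        exact H x s h0 hx hxc
      · intro hx
        exact ⟨mem_sweep.2 ⟨0, le_rfl, zero_le_one, by simpa using hx⟩, hP x hx⟩
    have e2 : sweep w P ∩ {x | c ≤ u x} = sweep w (P ∩ {x | u x = c}) := by
      ext x
      rw [Set.mem_inter_iff, mem_sweep, mem_sweep]
      constructor
      · rintro ⟨⟨s, h0, h1, hx⟩, hxc⟩
        simp only [Set.mem_ofPred_eq] at hxc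
        have hux : u (x - s • w) ≤ c := hP _ hx
        simp only [map_sub, map_smul, hw, smul_eq_mul, mul_one] at hux
        refine ⟨u x - c, by linarith, by linarith, H _ (s - (u x - c)) (by linarith) ?_ ?_, ?_⟩
        · convert hx using 1; module
        · simp [hw]
        · simp [hw]
      · rintro ⟨s, h0, h1, hx, hxc⟩
        simp only [Set.mem_ofPred_eq, map_sub, map_smul, hw, smul_eq_mul, mul_one] at hxc
        refine ⟨⟨s, h0, h1, hx⟩, ?_⟩
        simp only [Set.mem_ofPred_eq]; linarith
    rw [hψ.cut0 (sweep_compact w hc) (sweep_convex w hv) u c (Or.inl hu0), e1, e2]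
    have hG : IsConvexBody (P ∩ {x | u x = c}) := by
      refine ⟨?_, hc.inter_right ?_, hv.inter ?_⟩
      · obtain ⟨p, hp⟩ := hne
        refine ⟨p + (c - u p) • w, H _ (c - u p) (by linarith [hP p hp]) (by simpa using hp) ?_, ?_⟩
        · simp [hw]
        · simp [hw]
      · exact isClosed_eq u.continuous_of_finiteDimensional continuous_const
      · exact convex_hyperplane u.isLinear c
    rw [ex0_ne ψ (sweep_body w hG).1, hψ.sweep_cyl Z w u hw c hG (fun x hx => hx.2), add_zero]
  | succ r ih =>
    intro S hS hw P hc hv hP H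
    obtain ⟨q1, hq1, q2, hq2, hne⟩ := Finset.one_lt_card.1 (by omega : 1 < S.card)
    let φ : Du (m+1) := q1.1 - q2.1
    let b : ℝ := q1.2 - q2.2
    have hφw : ∀ (x : Rn (m+1)) (s : ℝ), φ (x - s • w) = φ x := by intro x s; simp [φ, hw q1 hq1, hw q2 hq2]
    have h0 : φ ≠ 0 ∨ b ≠ 0 := by
      by_contra hcon
      push Not at hcon
      exact hne (Prod.ext (sub_eq_zero.1 hcon.1) (sub_eq_zero.1 hcon.2))
    have hφc := φ.continuous_of_finiteDimensional
    have e1 : sweep w P ∩ {x | φ x ≤ b} = sweep w (P ∩ {x | φ x ≤ b}) := by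
      ext x
      simp only [Set.mem_inter_iff, mem_sweep, Set.mem_ofPred_eq, hφw]
      constructor
      · rintro ⟨⟨s, h0, h1, hx⟩, h2⟩; exact ⟨s, h0, h1, hx, h2⟩
      · rintro ⟨s, h0, h1, hx, h2⟩; exact ⟨⟨s, h0, h1, hx⟩, h2⟩
    have e2 : sweep w P ∩ {x | b ≤ φ x} = sweep w (P ∩ {x | b ≤ φ x}) := by
      ext x
      simp only [Set.mem_inter_iff, mem_sweep, Set.mem_ofPred_eq, hφw]
      constructor
      · rintro ⟨⟨s, h0, h1, hx⟩, h2⟩; exact ⟨s, h0, h1, hx, h2⟩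
      · rintro ⟨s, h0, h1, hx, h2⟩; exact ⟨⟨s, h0, h1, hx⟩, h2⟩
    rw [hψ.cut0 (sweep_compact w hc) (sweep_convex w hv) φ b h0, hψ.cut0 hc hv φ b h0, e1, e2]
    congr 1
    · refine ih (S.erase q1) (by rw [Finset.card_erase_of_mem hq1]; omega) (fun q hq => hw q (Finset.mem_of_mem_erase hq)) _
        (hc.inter_right (isClosed_le hφc continuous_const)) (hv.inter (convex_halfSpace_le φ.isLinear b))
        (fun x hx q hq => hP x hx.1 q (Finset.mem_of_mem_erase hq)) ?_
      intro x s hs hx hq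
      have hxb : φ x ≤ b := by have : φ (x - s • w) ≤ b := hx.2; rwa [hφw] at this
      refine ⟨H x s hs hx.1 fun q hqS => ?_, hxb⟩
      by_cases hqq : q = q1
      · subst hqq
        have := hq q2 (Finset.mem_erase.2 ⟨hne.symm, hq2⟩)
        simp only [φ, b, LinearMap.sub_apply] at hxb
        linarith
      · exact hq q (Finset.mem_erase.2 ⟨hqq, hqS⟩)
    · refine ih (S.erase q2) (by rw [Finset.card_erase_of_mem hq2]; omega) (fun q hq => hw q (Finset.mem_of_mem_erase hq)) _
        (hc.inter_right (isClosed_le continuous_const hφc)) (hv.inter (convex_halfSpace_ge φ.isLinear b))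
        (fun x hx q hq => hP x hx.1 q (Finset.mem_of_mem_erase hq)) ?_
      intro x s hs hx hq
      have hxb : b ≤ φ x := by have : b ≤ φ (x - s • w) := hx.2; rwa [hφw] at this
      refine ⟨H x s hs hx.1 fun q hqS => ?_, hxb⟩
      by_cases hqq : q = q2
      · subst hqq
        have := hq q1 (Finset.mem_erase.2 ⟨hne, hq1⟩)
        simp only [φ, b, LinearMap.sub_apply] at hxb
        linarith
      · exact hq q (Finset.mem_erase.2 ⟨hqq, hqS⟩)

end vcyl

end

section

open MeasureTheory Metric Filter Topology
open scoped Pointwise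

section sw
variable {n m k : ℕ}

theorem HC.lin2 {E F G : Type*} [NormedAddCommGroup E] [NormedSpace ℝ E] [NormedAddCommGroup F] [NormedSpace ℝ F]
    [NormedAddCommGroup G] [NormedSpace ℝ G] (f : (E × F) →L[ℝ] G) {Ki : ℕ → Set E} {K : Set E} {Mi : ℕ → Set F} {M : Set F}
    (h : HC Ki K) (h' : HC Mi M) : HC (fun i => f '' (Ki i ×ˢ Mi i)) (f '' (K ×ˢ M)) :=
  (h.prod h').image f.lipschitz

theorem HC.sweep {Ki : ℕ → Set (Rn n)} {K : Set (Rn n)} (h : HC Ki K) (w : Rn n) :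
    HC (fun i => sweep w (Ki i)) (sweep w K) :=
  HC.lin2 (ContinuousLinearMap.fst ℝ (Rn n) ℝ + (ContinuousLinearMap.snd ℝ (Rn n) ℝ).smulRight w) h (HC.const (Set.Icc 0 1))

theorem exists_polh {K : Set (Rn n)} (hK : IsConvexBody K) : ∃ S : ℕ → Set (Du n × ℝ), (∀ i, (S i).Finite) ∧
    (∀ i, K ⊆ Polh (S i)) ∧ (∀ i, IsConvexBody (Polh (S i))) ∧ HC (fun i => Polh (S i)) K := by
  have := fun i : ℕ => exists_generic_approx hK (ε := 1 / ((i:ℝ)+1)) (by positivity) Set.finite_empty generic_empty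
  choose S h1 h2 h3 h4 h5 h6 using this
  exact ⟨S, h1, h4, h5, HC.of_approx h4 h6⟩

theorem Val.sweep {ψ : Set (Rn (m+1)) → ℂ} (hψ : Val ψ k) (Z : ∀ (e : CE m) M, IsConvexBody M → ψ (Cy e M 0 1) = 0)
    (w : Rn (m+1)) {K} (hK : IsConvexBody K) : ψ (sweep w K) = ψ K := by
  classical
  by_cases hw : w = 0
  · subst hw
    congr 1
    ext x
    rw [mem_sweep]
    constructor
    · rintro ⟨s, _, _, h⟩; simpa using h
    · intro h; exact ⟨0, le_rfl, zero_le_one, by simpa using h⟩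
  obtain ⟨S, hf, hKS, hb, hc⟩ := exists_polh hK
  have key : ∀ i, ψ (_root_.sweep w (Polh (S i))) = ψ (Polh (S i)) := by
    intro i
    set P := Polh (S i) with hP
    let T : Finset (Du (m+1) × ℝ) := ((hf i).toFinset.filter fun q => 0 < q.1 w).image
      fun q => ((q.1 w)⁻¹ • q.1, (q.1 w)⁻¹ * q.2)
    have hT1 : ∀ q ∈ T, q.1 w = 1 := by
      intro q hq
      obtain ⟨p, hp, rfl⟩ := Finset.mem_image.1 hq
      have := (Finset.mem_filter.1 hp).2
      simp [this.ne']
    have hT2 : ∀ x, (∀ q ∈ T, q.1 x ≤ q.2) ↔ ∀ p ∈ S i, 0 < p.1 w → p.1 x ≤ p.2 := by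
      intro x
      constructor
      · intro h p hp hpw
        have := h _ (Finset.mem_image.2 ⟨p, Finset.mem_filter.2 ⟨(hf i).mem_toFinset.2 hp, hpw⟩, rfl⟩)
        simp only [LinearMap.smul_apply, smul_eq_mul] at this
        exact le_of_mul_le_mul_left this (inv_pos.2 hpw)
      · intro h q hq
        obtain ⟨p, hp, rfl⟩ := Finset.mem_image.1 hq
        obtain ⟨h1, h2⟩ := Finset.mem_filter.1 hp
        simp only [LinearMap.smul_apply, smul_eq_mul]
        exact mul_le_mul_of_nonneg_left (h p ((hf i).mem_toFinset.1 h1) h2) (inv_pos.2 h2).le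
    have H : ∀ x, ∀ s : ℝ, 0 ≤ s → x - s • w ∈ P → (∀ q ∈ T, q.1 x ≤ q.2) → x ∈ P := by
      intro x s hs hx hq p hp
      by_cases hpw : 0 < p.1 w
      · exact (hT2 x).1 hq p hp hpw
      · have := hx p hp
        simp only [map_sub, map_smul, smul_eq_mul] at this
        nlinarith
    have hTne : T.Nonempty := by
      by_contra hem
      rw [Finset.not_nonempty_iff_eq_empty] at hem
      obtain ⟨p, hp⟩ := (hb i).1
      obtain ⟨R, hR⟩ := (hb i).isCompact.isBounded.exists_norm_le
      have hall : ∀ s : ℝ, 0 ≤ s → p + s • w ∈ P := fun s hs => H _ s hs (by simpa using hp) (by simp [hem])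
      have hwn : 0 < ‖w‖ := norm_pos_iff.2 hw
      have hR0 : 0 ≤ R := (norm_nonneg _).trans (hR p hp)
      have h1 := hR _ (hall ((2 * R + 1) / ‖w‖) (by positivity))
      have h2 := hR p hp
      have h3 : ‖((2 * R + 1) / ‖w‖) • w‖ = 2 * R + 1 := by
        rw [norm_smul, Real.norm_of_nonneg (by positivity)]; field_simp
      have h4 : ‖((2 * R + 1) / ‖w‖) • w‖ ≤ ‖p + ((2 * R + 1) / ‖w‖) • w‖ + ‖p‖ := by
        have := norm_sub_le (p + ((2 * R + 1) / ‖w‖) • w) p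
        simpa using this
      linarith
    have := hψ.sweep_fin Z w (T.card - 1) T (by have := hTne.card_pos; omega) hT1 P (hb i).isCompact (hb i).convex
      (fun x hx => (hT2 x).2 fun p hp _ => hx p hp) H
    rwa [ex0_ne ψ (sweep_body w (hb i)).1, ex0_ne ψ (hb i).1] at this
  have h1 := hψ.cont _ _ (fun i => sweep_body w (hb i)) (sweep_body w hK) (hc.sweep w)
  simp only [key] at h1
  exact tendsto_nhds_unique h1 (hψ.cont _ _ hb hK hc)

end sw

end

section

open MeasureTheory Metric Filter Topology
open scoped Pointwise

section supp
variable {n m k : ℕ}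

/-- sublinear functions -/
structure Subl (h : Rn n → ℝ) : Prop where
  hom : ∀ c : ℝ, 0 < c → ∀ u, h (c • u) = c * h u
  add : ∀ u v, h (u + v) ≤ h u + h v

theorem Subl.zero {h : Rn n → ℝ} (H : Subl h) : h 0 = 0 := by
  have := H.hom 2 (by norm_num) 0
  rw [smul_zero] at this; linarith

theorem Subl.hom0 {h : Rn n → ℝ} (H : Subl h) {c : ℝ} (hc : 0 ≤ c) (u) : h (c • u) = c * h u := by
  rcases hc.eq_or_lt with rfl | hc
  · simp [H.zero]
  · exact H.hom c hc u

theorem Subl.neg_le {h : Rn n → ℝ} (H : Subl h) (u) : -h u ≤ h (-u) := by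
  have := H.add u (-u)
  rw [add_neg_cancel, H.zero] at this; linarith

theorem Subl.plus {h g : Rn n → ℝ} (H : Subl h) (G : Subl g) : Subl (h + g) where
  hom c hc u := by simp only [Pi.add_apply, H.hom c hc, G.hom c hc]; ring
  add u v := by simp only [Pi.add_apply]; linarith [H.add u v, G.add u v]

theorem Subl.smul {h : Rn n → ℝ} (H : Subl h) {t : ℝ} (ht : 0 ≤ t) : Subl (t • h) where
  hom c hc u := by simp only [Pi.smul_apply, H.hom c hc, smul_eq_mul]; ring
  add u v := by simp only [Pi.smul_apply, smul_eq_mul, ← mul_add]; exact mul_le_mul_of_nonneg_left (H.add u v) ht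

theorem Subl.continuous {h : Rn n → ℝ} (H : Subl h) : Continuous h := by
  have : ConvexOn ℝ Set.univ h := by
    refine ⟨convex_univ, fun x _ y _ a b ha hb _ => ?_⟩
    have := H.add (a • x) (b • y)
    rwa [H.hom0 ha, H.hom0 hb] at this
  exact this.locallyLipschitz.continuous

theorem Subl.bound {h : Rn n → ℝ} (H : Subl h) : ∃ C, 0 ≤ C ∧ ∀ u, |h u| ≤ C * ‖u‖ := by
  obtain ⟨C, hC⟩ := (isCompact_closedBall (0 : Rn n) 1).exists_bound_of_continuousOn H.continuous.continuousOn
  refine ⟨C, (norm_nonneg _).trans (hC 0 (by simp)), fun u => ?_⟩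
  by_cases hu : u = 0
  · simp [hu, H.zero]
  have hn : 0 < ‖u‖ := norm_pos_iff.2 hu
  have h1 := hC (‖u‖⁻¹ • u) (by simp [norm_smul, hn.ne'])
  have h2 : h u = ‖u‖ * h (‖u‖⁻¹ • u) := by
    rw [← H.hom _ hn, smul_smul, mul_inv_cancel₀ hn.ne', one_smul]
  rw [h2, abs_mul, abs_norm, mul_comm]
  exact mul_le_mul_of_nonneg_right h1 hn.le

/-- the body with support function h -/
def bd (h : Rn n → ℝ) : Set (Rn n) := {x | ∀ u, inner ℝ x u ≤ h u}

theorem bd_attain {h : Rn n → ℝ} (H : Subl h) (u : Rn n) : ∃ x ∈ bd h, inner ℝ x u = h u := by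
  have hz : ∀ c : ℝ, c • u = 0 → c • h u = 0 := by
    intro c hc
    rcases smul_eq_zero.1 hc with rfl | rfl
    · simp
    · simp [H.zero]
  obtain ⟨g, hg1, hg2⟩ := exists_extension_of_le_sublinear (LinearPMap.mkSpanSingleton' u (h u) hz) h H.hom H.add (by
    rintro ⟨x, hx⟩
    obtain ⟨c, rfl⟩ := Submodule.mem_span_singleton.1 hx
    rw [LinearPMap.mkSpanSingleton'_apply]
    rcases le_or_gt 0 c with hc | hc
    · rw [H.hom0 hc]; simp
    · have := H.neg_le ((-c) • u)
      rw [H.hom0 (by linarith), ← neg_smul, neg_neg] at this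
      simpa using this)
  have hg3 : g u = h u := by
    have := hg1 ⟨u, Submodule.mem_span_singleton_self u⟩
    simp only at this
    rw [this]
    have h2 := LinearPMap.mkSpanSingleton'_apply (σ := RingHom.id ℝ) u (h u) hz 1 (by simpa using Submodule.mem_span_singleton_self u)
    simpa using h2
  let x := (InnerProductSpace.toDual ℝ (Rn n)).symm (LinearMap.toContinuousLinearMap g)
  have hx : ∀ v, inner ℝ x v = g v := fun v => by simp [x]
  exact ⟨x, fun v => by rw [hx]; exact hg2 v, by rw [hx, hg3]⟩

theorem bd_body {h : Rn n → ℝ} (H : Subl h) : IsConvexBody (bd h) := by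
  obtain ⟨x, hx, -⟩ := bd_attain H 0
  refine ⟨⟨x, hx⟩, ?_, ?_⟩
  · obtain ⟨C, hC0, hC⟩ := H.bound
    refine (isCompact_closedBall (0 : Rn n) C).of_isClosed_subset ?_ ?_
    · have : bd h = ⋂ u, {x | inner ℝ x u ≤ h u} := by ext; simp [bd]
      rw [this]
      exact isClosed_iInter fun u => isClosed_le (by fun_prop) continuous_const
    · intro x hx
      have h1 := hx x
      rw [real_inner_self_eq_norm_sq] at h1
      have h2 := (le_abs_self _).trans (hC x)
      rw [mem_closedBall_zero_iff]
      by_contra hcon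
      push Not at hcon
      nlinarith [norm_nonneg x]
  · intro x hx y hy a b ha hb hab u
    rw [inner_add_left, inner_smul_left, inner_smul_left]
    have h1 := hx u; have h2 := hy u
    simp only [conj_trivial]
    calc _ ≤ a * h u + b * h u := by gcongr
      _ = h u := by rw [← add_mul, hab, one_mul]

theorem bd_eq {h : Rn n → ℝ} {K : Set (Rn n)} (hK : IsConvexBody K) (h1 : ∀ x ∈ K, ∀ u, inner ℝ x u ≤ h u)
    (h2 : ∀ u, ∃ x ∈ K, inner ℝ x u = h u) : bd h = K := by
  apply Set.Subset.antisymm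
  · intro x hx
    by_contra hxK
    obtain ⟨f, c, hf1, hf2⟩ := geometric_hahn_banach_closed_point hK.convex hK.isClosed hxK
    let u := (InnerProductSpace.toDual ℝ (Rn n)).symm f
    have hu : ∀ v, inner ℝ v u = f v := fun v => by rw [real_inner_comm]; simp [u]
    obtain ⟨y, hy, hyu⟩ := h2 u
    have h3 := hx u
    rw [← hyu, hu, hu] at h3
    linarith [hf1 y hy]
  · exact h1

theorem bd_add {h g : Rn n → ℝ} (H : Subl h) (G : Subl g) : bd (h + g) = bd h + bd g := by
  refine bd_eq ((bd_body H).add (bd_body G)) ?_ ?_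
  · rintro _ ⟨x, hx, y, hy, rfl⟩ u
    simp only [inner_add_left, Pi.add_apply]
    exact add_le_add (hx u) (hy u)
  · intro u
    obtain ⟨x, hx, hxu⟩ := bd_attain H u
    obtain ⟨y, hy, hyu⟩ := bd_attain G u
    exact ⟨x + y, ⟨x, hx, y, hy, rfl⟩, by simp [inner_add_left, hxu, hyu]⟩

theorem bd_smul {h : Rn n → ℝ} (H : Subl h) {t : ℝ} (ht : 0 ≤ t) : bd (t • h) = t • bd h := by
  refine bd_eq ((bd_body H).smul t) ?_ ?_
  · rintro _ ⟨x, hx, rfl⟩ u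
    simp only [inner_smul_left, conj_trivial, Pi.smul_apply, smul_eq_mul]
    exact mul_le_mul_of_nonneg_left (hx u) ht
  · intro u
    obtain ⟨x, hx, hxu⟩ := bd_attain H u
    exact ⟨t • x, ⟨x, hx, rfl⟩, by simp [inner_smul_left, hxu]⟩

theorem subl_norm : Subl (fun u : Rn n => ‖u‖) where
  hom c hc u := by rw [norm_smul, Real.norm_of_nonneg hc.le]
  add u v := norm_add_le u v

theorem bd_norm : bd (fun u : Rn n => ‖u‖) = closedBall 0 1 := by
  ext x
  rw [mem_closedBall_zero_iff]
  constructor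
  · intro hx
    have := hx x
    rw [real_inner_self_eq_norm_sq] at this
    by_contra hcon
    push Not at hcon
    nlinarith
  · intro hx u
    calc inner ℝ x u ≤ ‖x‖ * ‖u‖ := real_inner_le_norm x u
      _ ≤ 1 * ‖u‖ := by gcongr
      _ = ‖u‖ := one_mul _

theorem bd_near {h g : Rn n → ℝ} (G : Subl g) {δ : ℝ} (hδ : 0 ≤ δ) (hh : ∀ u, h u ≤ g u + δ * ‖u‖)
    {x} (hx : x ∈ bd h) : ∃ y ∈ bd g, dist x y ≤ δ := by
  have h1 : x ∈ bd (g + δ • fun u : Rn n => ‖u‖) := fun u => (hx u).trans (hh u)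
  rw [bd_add G (subl_norm.smul hδ), bd_smul subl_norm hδ, bd_norm] at h1
  obtain ⟨y, hy, _, ⟨z, hz, rfl⟩, rfl⟩ := h1
  refine ⟨y, hy, ?_⟩
  rw [mem_closedBall_zero_iff] at hz
  simp only [dist_eq_norm, add_sub_cancel_left, norm_smul, Real.norm_of_nonneg hδ]
  nlinarith

theorem Subl.le_of_ball {h g : Rn n → ℝ} (H : Subl h) (G : Subl g) {δ : ℝ}
    (hh : ∀ u, ‖u‖ ≤ 1 → |h u - g u| ≤ δ) (u) : |h u - g u| ≤ δ * ‖u‖ := by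
  by_cases hu : u = 0
  · simp [hu, H.zero, G.zero]
  have hn : 0 < ‖u‖ := norm_pos_iff.2 hu
  have h1 := hh (‖u‖⁻¹ • u) (by simp [norm_smul, hn.ne'])
  rw [H.hom _ (inv_pos.2 hn), G.hom _ (inv_pos.2 hn), ← mul_sub, abs_mul, abs_of_pos (inv_pos.2 hn), inv_mul_le_iff₀ hn] at h1
  rwa [mul_comm]

theorem HC.bd {h : ℕ → Rn n → ℝ} {g : Rn n → ℝ} (H : ∀ i, Subl (h i)) (G : Subl g) {δ : ℕ → ℝ}
    (hδ : Tendsto δ atTop (𝓝 0)) (hh : ∀ i u, ‖u‖ ≤ 1 → |h i u - g u| ≤ δ i) : HC (fun i => bd (h i)) (bd g) := by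
  have h0 : ∀ i, 0 ≤ δ i := fun i => (abs_nonneg _).trans (hh i 0 (by simp))
  refine HC.of_dist hδ fun i => ⟨fun x hx => bd_near G (h0 i) (fun u => ?_) hx, fun x hx => bd_near (H i) (h0 i) (fun u => ?_) hx⟩
  · have := abs_le.1 ((H i).le_of_ball G (hh i) u); linarith
  · have := abs_le.1 ((H i).le_of_ball G (hh i) u); linarith

/-- support function -/
noncomputable def hs (K : Set (Rn n)) (u : Rn n) : ℝ := sSup ((fun x => inner ℝ x u) '' K)

theorem hs_attain {K : Set (Rn n)} (hK : IsConvexBody K) (u) : ∃ x ∈ K, inner ℝ x u = hs K u := by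
  have := (hK.isCompact.image (f := fun x : Rn n => inner ℝ x u) (by fun_prop)).sSup_mem (hK.1.image _)
  obtain ⟨x, hx, hxu⟩ := this
  exact ⟨x, hx, hxu⟩

theorem le_hs {K : Set (Rn n)} (hK : IsConvexBody K) {x} (hx : x ∈ K) (u) : inner ℝ x u ≤ hs K u :=
  le_csSup (hK.isCompact.image (f := fun x : Rn n => inner ℝ x u) (by fun_prop)).bddAbove ⟨x, hx, rfl⟩

theorem hs_subl {K : Set (Rn n)} (hK : IsConvexBody K) : Subl (hs K) where
  hom c hc u := by
    apply le_antisymm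
    · obtain ⟨x, hx, hxu⟩ := hs_attain hK (c • u)
      rw [← hxu, inner_smul_right]
      exact mul_le_mul_of_nonneg_left (le_hs hK hx u) hc.le
    · obtain ⟨x, hx, hxu⟩ := hs_attain hK u
      rw [← hxu, ← inner_smul_right]
      exact le_hs hK hx _
  add u v := by
    obtain ⟨x, hx, hxu⟩ := hs_attain hK (u + v)
    rw [← hxu, inner_add_right]
    exact add_le_add (le_hs hK hx u) (le_hs hK hx v)

theorem bd_hs {K : Set (Rn n)} (hK : IsConvexBody K) : bd (hs K) = K :=
  bd_eq hK (fun _ hx u => le_hs hK hx u) (hs_attain hK)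

theorem hs_neg {K : Set (Rn n)} (hK : IsConvexBody K) (hs' : -K = K) (u) : hs K (-u) = hs K u := by
  have : ∀ u, hs K (-u) ≤ hs K u := by
    intro u
    obtain ⟨x, hx, hxu⟩ := hs_attain hK (-u)
    rw [← hxu, inner_neg_right, ← inner_neg_left]
    exact le_hs hK (by rw [← hs']; simpa using hx) u
  apply le_antisymm (this u)
  simpa using this (-u)

theorem subl_zero : Subl (0 : Rn n → ℝ) := ⟨by simp, by simp⟩

theorem bd_zero : bd (0 : Rn n → ℝ) = {0} :=
  bd_eq (isConvexBody_singleton 0) (by simp) (by simp)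

end supp

section Nul
variable {n m k : ℕ}

/-- null summands -/
def Nul (ψ : Set (Rn n) → ℂ) (h : Rn n → ℝ) : Prop := Subl h ∧ ∀ g, Subl g → ψ (bd (g + h)) = ψ (bd g)

variable {ψ : Set (Rn n) → ℂ}

theorem Nul.zero : Nul ψ 0 := ⟨subl_zero, by simp⟩

theorem Nul.plus {h h' : Rn n → ℝ} (H : Nul ψ h) (H' : Nul ψ h') : Nul ψ (h + h') :=
  ⟨H.1.plus H'.1, fun g hg => by rw [← add_assoc, H'.2 _ (hg.plus H.1), H.2 g hg]⟩

theorem Nul.cancel {h h' : Rn n → ℝ} (H : Subl h) (H' : Nul ψ h') (H2 : Nul ψ (h + h')) : Nul ψ h :=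
  ⟨H, fun g hg => by rw [← H'.2 _ (hg.plus H), add_assoc, H2.2 g hg]⟩

theorem Nul.smul (hψ : Val ψ k) {h : Rn n → ℝ} (H : Nul ψ h) {t : ℝ} (ht : 0 ≤ t) : Nul ψ (t • h) := by
  rcases ht.eq_or_lt with rfl | ht
  · rw [zero_smul]; exact Nul.zero
  refine ⟨H.1.smul ht.le, fun g hg => ?_⟩
  have hg' := hg.smul (inv_pos.2 ht).le
  have e : g = t • (t⁻¹ • g) := by rw [smul_smul, mul_inv_cancel₀ ht.ne', one_smul]
  rw [e, ← smul_add, bd_smul (hg'.plus H.1) ht.le, bd_smul hg' ht.le, hψ.hom t ht _ (bd_body (hg'.plus H.1)), hψ.hom t ht _ (bd_body hg'),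
    H.2 _ hg']

theorem Nul.lim (hψ : Val ψ k) {h : ℕ → Rn n → ℝ} {h0 : Rn n → ℝ} (H : ∀ i, Nul ψ (h i)) (H0 : Subl h0) {δ : ℕ → ℝ}
    (hδ : Tendsto δ atTop (𝓝 0)) (hh : ∀ i u, ‖u‖ ≤ 1 → |h i u - h0 u| ≤ δ i) : Nul ψ h0 := by
  refine ⟨H0, fun g hg => ?_⟩
  have h1 := hψ.cont _ _ (fun i => bd_body (hg.plus (H i).1)) (bd_body (hg.plus H0))
    (HC.bd (fun i => hg.plus (H i).1) (hg.plus H0) hδ (fun i u hu => by simpa using hh i u hu))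
  simp only [fun i => (H i).2 g hg] at h1
  exact tendsto_nhds_unique h1 tendsto_const_nhds

theorem Nul.abs {ψ : Set (Rn (m+1)) → ℂ} (hψ : Val ψ k) (Z : ∀ (e : CE m) M, IsConvexBody M → ψ (Cy e M 0 1) = 0)
    (w : Rn (m+1)) : Nul ψ (fun u => |inner ℝ u w|) := by
  have hS : Subl (fun u : Rn (m+1) => |inner ℝ u w|) := by
    refine ⟨fun c hc u => ?_, fun u v => ?_⟩
    · rw [inner_smul_left]; simp [abs_mul, abs_of_pos hc]
    · rw [inner_add_left]; exact abs_add_le _ _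
  refine ⟨hS, fun g hg => ?_⟩
  have hb := bd_body hg
  have e1 : bd (g + fun u : Rn (m+1) => |inner ℝ u w|) = (fun y => y + (-w)) '' sweep ((2:ℝ) • w) (bd g) := by
    refine bd_eq ((sweep_body _ hb).translate _) ?_ ?_
    · rintro _ ⟨y, hy, rfl⟩ u
      obtain ⟨s, h0, h1, hy⟩ := mem_sweep.1 hy
      have h2 := hy u
      simp only [inner_add_left, inner_sub_left, inner_smul_left, conj_trivial, inner_neg_left, Pi.add_apply] at h2 ⊢
      rw [real_inner_comm w u]
      have h3 : (2 * s - 1) * inner ℝ w u ≤ |inner ℝ w u| := by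
        calc _ ≤ |(2 * s - 1) * inner ℝ w u| := le_abs_self _
          _ = |2 * s - 1| * |inner ℝ w u| := abs_mul _ _
          _ ≤ 1 * |inner ℝ w u| := by
            gcongr
            rw [abs_le]; constructor <;> linarith
          _ = _ := one_mul _
      linarith
    · intro u
      obtain ⟨x, hx, hxu⟩ := bd_attain hg u
      rcases le_total 0 (inner ℝ w u) with h | h
      · refine ⟨_, ⟨x + (2:ℝ) • w, mem_sweep.2 ⟨1, zero_le_one, le_rfl, by simpa using hx⟩, rfl⟩, ?_⟩
        simp only [inner_add_left, inner_smul_left, conj_trivial, inner_neg_left, Pi.add_apply, hxu]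
        rw [real_inner_comm w u, abs_of_nonneg h]; ring
      · refine ⟨_, ⟨x, mem_sweep.2 ⟨0, le_rfl, zero_le_one, by simpa using hx⟩, rfl⟩, ?_⟩
        simp only [inner_add_left, inner_neg_left, Pi.add_apply, hxu]
        rw [real_inner_comm w u, abs_of_nonpos h]
  rw [e1, hψ.trans _ (sweep_body _ hb), hψ.sweep Z _ hb]

end Nul

end

section

open MeasureTheory Metric Filter Topology
open scoped Pointwise

section int
variable {n m k : ℕ}

/-- restrictions of null summands to the ball -/
def NulC (ψ : Set (Rn n) → ℂ) : Set C(closedBall (0 : Rn n) 1, ℝ) := {F | ∃ h, Nul ψ h ∧ ∀ x, F x = h x}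

theorem NulC.convex {ψ : Set (Rn n) → ℂ} (hψ : Val ψ k) : Convex ℝ (NulC ψ) := by
  rintro F ⟨h, hN, hF⟩ G ⟨h', hN', hG⟩ a b ha hb _
  exact ⟨a • h + b • h', (hN.smul hψ ha).plus (hN'.smul hψ hb), fun x => by simp [hF, hG]⟩

theorem Subl.of_lim {h : ℕ → Rn n → ℝ} {h0 : Rn n → ℝ} (H : ∀ i, Subl (h i)) (hl : ∀ u, Tendsto (fun i => h i u) atTop (𝓝 (h0 u))) :
    Subl h0 where
  hom c hc u := by
    have := hl (c • u)
    simp only [fun i => (H i).hom c hc u] at this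
    exact tendsto_nhds_unique this ((hl u).const_mul c)
  add u v := le_of_tendsto_of_tendsto' (hl (u + v)) ((hl u).add (hl v)) (fun i => (H i).add u v)

theorem NulC.closed {ψ : Set (Rn n) → ℂ} (hψ : Val ψ k) : IsClosed (NulC ψ) := by
  apply IsSeqClosed.isClosed
  intro F F0 hF hlim
  choose h hN hFh using hF
  have hp : ∀ u : Rn n, (1 + ‖u‖)⁻¹ • u ∈ closedBall (0 : Rn n) 1 := by
    intro u
    have : 0 < 1 + ‖u‖ := by positivity
    rw [mem_closedBall_zero_iff, norm_smul, Real.norm_of_nonneg (by positivity), inv_mul_le_iff₀ this]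
    linarith
  have hpt : ∀ x, Tendsto (fun i => F i x) atTop (𝓝 (F0 x)) := fun x =>
    ((continuous_eval_const x).tendsto F0).comp hlim
  let h0 : Rn n → ℝ := fun u => (1 + ‖u‖) * F0 ⟨_, hp u⟩
  have hl : ∀ u, Tendsto (fun i => h i u) atTop (𝓝 (h0 u)) := by
    intro u
    have h1 := (hpt ⟨_, hp u⟩).const_mul (1 + ‖u‖)
    have h3 : 0 < 1 + ‖u‖ := by positivity
    have h2 : ∀ i, (1 + ‖u‖) * F i ⟨_, hp u⟩ = h i u := by
      intro i
      rw [hFh, (hN i).1.hom _ (inv_pos.2 h3), mul_inv_cancel_left₀ h3.ne']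
    simp only [h2] at h1
    exact h1
  have hF0 : ∀ x, F0 x = h0 x := by
    intro x
    have h1 := hpt x
    simp only [hFh] at h1
    exact tendsto_nhds_unique h1 (hl x)
  refine ⟨h0, Nul.lim hψ hN (Subl.of_lim (fun i => (hN i).1) hl) (δ := fun i => dist (F i) F0) ?_ ?_, hF0⟩
  · rwa [← tendsto_iff_dist_tendsto_zero]
  · intro i u hu
    have := ContinuousMap.dist_apply_le_dist (f := F i) (g := F0) ⟨u, by simpa using hu⟩
    rwa [hFh, hF0, Real.dist_eq] at this

theorem Nul.integral {ψ : Set (Rn (m+1)) → ℂ} (hψ : Val ψ k) (Z : ∀ (e : CE m) M, IsConvexBody M → ψ (Cy e M 0 1) = 0)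
    {Ω : Type*} [TopologicalSpace Ω] [SecondCountableTopology Ω] [MeasurableSpace Ω] [OpensMeasurableSpace Ω] 
    (μ : Measure Ω) [IsProbabilityMeasure μ] {g : Ω → ℝ} (hg : Continuous g) (hg0 : ∀ ω, 0 ≤ g ω) {w : Ω → Rn (m+1)} (hw : Continuous w)
    (hint : Integrable (fun ω => g ω * ‖w ω‖) μ) : Nul ψ (fun u => ∫ ω, g ω * |inner ℝ u (w ω)| ∂μ) := by
  let G : C(Ω × closedBall (0 : Rn (m+1)) 1, ℝ) := ⟨fun p => g p.1 * |inner ℝ (p.2 : Rn (m+1)) (w p.1)|, by fun_prop⟩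
  let F : Ω → C(closedBall (0 : Rn (m+1)) 1, ℝ) := fun ω => G.curry ω
  have hFa : ∀ ω x, F ω x = g ω * |inner ℝ (x : Rn (m+1)) (w ω)| := fun ω x => rfl
  have hFc : Continuous F := G.curry.continuous
  have hFi : Integrable F μ := by
    refine hint.mono' hFc.aestronglyMeasurable (Eventually.of_forall fun ω => ?_)
    rw [ContinuousMap.norm_le _ (mul_nonneg (hg0 ω) (norm_nonneg _))]
    intro x
    rw [hFa, norm_mul, Real.norm_of_nonneg (hg0 ω), Real.norm_eq_abs, abs_abs]
    refine mul_le_mul_of_nonneg_left ?_ (hg0 ω)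
    have hx : ‖(x : Rn (m+1))‖ ≤ 1 := mem_closedBall_zero_iff.1 x.2
    calc _ ≤ ‖(x : Rn (m+1))‖ * ‖w ω‖ := abs_real_inner_le_norm _ _
      _ ≤ 1 * ‖w ω‖ := by gcongr
      _ = _ := one_mul _
  have hmem := (NulC.convex hψ).integral_mem (NulC.closed hψ) (f := F) (μ := μ) (Eventually.of_forall fun ω =>
    ⟨g ω • fun u => |inner ℝ u (w ω)|, (Nul.abs hψ Z (w ω)).smul hψ (hg0 ω), fun x => hFa ω x⟩) hFi
  obtain ⟨h, hN, hh⟩ := hmem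
  have key : ∀ u : Rn (m+1), ‖u‖ ≤ 1 → h u = ∫ ω, g ω * |inner ℝ u (w ω)| ∂μ := by
    intro u hu
    have h1 := hh ⟨u, by simpa using hu⟩
    rw [← h1]
    have h2 := ContinuousLinearMap.integral_comp_comm (ContinuousMap.evalCLM ℝ (⟨u, by simpa using hu⟩ : closedBall (0 : Rn (m+1)) 1)) hFi
    exact h2.symm
  have : h = (fun u => ∫ ω, g ω * |inner ℝ u (w ω)| ∂μ) := by
    funext u
    have h3 : 0 < 1 + ‖u‖ := by positivity
    have h1 := key ((1 + ‖u‖)⁻¹ • u) (by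
      rw [norm_smul, Real.norm_of_nonneg (by positivity), inv_mul_le_iff₀ h3]; linarith)
    rw [hN.1.hom _ (inv_pos.2 h3)] at h1
    have h2 : ∀ ω, g ω * |inner ℝ ((1 + ‖u‖)⁻¹ • u) (w ω)| = (1 + ‖u‖)⁻¹ * (g ω * |inner ℝ u (w ω)|) := by
      intro ω
      rw [inner_smul_left, abs_mul]
      simp only [conj_trivial, abs_of_pos (inv_pos.2 h3)]; ring
    simp only [h2, integral_const_mul] at h1
    exact mul_left_cancel₀ (inv_pos.2 h3).ne' h1
  rwa [← this]

end int

end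

section

open MeasureTheory Metric Filter Topology
open scoped Pointwise
open ProbabilityTheory

section gauss
variable {n m k : ℕ}

/-- the product Gaussian measure -/
noncomputable def gam (E : Type*) [NormedAddCommGroup E] [InnerProductSpace ℝ E] [FiniteDimensional ℝ E] [MeasurableSpace E] [BorelSpace E] :
    Measure (ℝ × E) := (gaussianReal 0 1).prod (stdGaussian E)

instance gam_prob (E : Type*) [NormedAddCommGroup E] [InnerProductSpace ℝ E] [FiniteDimensional ℝ E] [MeasurableSpace E] [BorelSpace E] :
    IsProbabilityMeasure (gam E) := by unfold gam; infer_instance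

theorem law_charFun {E G : Type*} [NormedAddCommGroup E] [InnerProductSpace ℝ E] [FiniteDimensional ℝ E] [MeasurableSpace E] [BorelSpace E]
    [NormedAddCommGroup G] [InnerProductSpace ℝ G] [FiniteDimensional ℝ G] [MeasurableSpace G] [BorelSpace G]
    (T : E →L[ℝ] G) (a t : G) (T' : E) (hT : ∀ x, inner ℝ (T x) t = inner ℝ x T') :
    charFun ((gam E).map fun p => p.1 • a + T p.2) t = Complex.exp (-(((inner ℝ a t : ℝ) : ℂ) ^ 2 + (‖T'‖ : ℂ) ^ 2) / 2) := by
  have hm : Measurable fun p : ℝ × E => p.1 • a + T p.2 := by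
    apply Measurable.add
    · exact measurable_fst.smul_const a
    · exact T.measurable.comp measurable_snd
  have hc : Continuous fun x : G => Complex.exp ((inner ℝ x t : ℝ) * Complex.I) := by fun_prop
  rw [charFun_apply, integral_map hm.aemeasurable hc.aestronglyMeasurable]
  have h1 : ∀ p : ℝ × E, Complex.exp ((inner ℝ (p.1 • a + T p.2) t : ℝ) * Complex.I) =
      Complex.exp ((inner ℝ p.1 (inner ℝ a t : ℝ) : ℝ) * Complex.I) * Complex.exp ((inner ℝ p.2 T' : ℝ) * Complex.I) := by
    intro p
    rw [← Complex.exp_add, inner_add_left, hT, inner_smul_left]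
    congr 1
    simp only [conj_trivial, RCLike.inner_apply]
    push_cast
    ring
  simp_rw [h1]
  unfold gam
  have := integral_prod_mul (μ := gaussianReal 0 1) (ν := stdGaussian E) (fun y : ℝ => Complex.exp ((inner ℝ y (inner ℝ a t : ℝ) : ℝ) * Complex.I))
    (fun x : E => Complex.exp ((inner ℝ x T' : ℝ) * Complex.I))
  rw [this, ← charFun_apply, ← charFun_apply, charFun_gaussianReal, charFun_stdGaussian, ← Complex.exp_add]
  congr 1
  simp
  ring

/-- first absolute moment of the gaussian -/
noncomputable def gc : ℝ := ∫ y, |y| ∂(gaussianReal 0 1)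

theorem gauss_pow_int (p : ℕ) : Integrable (fun y : ℝ => |y| ^ p) (gaussianReal 0 1) := by
  have h := (IsGaussian.memLp_id (gaussianReal 0 1) p (by simp)).integrable_norm_pow'
  simpa using h

theorem std_pow_int (E : Type*) [NormedAddCommGroup E] [InnerProductSpace ℝ E] [FiniteDimensional ℝ E] [MeasurableSpace E] [BorelSpace E] (p : ℕ) :
    Integrable (fun x : E => ‖x‖ ^ p) (stdGaussian E) := by
  have h := (IsGaussian.memLp_id (stdGaussian E) p (by simp)).integrable_norm_pow'
  simpa using h

theorem std_int (E : Type*) [NormedAddCommGroup E] [InnerProductSpace ℝ E] [FiniteDimensional ℝ E] [MeasurableSpace E] [BorelSpace E] :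
    Integrable (fun x : E => ‖x‖) (stdGaussian E) := by
  simpa using std_pow_int E 1

theorem gauss_tail (R : ℝ) : 0 < gaussianReal 0 1 (Set.Icc R (R+1)) := by
  have : gaussianReal 0 1 (Set.Icc R (R+1)) ≠ 0 := by
    intro h
    have h2 := gaussianReal_absolutelyContinuous' 0 (one_ne_zero : (1:NNReal) ≠ 0) h
    simp at h2
  exact pos_iff_ne_zero.2 this

theorem gc_pos : 0 < gc := by
  unfold gc
  have h1 : Integrable (fun y : ℝ => |y|) (gaussianReal 0 1) := by simpa using gauss_pow_int 1
  rw [integral_pos_iff_support_of_nonneg (fun y => abs_nonneg y) h1]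
  refine (gauss_tail 1).trans_le (measure_mono fun y hy => ?_)
  simp only [Function.mem_support]
  have := hy.1
  have : 0 < |y| := by rw [abs_pos]; linarith
  exact this.ne'

theorem gauss_abs (a : ℝ) {E : Type*} [NormedAddCommGroup E] [InnerProductSpace ℝ E] [FiniteDimensional ℝ E] [MeasurableSpace E] [BorelSpace E]
    (u : E) : ∫ p : ℝ × E, |p.1 * a + inner ℝ u p.2| ∂(gam E) = Real.sqrt (‖u‖ ^ 2 + a ^ 2) * gc := by
  set c := Real.sqrt (‖u‖ ^ 2 + a ^ 2) with hc
  have hc2 : c ^ 2 = ‖u‖ ^ 2 + a ^ 2 := Real.sq_sqrt (by positivity)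
  have hlaw : (gam E).map (fun p => p.1 • a + innerSL ℝ u p.2) = (gaussianReal 0 1).map (fun x => c * x) := by
    have hm : Measurable fun p : ℝ × E => p.1 • a + innerSL ℝ u p.2 := by
      apply Measurable.add
      · exact measurable_fst.smul_const a
      · exact (innerSL ℝ u).measurable.comp measurable_snd
    have : IsProbabilityMeasure ((gam E).map (fun p => p.1 • a + innerSL ℝ u p.2)) := Measure.isProbabilityMeasure_map hm.aemeasurable
    rw [gaussianReal_map_const_mul]
    apply Measure.ext_of_charFun
    funext t
    rw [law_charFun (innerSL ℝ u) a t (t • u) (by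
      intro x; simp [inner_smul_right, real_inner_comm]), charFun_gaussianReal]
    congr 1
    have : (c : ℂ) ^ 2 = (‖u‖ : ℂ) ^ 2 + (a : ℂ) ^ 2 := by exact_mod_cast congrArg (fun x : ℝ => (x : ℂ)) hc2
    simp only [norm_smul, mul_zero, Complex.ofReal_zero, zero_mul, RCLike.inner_apply, conj_trivial, mul_one, NNReal.coe_mk, zero_sub]
    push_cast
    rw [this]
    have h3 : ((|t| : ℝ) : ℂ) ^ 2 = (t : ℂ) ^ 2 := by exact_mod_cast congrArg (fun x : ℝ => (x : ℂ)) (sq_abs t)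
    simp only [Real.norm_eq_abs, mul_pow, h3]
    ring
  have hm : Measurable fun p : ℝ × E => p.1 • a + innerSL ℝ u p.2 := by
    apply Measurable.add
    · exact measurable_fst.smul_const a
    · exact (innerSL ℝ u).measurable.comp measurable_snd
  have h1 : ∫ x, |x| ∂((gam E).map (fun p => p.1 • a + innerSL ℝ u p.2)) = ∫ p : ℝ × E, |p.1 * a + inner ℝ u p.2| ∂(gam E) := by
    rw [integral_map hm.aemeasurable continuous_abs.aestronglyMeasurable]; simp
  rw [← h1, hlaw, integral_map (by fun_prop) continuous_abs.aestronglyMeasurable]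
  have hc0 : |c| = c := abs_of_nonneg (Real.sqrt_nonneg _)
  simp only [abs_mul, integral_const_mul, hc0]
  rfl

/-- space of matrices -/
abbrev Mn (n : ℕ) := EuclideanSpace ℝ (Fin n × Fin n)

/-- antisymmetrized action -/
noncomputable def Sb (n : ℕ) : Mn n →L[ℝ] Rn n →L[ℝ] Rn n :=
  LinearMap.toContinuousBilinearMap (LinearMap.mk₂ ℝ
    (fun (G : Mn n) (u : Rn n) => (WithLp.toLp 2 (fun i => ∑ j, (G (i, j) - G (j, i)) / Real.sqrt 2 * u j) : Rn n))
    (by intro G G' u; ext i; simp only [PiLp.add_apply, ← Finset.sum_add_distrib]; congr 1; funext j; ring)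
    (by intro c G u; ext i; simp only [PiLp.smul_apply, smul_eq_mul, Finset.mul_sum]; congr 1; funext j; ring)
    (by intro G u u'; ext i; simp only [PiLp.add_apply, ← Finset.sum_add_distrib]; congr 1; funext j; ring)
    (by intro c G u; ext i; simp only [PiLp.smul_apply, smul_eq_mul, Finset.mul_sum]; congr 1; funext j; ring))

theorem Sb_apply (G : Mn n) (u : Rn n) (i) : Sb n G u i = ∑ j, (G (i, j) - G (j, i)) / Real.sqrt 2 * u j := rfl

/-- adjoint -/
noncomputable def Sad (u t : Rn n) : Mn n := WithLp.toLp 2 fun p => (t p.1 * u p.2 - t p.2 * u p.1) / Real.sqrt 2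

theorem Sb_inner (G : Mn n) (u t : Rn n) : inner ℝ (Sb n G u) t = inner ℝ G (Sad u t) := by
  have h1 : inner ℝ (Sb n G u) t = ∑ i, ∑ j, (G (i, j) - G (j, i)) / Real.sqrt 2 * u j * t i := by
    rw [PiLp.inner_apply]
    congr 1; funext i
    simp only [RCLike.inner_apply, conj_trivial, Sb_apply, Finset.mul_sum]
    congr 1; funext j; ring
  have h2 : inner ℝ G (Sad u t) = ∑ i, ∑ j, G (i, j) * ((t i * u j - t j * u i) / Real.sqrt 2) := by
    rw [PiLp.inner_apply, Fintype.sum_prod_type]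
    congr 1; funext i; congr 1; funext j
    simp only [RCLike.inner_apply, conj_trivial, Sad]; ring
  rw [h1, h2]
  have h3 : ∑ i, ∑ j, G (j, i) / Real.sqrt 2 * u j * t i = ∑ i, ∑ j, G (i, j) / Real.sqrt 2 * u i * t j := Finset.sum_comm
  have h4 : ∀ i j, (G (i, j) - G (j, i)) / Real.sqrt 2 * u j * t i = G (i, j) / Real.sqrt 2 * u j * t i - G (j, i) / Real.sqrt 2 * u j * t i := by
    intros; ring
  simp only [h4, Finset.sum_sub_distrib]
  rw [h3]
  simp only [← Finset.sum_sub_distrib]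
  congr 1; funext i; congr 1; funext j; ring

theorem Sad_norm (u t : Rn n) : ‖Sad u t‖ ^ 2 = ‖u‖ ^ 2 * ‖t‖ ^ 2 - (inner ℝ u t) ^ 2 := by
  have hs : (Real.sqrt 2) ^ 2 = 2 := Real.sq_sqrt (by norm_num)
  have h1 : ‖Sad u t‖ ^ 2 = ∑ i, ∑ j, (t i * u j - t j * u i) ^ 2 / 2 := by
    rw [EuclideanSpace.norm_sq_eq, Fintype.sum_prod_type]
    congr 1; funext i; congr 1; funext j
    simp only [Sad, Real.norm_eq_abs, sq_abs, div_pow, hs]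
  have h2 : ‖u‖ ^ 2 * ‖t‖ ^ 2 = ∑ i, ∑ j, u i ^ 2 * t j ^ 2 := by
    rw [EuclideanSpace.norm_sq_eq, EuclideanSpace.norm_sq_eq, Finset.sum_mul_sum]
    simp
  have h2' : ‖u‖ ^ 2 * ‖t‖ ^ 2 = ∑ i, ∑ j, u j ^ 2 * t i ^ 2 := by rw [h2, Finset.sum_comm]
  have h3 : (inner ℝ u t) ^ 2 = ∑ i, ∑ j, (u i * t i) * (u j * t j) := by
    rw [sq, PiLp.inner_apply, Finset.sum_mul_sum]
    congr 1; funext i; congr 1; funext j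
    simp only [RCLike.inner_apply, conj_trivial]; ring
  have h4 : ‖u‖ ^ 2 * ‖t‖ ^ 2 = (∑ i, ∑ j, u i ^ 2 * t j ^ 2) / 2 + (∑ i, ∑ j, u j ^ 2 * t i ^ 2) / 2 := by rw [← h2, ← h2']; ring
  rw [h1, h3, h4]
  simp only [Finset.sum_div, ← Finset.sum_add_distrib, ← Finset.sum_sub_distrib]
  congr 1; funext i; congr 1; funext j; ring

theorem Sb_orth (G : Mn n) (u : Rn n) : inner ℝ (Sb n G u) u = 0 := by
  rw [Sb_inner]
  have : Sad u u = 0 := by ext p; simp [Sad, mul_comm]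
  simp [this]

/-- the random linear map -/
noncomputable def Aw (p : ℝ × Mn n) (u : Rn n) : Rn n := p.1 • u + Sb n p.2 u

theorem Aw_cont (u : Rn n) : Continuous fun p : ℝ × Mn n => Aw p u := by
  unfold Aw
  have : Continuous fun p : ℝ × Mn n => Sb n p.2 u := ((Sb n).flip u).continuous.comp continuous_snd
  fun_prop

theorem Aw_law {u : Rn n} (hu : ‖u‖ = 1) : (gam (Mn n)).map (fun p => Aw p u) = stdGaussian (Rn n) := by
  have : IsProbabilityMeasure ((gam (Mn n)).map (fun p => Aw p u)) :=
    Measure.isProbabilityMeasure_map (Aw_cont u).measurable.aemeasurable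
  apply Measure.ext_of_charFun
  funext t
  have := law_charFun ((Sb n).flip u) u t (Sad u t) (fun x => Sb_inner x u t)
  rw [charFun_stdGaussian]
  refine this.trans ?_
  congr 1
  have h2 := Sad_norm u t
  rw [hu] at h2
  have h3 : ((‖Sad u t‖ : ℝ) : ℂ) ^ 2 = (‖t‖ : ℂ) ^ 2 - ((inner ℝ u t : ℝ) : ℂ) ^ 2 := by
    have := congrArg (fun x : ℝ => (x : ℂ)) h2
    push_cast at this
    rw [this]; ring
  rw [h3]; ring

theorem Aw_inner {u : Rn n} (hu : ‖u‖ = 1) (p : ℝ × Mn n) : inner ℝ (Aw p u) u = p.1 := by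
  unfold Aw
  rw [inner_add_left, Sb_orth, inner_smul_left, real_inner_self_eq_norm_sq, hu]; simp

end gauss

end

section

open MeasureTheory Metric Filter Topology
open scoped Pointwise
open ProbabilityTheory

section fk
variable {n m k : ℕ}

/-- admissible kernels -/
def Ker (κ : ℝ → ℝ) : Prop := Continuous κ ∧ ∃ C : ℝ, ∃ p : ℕ, ∀ y, |κ y| ≤ C * (1 + |y| ^ p)

theorem Ker.int {κ : ℝ → ℝ} (h : Ker κ) : Integrable κ (gaussianReal 0 1) := by
  obtain ⟨hc, C, p, hp⟩ := h
  exact (((integrable_const 1).add (gauss_pow_int p)).const_mul C).mono' hc.aestronglyMeasurable (Eventually.of_forall hp)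

theorem Ker.int1 {κ : ℝ → ℝ} (h : Ker κ) : Integrable (fun y => κ y * |y|) (gaussianReal 0 1) := by
  obtain ⟨hc, C, p, hp⟩ := h
  have h1 : Integrable (fun y : ℝ => C * (|y| ^ 1 + |y| ^ (p+1))) (gaussianReal 0 1) := ((gauss_pow_int 1).add (gauss_pow_int (p+1))).const_mul C
  refine h1.mono' (by fun_prop) (Eventually.of_forall fun y => ?_)
  rw [norm_mul, Real.norm_eq_abs, Real.norm_eq_abs, abs_abs]
  calc _ ≤ C * (1 + |y| ^ p) * |y| := mul_le_mul_of_nonneg_right (hp y) (abs_nonneg y)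
    _ = _ := by ring

theorem Ker.mono {κ κ' : ℝ → ℝ} (hc : Continuous κ) (h : Ker κ') (hle : ∀ y, |κ y| ≤ |κ' y|) : Ker κ := by
  obtain ⟨_, C, p, hp⟩ := h
  exact ⟨hc, C, p, fun y => (hle y).trans (hp y)⟩

theorem Ker.smul {κ : ℝ → ℝ} (h : Ker κ) (c : ℝ) : Ker (fun y => c * κ y) := by
  obtain ⟨hc, C, p, hp⟩ := h
  refine ⟨by fun_prop, |c| * C, p, fun y => ?_⟩
  rw [abs_mul, mul_assoc]
  exact mul_le_mul_of_nonneg_left (hp y) (abs_nonneg c)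

theorem Ker.sub {κ κ' : ℝ → ℝ} (h : Ker κ) (h' : Ker κ') : Ker (fun y => κ y - κ' y) := by
  obtain ⟨hc, C, p, hp⟩ := h
  obtain ⟨hc', C', p', hp'⟩ := h'
  refine ⟨by fun_prop, 2 * (|C| + |C'|), p + p', fun y => ?_⟩
  have key : ∀ (a b : ℕ), 1 + |y| ^ a ≤ 2 * (1 + |y| ^ (a + b)) := by
    intro a b
    rcases le_total 1 |y| with h | h
    · have := pow_le_pow_right₀ h (Nat.le_add_right a b); linarith [pow_nonneg (abs_nonneg y) a]
    · have := pow_le_one₀ (abs_nonneg y) h (n := a); linarith [pow_nonneg (abs_nonneg y) (a + b)]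
  have h1 : |κ y| ≤ |C| * (2 * (1 + |y| ^ (p + p'))) := (hp y).trans
    ((mul_le_mul_of_nonneg_right (le_abs_self C) (by positivity)).trans (mul_le_mul_of_nonneg_left (key p p') (abs_nonneg C)))
  have h2 : |κ' y| ≤ |C'| * (2 * (1 + |y| ^ (p + p'))) := by
    rw [add_comm p p']
    exact (hp' y).trans
      ((mul_le_mul_of_nonneg_right (le_abs_self C') (by positivity)).trans (mul_le_mul_of_nonneg_left (key p' p) (abs_nonneg C')))
  calc |κ y - κ' y| ≤ |κ y| + |κ' y| := abs_sub _ _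
    _ ≤ _ := by linarith

/-- the smoothing operator -/
noncomputable def fk (h : Rn n → ℝ) (κ : ℝ → ℝ) (u : Rn n) : ℝ := ∫ p, κ p.1 * h (Aw p u) ∂(gam (Mn n))

theorem Aw_norm (p : ℝ × Mn n) {u : Rn n} (hu : ‖u‖ ≤ 1) : ‖Aw p u‖ ≤ |p.1| + ‖Sb n‖ * ‖p.2‖ := by
  unfold Aw
  refine (norm_add_le _ _).trans (add_le_add ?_ ?_)
  · rw [norm_smul, Real.norm_eq_abs]; exact mul_le_of_le_one_right (abs_nonneg _) hu
  · refine ((Sb n).le_opNorm₂ p.2 u).trans ?_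
    exact mul_le_of_le_one_right (by positivity) hu

theorem fk_dom_int {κ : ℝ → ℝ} (hκ : Ker κ) (a b : ℝ) :
    Integrable (fun p : ℝ × Mn n => |κ p.1| * (a * |p.1| + b * ‖p.2‖)) (gam (Mn n)) ∧
    ∫ p : ℝ × Mn n, |κ p.1| * (a * |p.1| + b * ‖p.2‖) ∂(gam (Mn n)) = a * ∫ y, |κ y| * |y| ∂(gaussianReal 0 1) +
      b * ((∫ y, |κ y| ∂(gaussianReal 0 1)) * ∫ G, ‖G‖ ∂(stdGaussian (Mn n))) := by
  have hκ' : Ker fun y => |κ y| := Ker.mono (by have := hκ.1; fun_prop) hκ (fun y => by simp)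
  have h1 : Integrable (fun p : ℝ × Mn n => a * ((|κ p.1| * |p.1|) * 1)) (gam (Mn n)) :=
    (hκ'.int1.mul_prod (integrable_const (1:ℝ))).const_mul a
  have h2 : Integrable (fun p : ℝ × Mn n => b * (|κ p.1| * ‖p.2‖)) (gam (Mn n)) :=
    (hκ'.int.mul_prod (std_int (Mn n))).const_mul b
  have e : (fun p : ℝ × Mn n => |κ p.1| * (a * |p.1| + b * ‖p.2‖)) = fun p => a * ((|κ p.1| * |p.1|) * 1) + b * (|κ p.1| * ‖p.2‖) := by
    funext p; ring
  rw [e]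
  refine ⟨h1.add h2, ?_⟩
  rw [integral_add h1 h2, integral_const_mul, integral_const_mul]
  unfold gam
  rw [integral_prod_mul (fun y : ℝ => |κ y|) (fun G : Mn n => ‖G‖), integral_prod_mul (fun y : ℝ => |κ y| * |y|) (fun G : Mn n => (1:ℝ))]
  simp

theorem fk_int {h : Rn n → ℝ} (H : Subl h) {κ : ℝ → ℝ} (hκ : Ker κ) (u) : Integrable (fun p => κ p.1 * h (Aw p u)) (gam (Mn n)) := by
  obtain ⟨C, hC0, hC⟩ := H.bound
  have hc : Continuous fun p : ℝ × Mn n => κ p.1 * h (Aw p u) := (hκ.1.comp continuous_fst).mul (H.continuous.comp (Aw_cont u))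
  refine ((fk_dom_int hκ 1 ‖Sb n‖).1.const_mul (C * (1 + ‖u‖))).mono' hc.aestronglyMeasurable (Eventually.of_forall fun p => ?_)
  rw [norm_mul, Real.norm_eq_abs, Real.norm_eq_abs]
  have hn : 0 < 1 + ‖u‖ := by positivity
  have h1 : Aw p u = (1 + ‖u‖) • Aw p ((1 + ‖u‖)⁻¹ • u) := by
    unfold Aw; rw [map_smul, smul_comm p.1, ← smul_add, smul_smul, mul_inv_cancel₀ hn.ne', one_smul]
  have h2 := Aw_norm p (u := (1 + ‖u‖)⁻¹ • u) (by
    rw [norm_smul, Real.norm_of_nonneg (by positivity), inv_mul_le_iff₀ hn]; linarith)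
  have h3 : |h (Aw p u)| ≤ C * ((1 + ‖u‖) * (|p.1| + ‖Sb n‖ * ‖p.2‖)) := by
    refine (hC _).trans (mul_le_mul_of_nonneg_left ?_ hC0)
    rw [h1, norm_smul, Real.norm_of_nonneg hn.le]
    exact mul_le_mul_of_nonneg_left h2 hn.le
  calc _ ≤ |κ p.1| * (C * ((1 + ‖u‖) * (|p.1| + ‖Sb n‖ * ‖p.2‖))) := mul_le_mul_of_nonneg_left h3 (abs_nonneg _)
    _ = _ := by ring

theorem fk_subl {h : Rn n → ℝ} (H : Subl h) {κ : ℝ → ℝ} (hκ : Ker κ) (h0 : ∀ y, 0 ≤ κ y) : Subl (fk h κ) where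
  hom c hc u := by
    unfold fk
    rw [← integral_const_mul]
    congr 1; funext p
    have : Aw p (c • u) = c • Aw p u := by unfold Aw; rw [map_smul, smul_comm p.1, ← smul_add]
    rw [this, H.hom c hc]; ring
  add u v := by
    unfold fk
    rw [← integral_add (fk_int H hκ u) (fk_int H hκ v)]
    refine integral_mono (fk_int H hκ _) ((fk_int H hκ u).add (fk_int H hκ v)) fun p => ?_
    have : Aw p (u + v) = Aw p u + Aw p v := by unfold Aw; rw [map_add, smul_add]; abel
    simp only [this, Pi.add_apply, ← mul_add]
    exact mul_le_mul_of_nonneg_left (H.add _ _) (h0 _)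

theorem fk_sub {h : Rn n → ℝ} (H : Subl h) {κ κ' : ℝ → ℝ} (hκ : Ker κ) (hκ' : Ker κ') (u) :
    fk h (fun y => κ y - κ' y) u = fk h κ u - fk h κ' u := by
  unfold fk
  rw [← integral_sub (fk_int H hκ u) (fk_int H hκ' u)]
  congr 1; funext p; ring

theorem fk_smul {h : Rn n → ℝ} (κ : ℝ → ℝ) (c : ℝ) (u) : fk h (fun y => c * κ y) u = c * fk h κ u := by
  unfold fk
  rw [← integral_const_mul]
  congr 1; funext p; ring

theorem fk_bound {h : Rn n → ℝ} (H : Subl h) : ∃ D, 0 ≤ D ∧ ∀ κ, Ker κ → ∀ u, ‖u‖ ≤ 1 →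
    |fk h κ u| ≤ D * ((∫ y, |κ y| * |y| ∂(gaussianReal 0 1)) + ∫ y, |κ y| ∂(gaussianReal 0 1)) := by
  obtain ⟨C, hC0, hC⟩ := H.bound
  set g := ∫ G, ‖G‖ ∂(stdGaussian (Mn n)) with hg
  have hg0 : 0 ≤ g := integral_nonneg fun _ => norm_nonneg _
  refine ⟨C * (1 + ‖Sb n‖ * g), by positivity, fun κ hκ u hu => ?_⟩
  obtain ⟨i1, i2⟩ := fk_dom_int (n := n) hκ C (C * ‖Sb n‖)
  have h1 : |fk h κ u| ≤ ∫ p : ℝ × Mn n, |κ p.1| * (C * |p.1| + C * ‖Sb n‖ * ‖p.2‖) ∂(gam (Mn n)) := by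
    unfold fk
    rw [← Real.norm_eq_abs]
    refine norm_integral_le_of_norm_le i1 (Eventually.of_forall fun p => ?_)
    rw [norm_mul, Real.norm_eq_abs, Real.norm_eq_abs]
    refine mul_le_mul_of_nonneg_left ?_ (abs_nonneg _)
    calc |h (Aw p u)| ≤ C * ‖Aw p u‖ := hC _
      _ ≤ C * (|p.1| + ‖Sb n‖ * ‖p.2‖) := mul_le_mul_of_nonneg_left (Aw_norm p hu) hC0
      _ = _ := by ring
  rw [i2] at h1
  refine h1.trans ?_
  have a0 : 0 ≤ ∫ y, |κ y| * |y| ∂(gaussianReal 0 1) := integral_nonneg fun _ => by positivity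
  have b0 : 0 ≤ ∫ y, |κ y| ∂(gaussianReal 0 1) := integral_nonneg fun _ => by positivity
  have : 0 ≤ ‖Sb n‖ * g := by positivity
  rw [← hg]
  nlinarith [mul_nonneg hC0 b0, mul_nonneg (mul_nonneg hC0 this) a0]

theorem fk_unit {h : Rn n → ℝ} (H : Subl h) {κ : ℝ → ℝ} (hκ : Continuous κ) {u : Rn n} (hu : ‖u‖ = 1) :
    fk h κ u = ∫ x, κ (inner ℝ x u) * h x ∂(stdGaussian (Rn n)) := by
  rw [← Aw_law hu, integral_map (Aw_cont u).measurable.aemeasurable]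
  · unfold fk; simp only [Aw_inner hu]
  · have := H.continuous
    exact Continuous.aestronglyMeasurable (by fun_prop)

theorem Subl.eq_of_unit {h g : Rn n → ℝ} (H : Subl h) (G : Subl g) (hh : ∀ u, ‖u‖ = 1 → h u = g u) : h = g := by
  funext u
  by_cases hu : u = 0
  · rw [hu, H.zero, G.zero]
  have hn : 0 < ‖u‖ := norm_pos_iff.2 hu
  have h1 := hh (‖u‖⁻¹ • u) (by simp [norm_smul, hn.ne'])
  rw [H.hom _ (inv_pos.2 hn), G.hom _ (inv_pos.2 hn)] at h1
  exact mul_left_cancel₀ (inv_pos.2 hn).ne' h1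

theorem ker_sqrt {s : ℝ} (hs : 0 ≤ s) : Ker (fun y => Real.sqrt (1 + s * y ^ 2)) := by
  refine ⟨by fun_prop, 1 + s, 2, fun y => ?_⟩
  rw [abs_of_nonneg (Real.sqrt_nonneg _), Real.sqrt_le_left (by positivity), sq_abs]
  have : 0 ≤ y ^ 2 := sq_nonneg y
  have h2 : 0 ≤ s * y^2 := by positivity
  have h3 : (1 + s * y^2) ≤ ((1 + s) * (1 + y^2)) := by nlinarith
  nlinarith

theorem Nul.base {ψ : Set (Rn (m+1)) → ℂ} (hψ : Val ψ k) (Z : ∀ (e : CE m) M, IsConvexBody M → ψ (Cy e M 0 1) = 0)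
    {h : Rn (m+1) → ℝ} (H : Subl h) (h0 : ∀ u, 0 ≤ h u) {s : ℝ} (hs : 0 ≤ s) :
    Nul ψ (fk h (fun y => Real.sqrt (1 + s * y ^ 2))) := by
  obtain ⟨C, hC0, hC⟩ := H.bound
  have hhc := H.continuous
  let E := Rn (m+1)
  let μ : Measure (E × (ℝ × E)) := (stdGaussian E).prod (gam E)
  let w : E × (ℝ × E) → E := fun p => (Real.sqrt s * p.2.1) • p.1 + p.2.2
  have hw : Continuous w := by fun_prop
  have i1 : Integrable (fun p : E × (ℝ × E) => ‖p.1‖ ^ 2 * (|p.2.1| ^ 1 * 1)) μ :=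
    (std_pow_int E 2).mul_prod ((gauss_pow_int 1).mul_prod (integrable_const (1:ℝ)))
  have i2 : Integrable (fun p : E × (ℝ × E) => ‖p.1‖ * (1 * ‖p.2.2‖)) μ :=
    (std_int E).mul_prod ((integrable_const (1:ℝ)).mul_prod (std_int E))
  have hint : Integrable (fun p => h p.1 * ‖w p‖) μ := by
    refine ((i1.const_mul (C * Real.sqrt s)).add (i2.const_mul C)).mono' (by fun_prop) (Eventually.of_forall fun p => ?_)
    rw [norm_mul, norm_norm, Real.norm_eq_abs]
    have h1 : ‖w p‖ ≤ Real.sqrt s * |p.2.1| * ‖p.1‖ + ‖p.2.2‖ := by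
      refine (norm_add_le _ _).trans ?_
      rw [norm_smul, norm_mul, Real.norm_of_nonneg (Real.sqrt_nonneg s), Real.norm_eq_abs]
    calc _ ≤ C * ‖p.1‖ * (Real.sqrt s * |p.2.1| * ‖p.1‖ + ‖p.2.2‖) := mul_le_mul (hC _) h1 (norm_nonneg _) (by positivity)
      _ = _ := by simp only [Pi.add_apply]; ring
  have hN := Nul.integral hψ Z μ (g := fun p => h p.1) (by fun_prop) (fun p => h0 _) hw hint
  have hS := fk_subl H (ker_sqrt hs) (fun y => Real.sqrt_nonneg _)
  have hN2 := hN.smul hψ (inv_pos.2 gc_pos).le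
  convert hN2 using 1
  refine hS.eq_of_unit hN2.1 fun u hu => ?_
  rw [fk_unit H (ker_sqrt hs).1 hu, Pi.smul_apply, smul_eq_mul]
  have hint2 : Integrable (fun p => h p.1 * |inner ℝ u (w p)|) μ := by
    refine hint.mono' (by fun_prop) (Eventually.of_forall fun p => ?_)
    rw [norm_mul, Real.norm_of_nonneg (h0 _), Real.norm_eq_abs, abs_abs]
    refine mul_le_mul_of_nonneg_left ?_ (h0 _)
    have := abs_real_inner_le_norm u (w p)
    rwa [hu, one_mul] at this
  rw [integral_prod _ hint2, ← integral_const_mul]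
  congr 1; funext x
  simp only [integral_const_mul]
  have e : ∀ p : ℝ × E, inner ℝ u (w (x, p)) = p.1 * (Real.sqrt s * inner ℝ x u) + inner ℝ u p.2 := by
    intro p
    simp only [w, inner_add_right, inner_smul_right]
    rw [real_inner_comm x u]; ring
  simp only [e]
  rw [gauss_abs, hu, mul_pow, Real.sq_sqrt hs, one_pow]
  have := gc_pos.ne'
  field_simp

end fk

end

section

open MeasureTheory Metric Filter Topology
open scoped Pointwise
open ProbabilityTheory

section Fj
variable {n m k : ℕ}

noncomputable def FF (j : ℕ) (s y : ℝ) : ℝ := y ^ (2 * j) * (1 + s * y ^ 2) ^ ((1:ℝ)/2 - j)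

theorem ff_base {s : ℝ} (hs : 0 ≤ s) (y : ℝ) : 1 ≤ 1 + s * y ^ 2 := by
  have := mul_nonneg hs (sq_nonneg y); linarith

theorem FF_nonneg (j : ℕ) {s : ℝ} (hs : 0 ≤ s) (y : ℝ) : 0 ≤ FF j s y := by
  have := ff_base hs y
  unfold FF
  have h2 : 0 ≤ y ^ (2*j) := by rw [pow_mul]; positivity
  positivity

theorem FF_cont (j : ℕ) {s : ℝ} (hs : 0 ≤ s) : Continuous (FF j s) := by
  unfold FF
  refine Continuous.mul (by fun_prop) (Continuous.rpow_const (by fun_prop) fun y => Or.inl ?_)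
  have := ff_base hs y; positivity

theorem FF_ker (j : ℕ) {s : ℝ} (hs : 0 ≤ s) : Ker (FF j s) := by
  refine ⟨FF_cont j hs, 1 + s, 2 * j + 2, fun y => ?_⟩
  rw [abs_of_nonneg (FF_nonneg j hs y)]
  have hb := ff_base hs y
  have h1 : (1 + s * y ^ 2) ^ ((1:ℝ)/2 - j) ≤ 1 + s * y ^ 2 := by
    conv_rhs => rw [← Real.rpow_one (1 + s * y ^ 2)]
    exact Real.rpow_le_rpow_of_exponent_le hb (by have : (0:ℝ) ≤ j := by positivity
                                                  linarith)
  have e : |y| ^ (2 * j + 2) = (y^2)^(j+1) := by rw [← sq_abs, ← pow_mul]; ring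
  have e2 : y ^ (2 * j) = (y^2)^j := by rw [pow_mul]
  unfold FF
  rw [e, e2]
  have z0 : 0 ≤ y^2 := sq_nonneg y
  generalize y^2 = z at *
  have h2 : z ^ j ≤ 1 + z ^ (j+1) := by
    rcases le_total 1 z with h | h
    · have := pow_le_pow_right₀ h (Nat.le_succ j); simp only [Nat.succ_eq_add_one] at this; linarith
    · have := pow_le_one₀ z0 h (n := j); linarith [pow_nonneg z0 (j+1)]
  have h3 : 0 ≤ z ^ j := pow_nonneg z0 j
  calc z ^ j * _ ≤ z ^ j * (1 + s * z) := mul_le_mul_of_nonneg_left h1 h3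
    _ = z ^ j + s * z ^ (j+1) := by ring
    _ ≤ _ := by linarith

theorem FF_anti (j : ℕ) {s t : ℝ} (hs : 0 ≤ s) (hst : s ≤ t) (y : ℝ) : FF (j+1) t y ≤ FF (j+1) s y := by
  have h2 : 0 ≤ y ^ (2*(j+1)) := by rw [pow_mul]; positivity
  refine mul_le_mul_of_nonneg_left ?_ h2
  have := ff_base hs y
  refine Real.rpow_le_rpow_of_nonpos (by positivity) ?_ ?_
  · have := mul_le_mul_of_nonneg_right hst (sq_nonneg y); linarith
  · push_cast; have : (0:ℝ) ≤ j := by positivity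
    linarith

theorem FF_zero (j : ℕ) : FF j 0 = fun y => y ^ (2 * j) := by
  funext y; simp [FF]

theorem FF_tend (j : ℕ) {s : ℝ} (hs : 0 ≤ s) (y : ℝ) :
    Tendsto (fun i : ℕ => FF j (s + 1 / ((i:ℝ) + 1)) y) atTop (𝓝 (FF j s y)) := by
  have h1 : Tendsto (fun i : ℕ => 1 + (s + 1 / ((i:ℝ) + 1)) * y^2) atTop (𝓝 (1 + s * y^2)) := by
    have := (((tendsto_one_div_add_atTop_nhds_zero_nat (𝕜 := ℝ)).const_add s).mul_const (y^2)).const_add 1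
    rwa [add_zero] at this
  exact (h1.rpow_const (Or.inl (by have := ff_base hs y; positivity))).const_mul _

theorem FF_mvt (j : ℕ) {s δ : ℝ} (hs : 0 ≤ s) (hδ : 0 < δ) (y : ℝ) :
    ∃ ξ, s ≤ ξ ∧ ξ ≤ s + δ ∧ FF j (s + δ) y - FF j s y = δ * (1/2 - j) * FF (j+1) ξ y := by
  have hd : ∀ t, 0 ≤ t → HasDerivAt (fun t => FF j t y) ((1/2 - j) * FF (j+1) t y) t := by
    intro t ht
    have hb := ff_base ht y
    have h1 : HasDerivAt (fun t : ℝ => 1 + t * y^2) (y^2) t := by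
      simpa using ((hasDerivAt_id t).mul_const (y^2)).const_add 1
    have h2 := (h1.rpow_const (p := (1:ℝ)/2 - j) (Or.inl (by positivity))).const_mul (y ^ (2*j))
    refine HasDerivAt.congr_deriv h2 ?_
    unfold FF
    push_cast
    rw [show (1:ℝ)/2 - (j+1) = 1/2 - j - 1 by ring]
    ring
  obtain ⟨ξ, hξ, he⟩ := exists_hasDerivAt_eq_slope (fun t => FF j t y) (fun t => (1/2 - j) * FF (j+1) t y)
    (show s < s + δ by linarith)
    (fun t ht => (hd t (hs.trans ht.1)).continuousAt.continuousWithinAt)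
    (fun t ht => hd t (hs.trans ht.1.le))
  refine ⟨ξ, hξ.1.le, hξ.2.le, ?_⟩
  rw [eq_div_iff (by linarith)] at he
  linarith

theorem Nul.ker_sub {ψ : Set (Rn n) → ℂ} {h : Rn n → ℝ} (H : Subl h) {κ κ' : ℝ → ℝ} (hκ : Ker κ) (hκ' : Ker κ')
    (hle : ∀ y, κ' y ≤ κ y) (N : Nul ψ (fk h κ)) (N' : Nul ψ (fk h κ')) : Nul ψ (fk h (fun y => κ y - κ' y)) := by
  refine Nul.cancel (fk_subl H (hκ.sub hκ') fun y => sub_nonneg.2 (hle y)) N' ?_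
  convert N using 1
  funext u
  rw [Pi.add_apply, fk_sub H hκ hκ']; ring

theorem Nul.FF {ψ : Set (Rn (m+1)) → ℂ} (hψ : Val ψ k) (Z : ∀ (e : CE m) M, IsConvexBody M → ψ (Cy e M 0 1) = 0)
    {h : Rn (m+1) → ℝ} (H : Subl h) (h0 : ∀ u, 0 ≤ h u) (j : ℕ) : ∀ {s : ℝ} (_ : 0 ≤ s), Nul ψ (fk h (FF j s)) := by
  induction j with
  | zero =>
    intro s hs
    have := Nul.base hψ Z H h0 hs
    convert this using 2
    funext y; simp [_root_.FF, Real.sqrt_eq_rpow]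
  | succ j ih =>
    intro s hs
    let d : ℕ → ℝ := fun i => 1 / ((i:ℝ) + 1)
    have hd : ∀ i, 0 < d i := fun i => by positivity
    have hsd : ∀ i, 0 ≤ s + d i := fun i => by have := hd i; linarith
    let kd : ℕ → ℝ → ℝ := fun i y => (d i * (1/2 - j))⁻¹ * (_root_.FF j (s + d i) y - _root_.FF j s y)
    have hc : (1/2 - (j:ℝ)) ≠ 0 := by
      intro hh
      have : (1:ℝ) = 2 * j := by linarith
      have : (1:ℕ) = 2 * j := by exact_mod_cast this
      omega
    have hkd : ∀ i y, _root_.FF (j+1) (s + d i) y ≤ kd i y ∧ kd i y ≤ _root_.FF (j+1) s y := by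
      intro i y
      obtain ⟨ξ, h1, h2, h3⟩ := FF_mvt j hs (hd i) y
      have : kd i y = _root_.FF (j+1) ξ y := by
        simp only [kd]; rw [h3, inv_mul_cancel_left₀ (mul_ne_zero (hd i).ne' hc)]
      rw [this]
      exact ⟨FF_anti j (hs.trans h1) h2 y, FF_anti j hs h1 y⟩
    have hkK : ∀ i, Ker (kd i) := fun i => ((FF_ker j (hsd i)).sub (FF_ker j hs)).smul _
    have hN : ∀ i, Nul ψ (fk h (kd i)) := by
      intro i
      have sgn : ∀ y, 0 ≤ (d i * (1/2 - j))⁻¹ * (_root_.FF j (s + d i) y - _root_.FF j s y) := fun y =>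
        (FF_nonneg (j+1) (hsd i) y).trans (hkd i y).1
      rcases hc.lt_or_gt with hneg | hpos
      · have hm : (d i * (1/2 - (j:ℝ))) < 0 := mul_neg_of_pos_of_neg (hd i) hneg
        have := (Nul.ker_sub H (FF_ker j hs) (FF_ker j (hsd i)) (fun y => ?_) (ih hs) (ih (hsd i))).smul hψ
          (t := -(d i * (1/2 - (j:ℝ)))⁻¹) (neg_nonneg.2 (inv_nonpos.2 hm.le))
        · convert this using 1
          funext u
          rw [Pi.smul_apply, smul_eq_mul, ← fk_smul]
          congr 1; funext y; simp only [kd]; ring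
        · have h1 := sgn y
          have h2 := inv_lt_zero.2 hm
          nlinarith
      · have hm : 0 < (d i * (1/2 - (j:ℝ))) := mul_pos (hd i) hpos
        have := (Nul.ker_sub H (FF_ker j (hsd i)) (FF_ker j hs) (fun y => ?_) (ih (hsd i)) (ih hs)).smul hψ
          (t := (d i * (1/2 - (j:ℝ)))⁻¹) (inv_nonneg.2 hm.le)
        · convert this using 1
          funext u
          rw [Pi.smul_apply, smul_eq_mul, ← fk_smul]
        · have h1 := sgn y
          have h2 := inv_pos.2 hm
          nlinarith
    obtain ⟨D, hD0, hD⟩ := fk_bound H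
    have hK0 := FF_ker (j+1) hs
    have habs : ∀ i y, |kd i y - _root_.FF (j+1) s y| ≤ _root_.FF (j+1) s y := by
      intro i y
      have := hkd i y
      have h2 := FF_nonneg (j+1) (hsd i) y
      rw [abs_le]; constructor <;> linarith
    have hpt : ∀ y, Tendsto (fun i => |kd i y - _root_.FF (j+1) s y|) atTop (𝓝 0) := by
      intro y
      have h1 : Tendsto (fun i => kd i y) atTop (𝓝 (_root_.FF (j+1) s y)) :=
        tendsto_of_tendsto_of_tendsto_of_le_of_le (FF_tend (j+1) hs y) tendsto_const_nhds (fun i => (hkd i y).1) (fun i => (hkd i y).2)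
      have := (h1.sub_const (_root_.FF (j+1) s y)).abs
      simpa using this
    refine Nul.lim hψ hN (fk_subl H hK0 (FF_nonneg _ hs)) (δ := fun i => D * ((∫ y, |kd i y - _root_.FF (j+1) s y| * |y| ∂(gaussianReal 0 1)) +
      ∫ y, |kd i y - _root_.FF (j+1) s y| ∂(gaussianReal 0 1))) ?_ ?_
    · have t1 : Tendsto (fun i => ∫ y, |kd i y - _root_.FF (j+1) s y| * |y| ∂(gaussianReal 0 1)) atTop (𝓝 (∫ y, (0:ℝ) ∂(gaussianReal 0 1))) := by
        refine tendsto_integral_of_dominated_convergence _ (fun i => ?_) hK0.int1 (fun i => Eventually.of_forall fun y => ?_) (Eventually.of_forall fun y => ?_)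
        · have h1 := (hkK i).1; have h2 := hK0.1
          exact Continuous.aestronglyMeasurable (by fun_prop)
        · rw [norm_mul, Real.norm_eq_abs, Real.norm_eq_abs, abs_abs, abs_abs]
          exact mul_le_mul_of_nonneg_right (habs i y) (abs_nonneg y)
        · simpa using (hpt y).mul_const |y|
      have t2 : Tendsto (fun i => ∫ y, |kd i y - _root_.FF (j+1) s y| ∂(gaussianReal 0 1)) atTop (𝓝 (∫ y, (0:ℝ) ∂(gaussianReal 0 1))) := by
        refine tendsto_integral_of_dominated_convergence _ (fun i => ?_) hK0.int (fun i => Eventually.of_forall fun y => ?_) (Eventually.of_forall fun y => ?_)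
        · have h1 := (hkK i).1; have h2 := hK0.1
          exact Continuous.aestronglyMeasurable (by fun_prop)
        · rw [Real.norm_eq_abs, abs_abs]
          exact habs i y
        · exact hpt y
      simpa using (t1.add t2).const_mul D
    · intro i u hu
      rw [← fk_sub H (hkK i) hK0]
      exact hD _ ((hkK i).sub hK0) u hu

end Fj

end

section

open MeasureTheory Metric Filter Topology
open scoped Pointwise
open ProbabilityTheory

section symm
variable {n m k : ℕ}

theorem gauss_moments (R : ℝ) (hR : 0 < R) : ∃ N : ℕ, 0 < ∫ y : ℝ, |y| ^ (2*N+1) ∂(gaussianReal 0 1) ∧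
    R * ∫ y : ℝ, y ^ (2*N) ∂(gaussianReal 0 1) ≤ 2 * ∫ y : ℝ, |y| ^ (2*N+1) ∂(gaussianReal 0 1) := by
  set p := (gaussianReal 0 1).real (Set.Icc (R+1) (R+1+1)) with hp
  have hp0 : 0 < p := ENNReal.toReal_pos (gauss_tail (R+1)).ne' (measure_ne_top _ _)
  have h1 : 1 < (R+1)/R := by rw [lt_div_iff₀ hR]; linarith
  obtain ⟨N, hN⟩ := pow_unbounded_of_one_lt (1/p) h1
  have hN' : 1 / p ≤ ((R+1)/R)^(2*N+1) := hN.le.trans (pow_le_pow_right₀ h1.le (by omega))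
  rw [div_pow, div_le_div_iff₀ hp0 (by positivity), one_mul] at hN'
  have hM : (R+1)^(2*N+1) * p ≤ ∫ y : ℝ, |y| ^ (2*N+1) ∂(gaussianReal 0 1) := by
    refine le_trans ?_ (mul_meas_ge_le_integral_of_nonneg (Eventually.of_forall fun y => by positivity) (gauss_pow_int (2*N+1)) ((R+1)^(2*N+1)))
    refine mul_le_mul_of_nonneg_left ?_ (by positivity)
    refine measureReal_mono ?_ (measure_ne_top _ _)
    intro y hy
    change (R+1)^(2*N+1) ≤ |y| ^ (2*N+1)
    exact pow_le_pow_left₀ (by positivity) (hy.1.trans (le_abs_self y)) _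
  refine ⟨N, lt_of_lt_of_le (by positivity) hM, ?_⟩
  have hE : ∫ y : ℝ, y ^ (2*N) ∂(gaussianReal 0 1) ≤ ∫ y : ℝ, (R^(2*N) + R⁻¹ * |y| ^ (2*N+1)) ∂(gaussianReal 0 1) := by
    refine integral_mono ?_ ((integrable_const _).add ((gauss_pow_int (2*N+1)).const_mul R⁻¹)) fun y => ?_
    · have := gauss_pow_int (2*N)
      simpa only [pow_mul, sq_abs] using this
    · have e : y ^ (2*N) = |y|^(2*N) := by rw [pow_mul, pow_mul, sq_abs]
      simp only [e]
      rcases le_total |y| R with h | h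
      · have := pow_le_pow_left₀ (abs_nonneg y) h (2*N)
        have : 0 ≤ R⁻¹ * |y| ^ (2*N+1) := by positivity
        linarith
      · have h2 : |y|^(2*N) ≤ R⁻¹ * |y| ^ (2*N+1) := by
          rw [le_inv_mul_iff₀ hR, pow_succ, mul_comm]
          exact mul_le_mul_of_nonneg_left h (by positivity)
        have : 0 ≤ R^(2*N) := by positivity
        linarith
  rw [integral_add (integrable_const _) ((gauss_pow_int (2*N+1)).const_mul R⁻¹), integral_const_mul] at hE
  simp only [integral_const, probReal_univ, one_smul] at hE
  have h3 := mul_le_mul_of_nonneg_left hE hR.le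
  rw [mul_add, mul_inv_cancel_left₀ hR.ne'] at h3
  have : R * R^(2*N) = R^(2*N+1) := by ring
  linarith

theorem Subl.lip {h : Rn n → ℝ} (H : Subl h) {C : ℝ} (hC : ∀ u, |h u| ≤ C * ‖u‖) (a b : Rn n) : |h a - h b| ≤ C * ‖a - b‖ := by
  have h1 := H.add b (a - b)
  have h2 := H.add a (b - a)
  rw [add_sub_cancel] at h1 h2
  have h3 := (le_abs_self _).trans (hC (a-b))
  have h4 := (le_abs_self _).trans (hC (b-a))
  rw [norm_sub_rev] at h4
  rw [abs_le]; constructor <;> linarith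

theorem Nul.symm {ψ : Set (Rn (m+1)) → ℂ} (hψ : Val ψ k) (Z : ∀ (e : CE m) M, IsConvexBody M → ψ (Cy e M 0 1) = 0)
    {K : Set (Rn (m+1))} (hK : IsConvexBody K) (hsy : -K = K) : Nul ψ (hs K) := by
  have H := hs_subl hK
  have hev := hs_neg hK hsy
  set h := hs K with hh
  have h0 : ∀ u, 0 ≤ h u := by
    intro u
    have := H.add u (-u)
    rw [add_neg_cancel, H.zero, hev] at this
    linarith
  have habs : ∀ (y : ℝ) u, h (y • u) = |y| * h u := by
    intro y u
    rcases lt_trichotomy y 0 with hy | rfl | hy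
    · rw [abs_of_neg hy, ← H.hom _ (neg_pos.2 hy), neg_smul, hev]
    · simp [H.zero]
    · rw [abs_of_pos hy, H.hom _ hy]
  obtain ⟨C, hC0, hC⟩ := H.bound
  set g := ∫ G, ‖G‖ ∂(stdGaussian (Mn (m+1))) with hg
  have hg0 : 0 ≤ g := integral_nonneg fun _ => norm_nonneg _
  choose N hN1 hN2 using fun i : ℕ => gauss_moments ((i:ℝ)+1) (by positivity)
  have hker : ∀ i, Ker (fun y : ℝ => y ^ (2 * N i)) := fun i => FF_zero (N i) ▸ FF_ker (N i) le_rfl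
  have hnn : ∀ i (y:ℝ), 0 ≤ y ^ (2 * N i) := fun i y => by rw [pow_mul]; positivity
  have hNul : ∀ i, Nul ψ (fk h (fun y : ℝ => y ^ (2 * N i))) := fun i => FF_zero (N i) ▸ Nul.FF hψ Z H h0 (N i) le_rfl
  refine Nul.lim hψ (fun i => (hNul i).smul hψ (inv_pos.2 (hN1 i)).le) H
    (δ := fun i => 2 * (C * ‖Sb (m+1)‖ * g) * (1 / ((i:ℝ)+1))) ?_ ?_
  · simpa using (tendsto_one_div_add_atTop_nhds_zero_nat (𝕜 := ℝ)).const_mul (2 * (C * ‖Sb (m+1)‖ * g))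
  · intro i u hu
    set M := ∫ y : ℝ, |y| ^ (2*N i+1) ∂(gaussianReal 0 1) with hM
    set E := ∫ y : ℝ, y ^ (2*N i) ∂(gaussianReal 0 1) with hE
    have hM0 : 0 < M := hN1 i
    have e1 : ∫ p, p.1 ^ (2 * N i) * h (p.1 • u) ∂(gam (Mn (m+1))) = M * h u := by
      have : ∀ p : ℝ × Mn (m+1), p.1 ^ (2 * N i) * h (p.1 • u) = |p.1| ^ (2*N i + 1) * h u := by
        intro p
        rw [habs, pow_succ, show |p.1| ^ (2 * N i) = p.1 ^ (2 * N i) by rw [pow_mul, pow_mul, sq_abs]]; ring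
      simp only [this]
      unfold gam
      rw [integral_prod_mul (fun y : ℝ => |y| ^ (2*N i + 1)) (fun G : Mn (m+1) => h u)]
      simp [hM]
    have i1 : Integrable (fun p => p.1 ^ (2 * N i) * h (p.1 • u)) (gam (Mn (m+1))) := by
      have : (fun p : ℝ × Mn (m+1) => p.1 ^ (2 * N i) * h (p.1 • u)) = fun p => |p.1| ^ (2*N i + 1) * h u := by
        funext p
        rw [habs, pow_succ, show |p.1| ^ (2 * N i) = p.1 ^ (2 * N i) by rw [pow_mul, pow_mul, sq_abs]]; ring
      rw [this]
      exact (gauss_pow_int (2*N i + 1)).mul_prod (integrable_const (h u))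
    have i2 := fk_int H (hker i) u
    have key : |fk h (fun y : ℝ => y ^ (2 * N i)) u - M * h u| ≤ C * ‖Sb (m+1)‖ * g * E := by
      rw [← e1, fk, ← integral_sub i2 i1, ← Real.norm_eq_abs]
      obtain ⟨d1, d2⟩ := fk_dom_int (n := m+1) (hker i) 0 (C * ‖Sb (m+1)‖)
      refine (norm_integral_le_of_norm_le d1 (Eventually.of_forall fun p => ?_)).trans_eq ?_
      · rw [← mul_sub, norm_mul, Real.norm_eq_abs, Real.norm_eq_abs]
        refine mul_le_mul_of_nonneg_left ?_ (abs_nonneg _)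
        refine (H.lip hC _ _).trans ?_
        rw [zero_mul, zero_add, mul_assoc]
        refine mul_le_mul_of_nonneg_left ?_ hC0
        unfold Aw
        rw [add_sub_cancel_left]
        refine ((Sb (m+1)).le_opNorm₂ p.2 u).trans ?_
        exact mul_le_of_le_one_right (by positivity) hu
      · rw [d2, ← hg]
        simp only [abs_of_nonneg (hnn i _)]
        rw [← hE]; ring
    rw [Pi.smul_apply, smul_eq_mul]
    have e2 : M⁻¹ * fk h (fun y : ℝ => y ^ (2 * N i)) u - h u = M⁻¹ * (fk h (fun y : ℝ => y ^ (2 * N i)) u - M * h u) := by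
      field_simp
    rw [e2, abs_mul, abs_of_pos (inv_pos.2 hM0), inv_mul_le_iff₀ hM0]
    refine key.trans ?_
    have h5 : ((i:ℝ)+1) * E ≤ 2 * M := hN2 i
    have hi : 0 < (i:ℝ)+1 := by positivity
    have h6 : E ≤ 2 * M * (1 / ((i:ℝ)+1)) := by rw [mul_one_div, le_div_iff₀ hi]; linarith
    have := mul_le_mul_of_nonneg_left h6 (show 0 ≤ C * ‖Sb (m+1)‖ * g by positivity)
    linarith

theorem Val.symm_zero {ψ : Set (Rn (m+1)) → ℂ} (hψ : Val ψ k) (Z : ∀ (e : CE m) M, IsConvexBody M → ψ (Cy e M 0 1) = 0)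
    {K : Set (Rn (m+1))} (hK : IsConvexBody K) (hsy : -K = K) : ψ K = 0 := by
  have := (Nul.symm hψ Z hK hsy).2 0 subl_zero
  rw [zero_add, bd_hs hK, bd_zero] at this
  rw [this]
  exact hψ.simple _ (isConvexBody_singleton 0) (interior_singleton_zero)

end symm

end

section

open MeasureTheory Metric Filter Topology
open scoped Pointwise

section caps
variable {n m k : ℕ}

noncomputable def du (v : Rn n) : Du n := (innerSL ℝ v : Rn n →L[ℝ] ℝ)
theorem du_apply (v x : Rn n) : du v x = inner ℝ v x := rfl

theorem du_ne {v : Rn n} (hv : ‖v‖ = 1) : du v ≠ 0 := by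
  intro h
  have := congrArg (fun φ : Du n => φ v) h
  simp [du_apply, hv] at this

theorem cap_close {v x : Rn n} (hv : ‖v‖ = 1) (hx : ‖x‖ ≤ 1) (h : 0.95 ≤ inner ℝ v x) : ‖v - x‖ ≤ 0.32 := by
  have h1 := norm_sub_sq_real v x
  have h2 := norm_nonneg x
  have h3 := norm_nonneg (v - x)
  rw [hv] at h1
  nlinarith

theorem caps_near {v w x z : Rn n} (hv : ‖v‖ = 1) (hw : ‖w‖ = 1) (hx : ‖x‖ ≤ 1) (hz : ‖z‖ ≤ 1)
    (h1 : 0.95 ≤ inner ℝ v z) (h2 : 0.95 ≤ inner ℝ w z) (h3 : 0.95 ≤ inner ℝ w x) : 0 < (inner ℝ v x : ℝ) := by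
  have a1 := cap_close hv hz h1
  have a2 := cap_close hw hz h2
  have a3 := cap_close hw hx h3
  have e : v - x = (v - z) - (w - z) + (w - x) := by abel
  have a4 : ‖v - x‖ ≤ 0.96 := by
    rw [e]
    have := norm_add_le ((v - z) - (w - z)) (w - x)
    have := norm_sub_le (v - z) (w - z)
    linarith
  have h1 := norm_sub_sq_real v x
  have h3 := norm_nonneg (v - x)
  rw [hv] at h1
  nlinarith [sq_nonneg ‖x‖]

def XT (T : Finset (Rn n × ℝ)) : Set (Rn n) := {x | ‖x‖ ≤ 1 ∧ ∀ p ∈ T, inner ℝ p.1 x ≤ p.2}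

theorem XT_eq (T : Finset (Rn n × ℝ)) : XT T = closedBall 0 1 ∩ ⋂ p ∈ T, {x | inner ℝ p.1 x ≤ p.2} := by
  ext x
  simp only [Set.mem_inter_iff, Set.mem_iInter, mem_closedBall_zero_iff]
  rfl

theorem XT_body {T : Finset (Rn n × ℝ)} (h : ∀ p ∈ T, 0 ≤ p.2) : IsConvexBody (XT T) := by
  refine ⟨⟨0, ?_⟩, ?_, ?_⟩
  · exact ⟨by simp, fun p hp => by simpa using h p hp⟩
  · rw [XT_eq]
    refine (isCompact_closedBall _ _).inter_right (isClosed_biInter fun p _ => isClosed_le (by fun_prop) (by fun_prop))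
  · rw [XT_eq]
    exact (convex_closedBall _ _).inter (convex_iInter₂ fun p _ => convex_halfSpace_le (du p.1).isLinear p.2)

theorem Val.half {ψ : Set (Rn n) → ℂ} (hψ : Val ψ k) {Q : Set (Rn n)} (hQ : IsConvexBody Q) (hs : -Q = Q) (h0 : ψ Q = 0)
    {φ : Du n} (hφ : φ ≠ 0) : ex0 ψ (Q ∩ {x | φ x ≤ 0}) = 0 ∧ ex0 ψ (Q ∩ {x | 0 ≤ φ x}) = 0 := by
  have hz : (0 : Rn n) ∈ Q := by
    obtain ⟨x, hx⟩ := hQ.1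
    have hx' : -x ∈ Q := by rw [← hs]; simpa using hx
    have := hQ.convex hx hx' (a := 1/2) (b := 1/2) (by norm_num) (by norm_num) (by norm_num)
    simpa using this
  have n1 : (Q ∩ {x | φ x ≤ 0}).Nonempty := ⟨0, hz, by change φ 0 ≤ 0; simp⟩
  have n2 : (Q ∩ {x | 0 ≤ φ x}).Nonempty := ⟨0, hz, by change 0 ≤ φ 0; simp⟩
  have c := hψ.cut Q hQ φ hφ 0 n1 n2
  have hb : IsConvexBody (Q ∩ {x | φ x ≤ 0}) :=
    hQ.inter (isClosed_le φ.cont continuous_const) (convex_halfSpace_le φ.isLinear 0) n1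
  have e : -(Q ∩ {x | φ x ≤ 0}) = Q ∩ {x | 0 ≤ φ x} := by
    ext x
    have h1 : -x ∈ Q ↔ x ∈ Q := by rw [← Set.mem_neg, hs]
    have h2 : φ (-x) ≤ 0 ↔ 0 ≤ φ x := by rw [map_neg, neg_nonpos]
    exact and_congr h1 h2
  have ev := hψ.even _ hb
  rw [e] at ev
  rw [ex0_ne _ n1, ex0_ne _ n2, ev]
  rw [ev, h0] at c
  have : ψ (Q ∩ {x | φ x ≤ 0}) = 0 := by
    have : (2:ℂ) * ψ (Q ∩ {x | φ x ≤ 0}) = 0 := by rw [c]; ring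
    simpa using this
  exact ⟨this, this⟩

theorem Val.XT_zero {ψ : Set (Rn n) → ℂ} (hψ : Val ψ k) (S0 : ∀ K, IsConvexBody K → -K = K → ψ K = 0) :
    ∀ (N : ℕ) (T : Finset (Rn n × ℝ)), T.card = N → (∀ p ∈ T, ‖p.1‖ = 1 ∧ 0.95 ≤ p.2) → ψ (XT T) = 0 := by
  classical
  intro N
  induction N using Nat.strong_induction_on with
  | _ N ih =>
  intro T hTN hT
  have hbd : ∀ {T' : Finset (Rn n × ℝ)}, T' ⊆ T → IsConvexBody (XT T') := fun {T'} h =>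
    XT_body fun p hp => by have := (hT p (h hp)).2; linarith
  have hB : IsConvexBody (closedBall (0 : Rn n) 1) := isConvexBody_closedBall 0 zero_le_one
  have hBs : -(closedBall (0 : Rn n) 1) = closedBall 0 1 := by ext x; simp
  rcases T.eq_empty_or_nonempty with rfl | ⟨p, hp⟩
  · have : XT (∅ : Finset (Rn n × ℝ)) = closedBall 0 1 := by rw [XT_eq]; simp
    rw [this]; exact S0 _ hB hBs
  obtain ⟨hp1, hp2⟩ := hT p hp
  let J := (T.erase p).filter fun q => ∃ z : Rn n, ‖z‖ ≤ 1 ∧ p.2 ≤ inner ℝ p.1 z ∧ q.2 < inner ℝ q.1 z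
  have hJ : J ⊆ T.erase p := Finset.filter_subset _ _
  have hET : T.erase p ⊆ T := Finset.erase_subset _ _
  have hcard : (T.erase p).card + 1 = T.card := Finset.card_erase_add_one hp
  have hpJ : insert p J ⊆ T := Finset.insert_subset hp (hJ.trans hET)
  have hins : ∀ A : Finset (Rn n × ℝ), XT A ∩ {x | du p.1 x ≤ p.2} = XT (insert p A) := by
    intro A; ext x
    constructor
    · rintro ⟨⟨h1, h2⟩, h3⟩
      refine ⟨h1, fun q hq => ?_⟩
      rcases Finset.mem_insert.1 hq with rfl | hq
      · exact h3
      · exact h2 q hq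
    · rintro ⟨h1, h2⟩
      exact ⟨⟨h1, fun q hq => h2 q (Finset.mem_insert_of_mem hq)⟩, h2 p (Finset.mem_insert_self _ _)⟩
  by_cases hJe : J = T.erase p
  · -- all caps near p
    have hnear : ∀ x : Rn n, ‖x‖ ≤ 1 → du p.1 x ≤ 0 → x ∈ XT T := by
      intro x hx hx0
      refine ⟨hx, fun q hq => ?_⟩
      by_cases hqp : q = p
      · rw [hqp]; rw [du_apply] at hx0; linarith
      · by_contra hlt
        push Not at hlt
        have hqJ : q ∈ J := by rw [hJe]; exact Finset.mem_erase.2 ⟨hqp, hq⟩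
        obtain ⟨z, hz, hz1, hz2⟩ := (Finset.mem_filter.1 hqJ).2
        obtain ⟨hq1, hq2⟩ := hT q hq
        have := caps_near hp1 hq1 hx hz (by linarith) (by linarith) (by linarith)
        rw [du_apply] at hx0; linarith
    have hP := hbd (Finset.Subset.refl T)
    have hne := du_ne hp1
    have c := hψ.cut0 hP.isCompact hP.convex (du p.1) 0 (Or.inl hne)
    have e1 : XT T ∩ {x | du p.1 x ≤ 0} = closedBall 0 1 ∩ {x | du p.1 x ≤ 0} := by
      ext x
      constructor
      · rintro ⟨h1, h2⟩; exact ⟨mem_closedBall_zero_iff.2 h1.1, h2⟩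
      · rintro ⟨h1, h2⟩; exact ⟨hnear x (mem_closedBall_zero_iff.1 h1) h2, h2⟩
    have hz : (0 : Rn n) ∈ XT T := hnear 0 (by simp) (by simp)
    have hQ : IsConvexBody (XT T ∩ -XT T) := hP.inter hP.neg.isClosed hP.neg.convex ⟨0, hz, by simpa using hz⟩
    have hQs : -(XT T ∩ -XT T) = XT T ∩ -XT T := by rw [Set.inter_neg, neg_neg, Set.inter_comm]
    have e2 : XT T ∩ {x | 0 ≤ du p.1 x} = (XT T ∩ -XT T) ∩ {x | 0 ≤ du p.1 x} := by
      ext x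
      constructor
      · rintro ⟨h1, h2⟩
        refine ⟨⟨h1, hnear (-x) (by simpa using h1.1) ?_⟩, h2⟩
        rw [map_neg, neg_nonpos]; exact h2
      · rintro ⟨h1, h2⟩; exact ⟨h1.1, h2⟩
    rw [e1, e2, (hψ.half hB hBs (S0 _ hB hBs) hne).1, (hψ.half hQ hQs (S0 _ hQ hQs) hne).2, add_zero, ex0_ne _ hP.1] at c
    exact c
  · have hJlt : J.card < (T.erase p).card := Finset.card_lt_card (Finset.ssubset_iff_subset_ne.2 ⟨hJ, hJe⟩)
    have hJins : (insert p J).card ≤ J.card + 1 := Finset.card_insert_le _ _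
    have z1 := ih _ (by omega) (T.erase p) rfl (fun q hq => hT q (hET hq))
    have z2 := ih _ (by omega) J rfl (fun q hq => hT q (hET (hJ hq)))
    have z3 := ih _ (by omega) (insert p J) rfl (fun q hq => hT q (hpJ hq))
    have b1 := hbd hET
    have b2 := hbd (hJ.trans hET)
    have b3 := hbd hpJ
    have hP := hbd (Finset.Subset.refl T)
    have c1 := hψ.cut0 b1.isCompact b1.convex (du p.1) p.2 (Or.inl (du_ne hp1))
    have c2 := hψ.cut0 b2.isCompact b2.convex (du p.1) p.2 (Or.inl (du_ne hp1))
    rw [hins, Finset.insert_erase hp, ex0_ne _ b1.1, ex0_ne _ hP.1, z1] at c1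
    rw [hins, ex0_ne _ b2.1, ex0_ne _ b3.1, z2, z3] at c2
    have e : XT (T.erase p) ∩ {x | p.2 ≤ du p.1 x} = XT J ∩ {x | p.2 ≤ du p.1 x} := by
      ext x
      constructor
      · rintro ⟨h1, h2⟩; exact ⟨⟨h1.1, fun q hq => h1.2 q (hJ hq)⟩, h2⟩
      · rintro ⟨h1, h2⟩
        refine ⟨⟨h1.1, fun q hq => ?_⟩, h2⟩
        by_contra hlt
        push Not at hlt
        exact absurd (h1.2 q (Finset.mem_filter.2 ⟨hq, x, h1.1, h2, hlt⟩)) (not_le.2 hlt)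
    rw [e] at c1
    rw [zero_add] at c2
    rw [← c2, add_zero] at c1
    exact c1.symm

theorem polh_XT {S : Set (Du n × ℝ)} (hS : S.Finite) (hb : closedBall 0 0.95 ⊆ Polh S) :
    ∃ T : Finset (Rn n × ℝ), (∀ p ∈ T, ‖p.1‖ = 1 ∧ 0.95 ≤ p.2) ∧ Polh S ∩ closedBall 0 1 = XT T := by
  classical
  have hz : (0 : Rn n) ∈ Polh S := hb (by simp; norm_num)
  have hv : ∀ φ : Du n, ∃ v : Rn n, ∀ x, φ x = inner ℝ v x := fun φ =>
    ⟨(InnerProductSpace.toDual ℝ (Rn n)).symm (LinearMap.toContinuousLinearMap φ), fun x => by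
      rw [InnerProductSpace.toDual_symm_apply]; rfl⟩
  choose V hV using hv
  let S' := hS.toFinset.filter fun p => V p.1 ≠ 0
  let F : Du n × ℝ → Rn n × ℝ := fun p => (‖V p.1‖⁻¹ • V p.1, ‖V p.1‖⁻¹ * p.2)
  have hF : ∀ p ∈ S, V p.1 ≠ 0 → ∀ x, (inner ℝ (F p).1 x ≤ (F p).2 ↔ p.1 x ≤ p.2) := by
    intro p hp h0 x
    have hn : 0 < ‖V p.1‖⁻¹ := inv_pos.2 (norm_pos_iff.2 h0)
    simp only [F]
    rw [inner_smul_left, conj_trivial, hV, mul_le_mul_iff_right₀ hn]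
  refine ⟨S'.image F, ?_, ?_⟩
  · intro q hq
    obtain ⟨p, hp, rfl⟩ := Finset.mem_image.1 hq
    obtain ⟨hpS, h0⟩ := Finset.mem_filter.1 hp
    rw [Set.Finite.mem_toFinset] at hpS
    have hn : 0 < ‖V p.1‖ := norm_pos_iff.2 h0
    have h1 : ‖(F p).1‖ = 1 := by simp [F, norm_smul, hn.ne']
    refine ⟨h1, ?_⟩
    have h2 := (hF p hpS h0 ((0.95:ℝ) • (F p).1)).2 (hb (by rw [mem_closedBall_zero_iff, norm_smul, h1]; norm_num) p hpS)
    rw [inner_smul_right, real_inner_self_eq_norm_sq, h1] at h2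
    linarith
  · ext x
    constructor
    · rintro ⟨h1, h2⟩
      refine ⟨mem_closedBall_zero_iff.1 h2, fun q hq => ?_⟩
      obtain ⟨p, hp, rfl⟩ := Finset.mem_image.1 hq
      obtain ⟨hpS, h0⟩ := Finset.mem_filter.1 hp
      rw [Set.Finite.mem_toFinset] at hpS
      exact (hF p hpS h0 x).2 (h1 p hpS)
    · rintro ⟨h1, h2⟩
      refine ⟨fun p hp => ?_, mem_closedBall_zero_iff.2 h1⟩
      by_cases h0 : V p.1 = 0
      · have := hz p hp
        rw [hV, h0, inner_zero_left] at this ⊢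
        exact this
      · exact (hF p hp h0 x).1 (h2 _ (Finset.mem_image_of_mem F (Finset.mem_filter.2 ⟨hS.mem_toFinset.2 hp, h0⟩)))

theorem Val.sandwich {ψ : Set (Rn n) → ℂ} (hψ : Val ψ k) (S0 : ∀ K, IsConvexBody K → -K = K → ψ K = 0)
    {K : Set (Rn n)} (hK : IsConvexBody K) (h1 : closedBall 0 0.95 ⊆ K) (h2 : K ⊆ closedBall 0 1) : ψ K = 0 := by
  obtain ⟨S, hS, hKS, hb, hc⟩ := exists_polh hK
  have hz : (0 : Rn n) ∈ K := h1 (by simp; norm_num)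
  have hc2 := hc.inter hK (convex_closedBall (0 : Rn n) 1) hz
    (mem_interior_iff_mem_nhds.2 (closedBall_mem_nhds 0 one_pos))
  rw [Set.inter_eq_left.2 h2] at hc2
  have hbody : ∀ i, IsConvexBody (Polh (S i) ∩ closedBall 0 1) := fun i =>
    (hb i).inter isClosed_closedBall (convex_closedBall _ _) ⟨0, hKS i hz, by simp⟩
  have ht := hψ.cont _ _ hbody hK hc2
  have h0 : ∀ i, ψ (Polh (S i) ∩ closedBall 0 1) = 0 := by
    intro i
    obtain ⟨T, hT, e⟩ := polh_XT (hS i) (h1.trans (hKS i))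
    rw [e]; exact hψ.XT_zero S0 _ T rfl hT
  simp only [h0] at ht
  exact tendsto_nhds_unique ht tendsto_const_nhds |>.symm ▸ rfl

theorem Val.zero_of_Z {ψ : Set (Rn (m+1)) → ℂ} (hψ : Val ψ k) (Z : ∀ (e : CE m) M, IsConvexBody M → ψ (Cy e M 0 1) = 0)
    {K : Set (Rn (m+1))} (hK : IsConvexBody K) : ψ K = 0 := by
  have S0 : ∀ K, IsConvexBody K → -K = K → ψ K = 0 := fun K hK hs => hψ.symm_zero Z hK hs
  obtain ⟨R, hR⟩ := hK.isCompact.isBounded.exists_norm_le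
  obtain ⟨x0, hx0⟩ := hK.1
  have hR0 : 0 ≤ R := (norm_nonneg _).trans (hR x0 hx0)
  let s : ℝ := 0.01 / (R + 1)
  have hs : 0 < s := by simp only [s]; positivity
  have hsK : IsConvexBody (s • K) := hK.smul s
  have hsm : ∀ y ∈ s • K, ‖y‖ ≤ 0.01 := by
    rintro _ ⟨x, hx, rfl⟩
    simp only [norm_smul, Real.norm_of_nonneg hs.le]
    have := hR x hx
    simp only [s]
    rw [div_mul_eq_mul_div, div_le_iff₀ (by positivity)]
    linarith
  have hB : IsConvexBody (closedBall (0 : Rn (m+1)) 1) := isConvexBody_closedBall 0 zero_le_one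
  have hN := (Nul.symm hψ Z hB (by ext x; simp)).smul hψ (t := 0.98) (by norm_num)
  have h1 := hN.2 _ (hs_subl hsK)
  rw [bd_add (hs_subl hsK) hN.1, bd_smul (hs_subl hB) (by norm_num), bd_hs hB, bd_hs hsK] at h1
  have h2 : ψ (s • K + (0.98:ℝ) • closedBall 0 1) = 0 := by
    refine hψ.sandwich S0 (hsK.add (hB.smul _)) ?_ ?_
    · intro x hx
      rw [mem_closedBall_zero_iff] at hx
      obtain ⟨y, hy⟩ := hsK.1
      have hy' := hsm y hy
      refine ⟨y, hy, x - y, ?_, by simp⟩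
      refine ⟨(0.98:ℝ)⁻¹ • (x - y), ?_, by simp only [smul_smul]; norm_num⟩
      rw [mem_closedBall_zero_iff, norm_smul, Real.norm_of_nonneg (by norm_num), inv_mul_le_iff₀ (by norm_num)]
      have := norm_sub_le x y
      linarith
    · rintro _ ⟨y, hy, _, ⟨z, hz, rfl⟩, rfl⟩
      rw [mem_closedBall_zero_iff] at hz ⊢
      refine (norm_add_le _ _).trans ?_
      have := hsm y hy
      rw [norm_smul, Real.norm_of_nonneg (by norm_num)]
      linarith
  rw [h2, hψ.hom s hs K hK] at h1
  have : (s:ℂ) ^ k ≠ 0 := pow_ne_zero _ (by exact_mod_cast hs.ne')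
  exact (mul_eq_zero.1 h1.symm).resolve_left this

/-- Klain–Schneider type vanishing -/
theorem Val.KS (k : ℕ) : ∀ m, k + 1 ≤ m → ∀ ψ : Set (Rn (m+1)) → ℂ, Val ψ k → ∀ K, IsConvexBody K → ψ K = 0 := by
  induction k with
  | zero =>
    intro m _ ψ hψ K hK
    have h1 := hψ.cont _ _ (fun i : ℕ => hK.smul (1 / ((i:ℝ)+1))) (isConvexBody_singleton 0)
      (HC.smul_zero hK tendsto_one_div_add_atTop_nhds_zero_nat)
    rw [hψ.simple {0} (isConvexBody_singleton 0) interior_singleton_zero] at h1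
    have h2 : ∀ i : ℕ, ψ ((1 / ((i:ℝ)+1)) • K) = ψ K := fun i => by
      rw [hψ.hom _ (by positivity) K hK, pow_zero, one_mul]
    simp only [h2] at h1
    exact tendsto_nhds_unique tendsto_const_nhds h1
  | succ k ih =>
    intro m hm ψ hψ K hK
    obtain ⟨m, rfl⟩ : ∃ m', m = m' + 1 := ⟨m - 1, by omega⟩
    exact hψ.zero_of_Z (fun e M hM => ih m (by omega) _ (hψ.slice e) M hM) hK

end caps

end

section

open MeasureTheory Metric Filter Topology
open scoped Pointwise NNReal

section conv
variable {n m k : ℕ}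

/-- integral against a signed measure -/
noncomputable def SI (s : SignedMeasure (Rn n)) (g : Rn n → ℂ) : ℂ :=
  (∫ x, g x ∂s.toJordanDecomposition.posPart) - (∫ x, g x ∂s.toJordanDecomposition.negPart)

theorem cm_SI (μ : ComplexMeasure (Rn n)) (g) : cmIntegral μ g = SI (ComplexMeasure.re μ) g + Complex.I * SI (ComplexMeasure.im μ) g := rfl

theorem jor (s : SignedMeasure (Rn n)) {β : Set (Rn n)} (hβ : MeasurableSet β) :
    s β = s.toJordanDecomposition.posPart.real β - s.toJordanDecomposition.negPart.real β := by
  conv_lhs => rw [← s.toSignedMeasure_toJordanDecomposition]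
  rw [JordanDecomposition.toSignedMeasure, VectorMeasure.sub_apply, Measure.toSignedMeasure_apply_measurable hβ,
    Measure.toSignedMeasure_apply_measurable hβ]

/-- bounded measurable functions -/
def BM (g : Rn n → ℂ) : Prop := Measurable g ∧ ∃ M : ℝ, ∀ x, ‖g x‖ ≤ M

theorem BM.int {g : Rn n → ℂ} (h : BM g) (μ : Measure (Rn n)) [IsFiniteMeasure μ] : Integrable g μ := by
  obtain ⟨M, hM⟩ := h.2
  exact Integrable.of_bound h.1.aestronglyMeasurable M (Eventually.of_forall hM)

theorem BM.comp {g : Rn n → ℂ} (h : BM g) {T : Rn n → Rn n} (hT : Measurable T) : BM (fun x => g (T x)) := by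
  obtain ⟨M, hM⟩ := h.2
  exact ⟨h.1.comp hT, M, fun x => hM _⟩

theorem SI_transfer {s s' : SignedMeasure (Rn n)} {T : Rn n → Rn n} (hT : Measurable T) {U : Set (Rn n)} (hU : MeasurableSet U)
    (c : ℝ≥0) (h : ∀ β, MeasurableSet β → β ⊆ U → s' β = c * s (T ⁻¹' β)) {g : Rn n → ℂ} (hg : BM g) (h0 : ∀ x ∉ U, g x = 0) :
    SI s' g = c * SI s (fun x => g (T x)) := by
  unfold SI
  set p := s.toJordanDecomposition.posPart
  set q := s.toJordanDecomposition.negPart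
  set p' := s'.toJordanDecomposition.posPart
  set q' := s'.toJordanDecomposition.negPart
  haveI : IsFiniteMeasure (p.map T) := Measure.isFiniteMeasure_map p T
  haveI : IsFiniteMeasure (q.map T) := Measure.isFiniteMeasure_map q T
  have key : (p' + c • q.map T).restrict U = (q' + c • p.map T).restrict U := by
    ext β hβ
    rw [Measure.restrict_apply hβ, Measure.restrict_apply hβ]
    have hb : MeasurableSet (β ∩ U) := hβ.inter hU
    have h1 := h (β ∩ U) hb Set.inter_subset_right
    rw [jor s' hb, jor s (hT hb)] at h1
    have e : ∀ r : Measure (Rn n), r.real (T ⁻¹' (β ∩ U)) = (r.map T).real (β ∩ U) := fun r => by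
      rw [measureReal_def, measureReal_def, Measure.map_apply hT hb]
    rw [e, e] at h1
    refine (measureReal_eq_measureReal_iff (measure_ne_top _ _) (measure_ne_top _ _)).1 ?_
    rw [measureReal_add_apply, measureReal_add_apply, measureReal_nnreal_smul_apply, measureReal_nnreal_smul_apply]
    linarith
  have i := fun (μ : Measure (Rn n)) [IsFiniteMeasure μ] => hg.int μ
  have h2 : ∫ x, g x ∂(p' + c • q.map T) = ∫ x, g x ∂(q' + c • p.map T) := by
    have h3 := fun μ : Measure (Rn n) => setIntegral_eq_integral_of_forall_compl_eq_zero (μ := μ) h0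
    rw [← h3 (p' + c • q.map T), key, h3]
  rw [integral_add_measure (i _) (i _), integral_add_measure (i _) (i _), integral_smul_nnreal_measure, integral_smul_nnreal_measure,
    integral_map hT.aemeasurable hg.1.aestronglyMeasurable, integral_map hT.aemeasurable hg.1.aestronglyMeasurable] at h2
  simp only [NNReal.smul_def, Complex.real_smul] at h2
  linear_combination h2

theorem cre (μ : ComplexMeasure (Rn n)) (β) : ComplexMeasure.re μ β = (μ β).re := rfl
theorem cim (μ : ComplexMeasure (Rn n)) (β) : ComplexMeasure.im μ β = (μ β).im := rfl

theorem cm_transfer {μ μ' : ComplexMeasure (Rn n)} {T : Rn n → Rn n} (hT : Measurable T) {U : Set (Rn n)} (hU : MeasurableSet U)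
    (c : ℝ≥0) (h : ∀ β, MeasurableSet β → β ⊆ U → μ' β = (c:ℝ) * μ (T ⁻¹' β)) {g : Rn n → ℂ} (hg : BM g) (h0 : ∀ x ∉ U, g x = 0) :
    cmIntegral μ' g = (c:ℝ) * cmIntegral μ (fun x => g (T x)) := by
  rw [cm_SI, cm_SI, SI_transfer (s := ComplexMeasure.re μ) hT hU c (fun β h1 h2 => ?_) hg h0,
    SI_transfer (s := ComplexMeasure.im μ) hT hU c (fun β h1 h2 => ?_) hg h0]
  · ring
  · rw [cim, cim, h β h1 h2, Complex.im_ofReal_mul]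
  · rw [cre, cre, h β h1 h2, Complex.re_ofReal_mul]

theorem SI_add (s : SignedMeasure (Rn n)) {f g : Rn n → ℂ} (hf : BM f) (hg : BM g) : SI s (fun x => f x + g x) = SI s f + SI s g := by
  unfold SI
  rw [integral_add (hf.int _) (hg.int _), integral_add (hf.int _) (hg.int _)]; ring

theorem cm_add (μ : ComplexMeasure (Rn n)) {f g : Rn n → ℂ} (hf : BM f) (hg : BM g) :
    cmIntegral μ (fun x => f x + g x) = cmIntegral μ f + cmIntegral μ g := by
  rw [cm_SI, SI_add _ hf hg, SI_add _ hf hg, cm_SI, cm_SI]; ring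

theorem cm_smul (μ : ComplexMeasure (Rn n)) (c : ℂ) (f : Rn n → ℂ) :
    cmIntegral μ (fun x => c * f x) = c * cmIntegral μ f := by
  simp only [cm_SI, SI, integral_const_mul]; ring

theorem cm_bound (μ : ComplexMeasure (Rn n)) : ∃ C : ℝ, 0 ≤ C ∧ ∀ (f : Rn n → ℂ) (M : ℝ), (∀ x, ‖f x‖ ≤ M) → ‖cmIntegral μ f‖ ≤ C * M := by
  have hS : ∀ s : SignedMeasure (Rn n), ∃ C : ℝ, 0 ≤ C ∧ ∀ (f : Rn n → ℂ) (M : ℝ), (∀ x, ‖f x‖ ≤ M) → ‖SI s f‖ ≤ C * M := by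
    intro s
    refine ⟨s.toJordanDecomposition.posPart.real Set.univ + s.toJordanDecomposition.negPart.real Set.univ, by positivity, fun f M h => ?_⟩
    have h1 := norm_integral_le_of_norm_le_const (μ := s.toJordanDecomposition.posPart) (Eventually.of_forall h)
    have h2 := norm_integral_le_of_norm_le_const (μ := s.toJordanDecomposition.negPart) (Eventually.of_forall h)
    have := norm_sub_le (∫ x, f x ∂s.toJordanDecomposition.posPart) (∫ x, f x ∂s.toJordanDecomposition.negPart)
    unfold SI
    linarith
  obtain ⟨C, hC, h⟩ := hS (ComplexMeasure.re μ)
  obtain ⟨C', hC', h'⟩ := hS (ComplexMeasure.im μ)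
  refine ⟨C + C', by positivity, fun f M hM => ?_⟩
  rw [cm_SI]
  have h3 := norm_add_le (SI (ComplexMeasure.re μ) f) (Complex.I * SI (ComplexMeasure.im μ) f)
  rw [norm_mul, Complex.norm_I, one_mul] at h3
  have := h f M hM
  have := h' f M hM
  linarith

theorem SI_real (s : SignedMeasure (Rn n)) (f : Rn n → ℝ) : SI s (fun x => (f x : ℂ)) =
    ((((∫ x, f x ∂s.toJordanDecomposition.posPart) - ∫ x, f x ∂s.toJordanDecomposition.negPart : ℝ)) : ℂ) := by
  unfold SI
  have h := fun μ : Measure (Rn n) => integral_ofReal (μ := μ) (𝕜 := ℂ) (f := f)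
  rw [Complex.ofReal_sub]
  exact congrArg₂ _ (h _) (h _)

theorem bcf_bm (f : BoundedContinuousFunction (Rn n) ℝ) : BM (fun x => (f x : ℂ)) :=
  ⟨by have := f.continuous.measurable; fun_prop, ‖f‖, fun x => by rw [Complex.norm_real]; exact f.norm_coe_le_norm x⟩

theorem SI_ext {s s' : SignedMeasure (Rn n)} (h : ∀ f : BoundedContinuousFunction (Rn n) ℝ,
    SI s (fun x => (f x : ℂ)) = SI s' (fun x => (f x : ℂ))) : s = s' := by
  have key : s.toJordanDecomposition.posPart + s'.toJordanDecomposition.negPart =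
      s.toJordanDecomposition.negPart + s'.toJordanDecomposition.posPart := by
    refine ext_of_forall_integral_eq_of_IsFiniteMeasure fun f => ?_
    have h1 := h f
    rw [SI_real, SI_real] at h1
    have h2 := Complex.ofReal_injective h1
    rw [integral_add_measure (f.integrable _) (f.integrable _), integral_add_measure (f.integrable _) (f.integrable _)]
    linarith
  ext β hβ
  rw [jor s hβ, jor s' hβ]
  have := congrArg (Measure.real · β) key
  beta_reduce at this
  rw [measureReal_add_apply, measureReal_add_apply] at this
  linarith

theorem cm_ext {μ μ' : ComplexMeasure (Rn n)} (h : ∀ f : BoundedContinuousFunction (Rn n) ℝ,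
    cmIntegral μ (fun x => (f x : ℂ)) = cmIntegral μ' (fun x => (f x : ℂ))) : μ = μ' := by
  have h1 : ∀ f : BoundedContinuousFunction (Rn n) ℝ,
      SI (ComplexMeasure.re μ) (fun x => (f x : ℂ)) = SI (ComplexMeasure.re μ') (fun x => (f x : ℂ)) ∧
      SI (ComplexMeasure.im μ) (fun x => (f x : ℂ)) = SI (ComplexMeasure.im μ') (fun x => (f x : ℂ)) := by
    intro f
    have := h f
    rw [cm_SI, cm_SI, SI_real, SI_real, SI_real, SI_real] at this
    have a := congrArg Complex.re this
    have b := congrArg Complex.im this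
    simp only [Complex.add_re, Complex.add_im, Complex.mul_re, Complex.mul_im, Complex.I_re, Complex.I_im, Complex.ofReal_re,
      Complex.ofReal_im] at a b
    rw [SI_real, SI_real, SI_real, SI_real]
    constructor
    · congr 1; linarith
    · congr 1; linarith
  have e1 := SI_ext fun f => (h1 f).1
  have e2 := SI_ext fun f => (h1 f).2
  ext β hβ
  apply Complex.ext
  · rw [← cre, ← cre, e1]
  · rw [← cim, ← cim, e2]

theorem cm_one (μ : ComplexMeasure (Rn n)) : cmIntegral μ (fun _ => ((1:ℝ):ℂ)) = μ Set.univ := by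
  rw [cm_SI, SI_real, SI_real]
  simp only [integral_const, smul_eq_mul, mul_one]
  rw [← jor _ MeasurableSet.univ, ← jor _ MeasurableSet.univ, cre, cim, mul_comm]
  exact Complex.re_add_im _

end conv

end

section

open MeasureTheory Metric Filter Topology
open scoped Pointwise NNReal

section final
variable {n m k : ℕ}

theorem interior_singleton_empty (x : Rn (m+1)) : interior ({x} : Set (Rn (m+1))) = ∅ := by
  let φ : Rn (m+1) →L[ℝ] ℝ := EuclideanSpace.proj (0 : Fin (m+1))
  refine interior_empty_of_subset_hyperplane (φ := φ) (c := φ x) ?_ ?_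
  · intro h
    have := congrArg (fun g : Rn (m+1) →L[ℝ] ℝ => g (EuclideanSpace.single 0 1)) h
    simp [φ] at this
  · rintro y rfl; rfl

/-- cut-off function -/
noncomputable def kf (K : Set (Rn n)) (f : C(Rn n, ℝ)) : Rn n → ℂ := K.indicator fun x => (f x : ℂ)

theorem kf_bm {K : Set (Rn n)} (hK : IsConvexBody K) (f : C(Rn n, ℝ)) : BM (kf K f) := by
  have hc : Continuous fun x => (f x : ℂ) := Complex.continuous_ofReal.comp f.continuous
  refine ⟨hc.measurable.indicator hK.isClosed.measurableSet, ?_⟩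
  obtain ⟨M, hM⟩ := hK.isCompact.exists_bound_of_continuousOn hc.continuousOn
  refine ⟨max M 0, fun x => ?_⟩
  by_cases hx : x ∈ K
  · rw [kf, Set.indicator_of_mem hx]; exact (hM x hx).trans (le_max_left _ _)
  · rw [kf, Set.indicator_of_notMem hx]; simp

theorem kf_lin (K : Set (Rn n)) (f g : C(Rn n, ℝ)) (c : ℝ) :
    kf K (f + g) = (fun x => kf K f x + kf K g x) ∧ kf K (c • f) = fun x => (c:ℂ) * kf K f x := by
  constructor
  · funext x; by_cases hx : x ∈ K <;> simp [kf, hx]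
  · funext x; by_cases hx : x ∈ K <;> simp [kf, hx]

theorem CurvatureMeasure.off (Φ : CurvatureMeasure (m+1))
    (hsimple : ∀ K : Set (Rn (m+1)), IsConvexBody K → interior K = ∅ →
      ∀ β : Set (Rn (m+1)), MeasurableSet β → Φ.meas K β = 0) {K} (hK : IsConvexBody K) {g : Rn (m+1) → ℂ} (hg : BM g)
    (h0 : ∀ x ∈ K, g x = 0) : cmIntegral (Φ.meas K) g = 0 := by
  obtain ⟨x0, hx0⟩ := hK.1
  have := cm_transfer (μ := Φ.meas K) (μ' := Φ.meas K) (T := id) measurable_id (U := Kᶜ) hK.isClosed.measurableSet.compl 0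
    (fun β hβ hU => by
      rw [Φ.locality K {x0} Kᶜ hK (isConvexBody_singleton x0) hK.isClosed.isOpen_compl ?_ β hβ hU,
        hsimple _ (isConvexBody_singleton x0) (interior_singleton_empty x0) β hβ]
      · simp
      · ext x; constructor
        · rintro ⟨h1, h2⟩; exact absurd h1 h2
        · rintro ⟨rfl, h2⟩; exact absurd hx0 h2) hg (fun x hx => h0 x (not_not.1 hx))
  simpa using this

theorem CurvatureMeasure.congr (Φ : CurvatureMeasure (m+1))
    (hsimple : ∀ K : Set (Rn (m+1)), IsConvexBody K → interior K = ∅ →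
      ∀ β : Set (Rn (m+1)), MeasurableSet β → Φ.meas K β = 0) {K} (hK : IsConvexBody K) {f g : Rn (m+1) → ℂ} (hf : BM f) (hg : BM g)
    (h0 : ∀ x ∈ K, f x = g x) : cmIntegral (Φ.meas K) f = cmIntegral (Φ.meas K) g := by
  have hg' : BM (fun x => (-1 : ℂ) * g x) := by
    obtain ⟨M, hM⟩ := hg.2
    exact ⟨hg.1.const_mul _, M, fun x => by simpa using hM x⟩
  have hs : BM (fun x => f x + (-1 : ℂ) * g x) := by
    obtain ⟨M, hM⟩ := hg'.2
    obtain ⟨M', hM'⟩ := hf.2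
    exact ⟨hf.1.add hg'.1, M' + M, fun x => (norm_add_le _ _).trans (add_le_add (hM' x) (hM x))⟩
  have := Φ.off hsimple hK hs (fun x hx => by rw [h0 x hx]; ring)
  rw [cm_add _ hf hg', cm_smul] at this
  linear_combination this

open Classical in
/-- functional attached to a curvature measure -/
noncomputable def CurvatureMeasure.L (Φ : CurvatureMeasure n) (K : Set (Rn n)) : C(Rn n, ℝ) →ₗ[ℝ] ℂ :=
  if h : IsConvexBody K then
    { toFun := fun f => cmIntegral (Φ.meas K) (kf K f)
      map_add' := fun f g => by rw [(kf_lin K f g 0).1, cm_add _ (kf_bm h f) (kf_bm h g)]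
      map_smul' := fun c f => by
        rw [(kf_lin K f f c).2, cm_smul, RingHom.id_apply, Complex.real_smul] }
  else 0

theorem CurvatureMeasure.L_apply (Φ : CurvatureMeasure n) {K : Set (Rn n)} (hK : IsConvexBody K) (f) :
    Φ.L K f = cmIntegral (Φ.meas K) (kf K f) := by
  unfold CurvatureMeasure.L; rw [dif_pos hK]; rfl

theorem CurvatureMeasure.L_bcf (Φ : CurvatureMeasure (m+1))
    (hsimple : ∀ K : Set (Rn (m+1)), IsConvexBody K → interior K = ∅ →
      ∀ β : Set (Rn (m+1)), MeasurableSet β → Φ.meas K β = 0) {K} (hK : IsConvexBody K) (f : C(Rn (m+1), ℝ))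
      (g : BoundedContinuousFunction (Rn (m+1)) ℝ) (h : ∀ x ∈ K, f x = g x) :
    Φ.L K f = cmIntegral (Φ.meas K) (fun x => (g x : ℂ)) := by
  rw [Φ.L_apply hK]
  refine Φ.congr hsimple hK (kf_bm hK f) (bcf_bm g) fun x hx => ?_
  rw [kf, Set.indicator_of_mem hx, h x hx]

noncomputable def CurvatureMeasure.toLoc (Φ : CurvatureMeasure (m+1))
    (hsimple : ∀ K : Set (Rn (m+1)), IsConvexBody K → interior K = ∅ →
      ∀ β : Set (Rn (m+1)), MeasurableSet β → Φ.meas K β = 0) : Loc (m+1) where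
  L := Φ.L
  bound K hK := by
    obtain ⟨C, hC, h⟩ := cm_bound (Φ.meas K)
    refine ⟨C, hC, fun f M hM => ?_⟩
    rw [Φ.L_apply hK]
    refine h _ M fun x => ?_
    by_cases hx : x ∈ K
    · rw [kf, Set.indicator_of_mem hx, Complex.norm_real]; exact hM x hx
    · rw [kf, Set.indicator_of_notMem hx, norm_zero]
      obtain ⟨y, hy⟩ := hK.1
      exact (abs_nonneg _).trans (hM y hy)
  loc K K' U hK hK' hU hKU f hf := by
    rw [Φ.L_apply hK, Φ.L_apply hK']
    have e : kf K f = kf K' f := by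
      funext x
      by_cases hx : x ∈ U
      · have : x ∈ K ↔ x ∈ K' := by
          have := Set.ext_iff.1 hKU x
          simpa [hx] using this
        by_cases hk : x ∈ K
        · rw [kf, kf, Set.indicator_of_mem hk, Set.indicator_of_mem (this.1 hk)]
        · rw [kf, kf, Set.indicator_of_notMem hk, Set.indicator_of_notMem (fun h => hk (this.2 h))]
      · simp [kf, Set.indicator, hf x hx]
    rw [e]
    have := cm_transfer (μ := Φ.meas K') (μ' := Φ.meas K) (T := id) measurable_id (U := U) hU.measurableSet 1
      (fun β hβ hb => by
        rw [Φ.locality K K' U hK hK' hU hKU β hβ hb]; simp) (kf_bm hK' f) (fun x hx => by simp [kf, Set.indicator, hf x hx])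
    simpa using this
  trans K hK a f := by
    rw [Φ.L_apply hK, Φ.L_apply (hK.translate a)]
    have := cm_transfer (μ := Φ.meas K) (μ' := Φ.meas ((fun y => y + a) '' K)) (T := fun y => y + a) (by fun_prop) (U := Set.univ) .univ 1
      (fun β hβ _ => by
        have h := Φ.translation_invariant K hK a ((fun y => y + a) ⁻¹' β) ((by fun_prop : Measurable fun y : Rn (m+1) => y + a) hβ)
        rw [Set.image_preimage_eq β (fun y => ⟨y - a, by simp⟩)] at h
        rw [h]; simp) (kf_bm (hK.translate a) f) (fun x hx => absurd (Set.mem_univ x) hx)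
    rw [this]
    simp only [NNReal.coe_one, Complex.ofReal_one, one_mul]
    congr 1
    funext x
    have hi : x + a ∈ (fun y => y + a) '' K ↔ x ∈ K := (add_left_injective a).mem_set_image
    by_cases hx : x ∈ K
    · rw [kf, kf, Set.indicator_of_mem hx, Set.indicator_of_mem (hi.2 hx)]; rfl
    · rw [kf, kf, Set.indicator_of_notMem hx, Set.indicator_of_notMem (fun h => hx (hi.1 h))]
  cont Ki K hKi hK h f := by
    obtain ⟨M, hM⟩ := (hK.isCompact.cthickening (r := 1)).exists_bound_of_continuousOn f.continuous.continuousOn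
    let g := clampB f M
    let gc : BoundedContinuousFunction (Rn (m+1)) ℂ := BoundedContinuousFunction.ofNormedAddCommGroup (fun x => (g x : ℂ))
      (Complex.continuous_ofReal.comp g.continuous) ‖g‖ (fun x => by rw [Complex.norm_real]; exact g.norm_coe_le_norm x)
    have ht := Φ.continuity Ki K hKi hK h.hausdorff gc
    have e : ∀ K', IsConvexBody K' → K' ⊆ cthickening 1 K → Φ.L K' f = cmIntegral (Φ.meas K') gc := fun K' hK' hs =>
      Φ.L_bcf hsimple hK' f g fun x hx => (clampB_eq f (hM x (hs hx))).symm
    rw [e K hK (self_subset_cthickening K)]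
    refine ht.congr' ?_
    filter_upwards [h 1 one_pos] with i hi
    refine (e _ (hKi i) fun x hx => ?_).symm
    obtain ⟨y, hy, hxy⟩ := hi.1 x hx
    exact mem_cthickening_of_dist_le x y 1 K hy hxy
  simple K hK hi f := by
    rw [Φ.L_apply hK]
    have := cm_transfer (μ := Φ.meas K) (μ' := Φ.meas K) (T := id) measurable_id (U := Set.univ) .univ 0
      (fun β hβ _ => by rw [hsimple K hK hi β hβ]; simp) (kf_bm hK f) (fun x hx => absurd (Set.mem_univ x) hx)
    simpa using this

theorem CurvatureMeasure.toLoc_hom (Φ : CurvatureMeasure (m+1))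
    (hsimple : ∀ K : Set (Rn (m+1)), IsConvexBody K → interior K = ∅ →
      ∀ β : Set (Rn (m+1)), MeasurableSet β → Φ.meas K β = 0) (hh : Φ.Homogeneous k) : (Φ.toLoc hsimple).Hom k := by
  intro t ht K hK f
  change Φ.L _ _ = _ * Φ.L _ _
  rw [Φ.L_apply hK, Φ.L_apply (hK.smul t)]
  have hm : Measurable fun y : Rn (m+1) => t • y := by fun_prop
  have := cm_transfer (μ := Φ.meas K) (μ' := Φ.meas (t • K)) (T := fun y => t • y) hm (U := Set.univ) .univ
    ((t ^ k).toNNReal)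
    (fun β hβ _ => by
      have h := hh t ht K hK ((fun y => t • y) ⁻¹' β) (hm hβ)
      have e : t • ((fun y : Rn (m+1) => t • y) ⁻¹' β) = β := by
        rw [← Set.image_smul, Set.image_preimage_eq β (fun y => ⟨t⁻¹ • y, by simp [smul_smul, ht.ne']⟩)]
      rw [e] at h
      rw [h, Real.coe_toNNReal _ (by positivity), Complex.ofReal_pow]) (kf_bm (hK.smul t) f) (fun x hx => absurd (Set.mem_univ x) hx)
  rw [this, Real.coe_toNNReal _ (by positivity), Complex.ofReal_pow]
  congr 2
  funext x
  have hi : t • x ∈ t • K ↔ x ∈ K := Set.smul_mem_smul_set_iff₀ ht.ne' K x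
  by_cases hx : x ∈ K
  · rw [kf, kf, Set.indicator_of_mem hx, Set.indicator_of_mem (hi.2 hx)]; rfl
  · rw [kf, kf, Set.indicator_of_notMem hx, Set.indicator_of_notMem (fun h => hx (hi.1 h))]

theorem Loc.val_one {Λ : Loc (k+1+1)} (hh : Λ.Hom k) : Val (fun K => Λ.L K 1) k where
  cont Ki K hKi hK h := Λ.cont Ki K hKi hK h _
  trans K hK a := by rw [Λ.trans K hK]; rfl
  simple K hK h := Λ.simple K hK h _
  cut K hK φ' h0 b h1 h2 := Λ.cut hK h0 b h1 h2 _
  even K hK := by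
    have h1 := Loc.parity k (k+1) 1 rfl Λ hh K hK 1
    have h2 : (1 : C(Rn (k+1+1), ℝ)).comp negC = 1 := rfl
    rw [h2] at h1
    rw [h1]; norm_num
  hom t ht K hK := by rw [hh t ht K hK]; rfl

end final

end

/-- A simple translation invariant curvature measure of degree k ≤ n−2 globalizes to zero and
is even; if moreover k ≤ n−3, then it vanishes identically. -/
theorem simple_curvatureMeasure_low_degree (n k : ℕ) (hn : 2 ≤ n) (hk : k + 2 ≤ n)
    (Φ : CurvatureMeasure n) (hhom : Φ.Homogeneous k)
    (hsimple : ∀ K : Set (Rn n), IsConvexBody K → interior K = ∅ →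
      ∀ β : Set (Rn n), MeasurableSet β → Φ.meas K β = 0) :
    (∀ K : Set (Rn n), IsConvexBody K → Φ.meas K Set.univ = 0) ∧
    (∀ K : Set (Rn n), IsConvexBody K → ∀ β : Set (Rn n), MeasurableSet β →
      Φ.meas (-K) (-β) = Φ.meas K β) ∧
    (k + 3 ≤ n → ∀ K : Set (Rn n), IsConvexBody K → ∀ β : Set (Rn n), MeasurableSet β →
      Φ.meas K β = 0) := by
  obtain ⟨m, rfl⟩ : ∃ m, n = m + 1 := ⟨n - 1, by omega⟩
  have hH := Φ.toLoc_hom hsimple hhom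
  have hL : ∀ K f, (Φ.toLoc hsimple).L K f = Φ.L K f := fun _ _ => rfl
  have hzero : k + 3 ≤ m + 1 → ∀ K : Set (Rn (m+1)), IsConvexBody K → ∀ β : Set (Rn (m+1)), MeasurableSet β → Φ.meas K β = 0 := by
    intro h3 K hK β _
    have hv := Loc.vanish (fun ψ hψ K hK => Val.KS 1 2 le_rfl ψ hψ K hK) k m (by omega) (Φ.toLoc hsimple) hH K hK
    have : Φ.meas K = 0 := by
      refine cm_ext fun f => ?_
      rw [← Φ.L_bcf hsimple hK f.toContinuousMap f (fun _ _ => rfl), ← hL, hv]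
      have := cm_transfer (μ := (0 : ComplexMeasure (Rn (m+1)))) (μ' := 0) (T := id) measurable_id (U := Set.univ) .univ 0
        (fun β hβ _ => by simp) (bcf_bm f) (fun x hx => absurd (Set.mem_univ x) hx)
      rw [this]; simp
    rw [this]; rfl
  by_cases h3 : k + 3 ≤ m + 1
  · refine ⟨fun K hK => hzero h3 K hK _ .univ, fun K hK β hβ => ?_, hzero⟩
    rw [hzero h3 K hK β hβ, hzero h3 _ hK.neg _ hβ.neg]
  · obtain rfl : m = k + 1 := by omega
    refine ⟨fun K hK => ?_, fun K hK β hβ => ?_, hzero⟩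
    · have h1 := Val.KS k (k+1) le_rfl _ (Loc.val_one hH) K hK
      rw [hL, Φ.L_bcf hsimple hK 1 (BoundedContinuousFunction.const _ 1) (fun _ _ => rfl)] at h1
      rw [← cm_one]; exact h1
    · have hm : Measurable fun y : Rn (k+1+1) => -y := by fun_prop
      have e : (Φ.meas (-K)).map (fun y => -y) = Φ.meas K := by
        refine cm_ext fun f => ?_
        have h1 := Loc.parity k (k+1) 1 rfl (Φ.toLoc hsimple) hH K hK f.toContinuousMap
        rw [hL, hL, Φ.L_bcf hsimple hK f.toContinuousMap f (fun _ _ => rfl),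
          Φ.L_bcf hsimple hK.neg (f.toContinuousMap.comp negC) (f.compContinuous negC) (fun _ _ => rfl)] at h1
        rw [cm_transfer (μ := Φ.meas (-K)) hm (U := Set.univ) .univ 1
          (fun β hβ _ => by rw [VectorMeasure.map_apply _ hm hβ]; simp) (bcf_bm f) (fun x hx => absurd (Set.mem_univ x) hx)]
        have h2 : cmIntegral (Φ.meas (-K)) (fun x => ((f (-x) : ℝ) : ℂ)) = _ := h1
        rw [h2]; norm_num
      rw [← e, VectorMeasure.map_apply _ hm hβ]; rfl
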